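/- arXiv:2401.10468 — 6 statements merged into one kernel-verified Lean document; each statement's English description precedes it below -/
import Mathlib

section
/- Let λ ≥ 1 be a real number and let G be a finite simple graph with λmin(G) ≥ −λ. If G contains H(a,m) as an induced subgraph (for nonnegative integers a and m), then (a − λ(λ−1))·(m − (λ−1)²) ≤ (λ(λ−1))². -/
open Classical in
/-- `G.adjEigenvalue μ` means that `μ` is an eigenvalue of the (real) adjacency matrix of the
finite simple graph `G`. -/
def SimpleGraph.adjEigenvalue {V : Type*} [Fintype V] (G : SimpleGraph V) (μ : ℝ) : Prop :=
  ∃ w : V → ℝ, w ≠ 0 ∧ Matrix.mulVec (Matrix.of fun i j => if G.Adj i j then (1 : ℝ) else 0) w = μ • w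

/-- If every eigenvalue of the adjacency matrix is at least `-lam`, then `A + lam • 1` is
nonnegative as a quadratic form. -/
theorem SimpleGraph.quadraticForm_nonneg_of_adjEigenvalue_ge {V : Type*} [Fintype V]
    [DecidableEq V] (G : SimpleGraph V) [DecidableRel G.Adj] {lam : ℝ}
    (hmin : ∀ μ : ℝ, G.adjEigenvalue μ → -lam ≤ μ) (w : V → ℝ) :
    0 ≤ ∑ i, (∑ j, (if G.Adj i j then (1 : ℝ) else 0) * w j + lam * w i) * w i := by
  have hA : (G.adjMatrix ℝ + lam • (1 : Matrix V V ℝ)).IsHermitian := by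
    ext i j
    simp [Matrix.one_apply, G.adj_comm, eq_comm]
  have hpsd : (G.adjMatrix ℝ + lam • (1 : Matrix V V ℝ)).PosSemidef := by
    rw [hA.posSemidef_iff_eigenvalues_nonneg]
    intro i
    have hv := hA.mulVec_eigenvectorBasis i
    have hμ : G.adjEigenvalue (hA.eigenvalues i - lam) := by
      refine ⟨(hA.eigenvectorBasis i).ofLp, fun h => ?_, ?_⟩
      · exact hA.eigenvectorBasis.orthonormal.ne_zero i (by ext j; exact congrFun h j)
      · have hM : (Matrix.of fun i j => @ite ℝ (G.Adj i j) (Classical.propDecidable _) 1 0)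
            = G.adjMatrix ℝ := by
          ext i j
          simp [SimpleGraph.adjMatrix_apply]
        rw [hM, sub_smul, ← hv, Matrix.add_mulVec, Matrix.smul_mulVec, Matrix.one_mulVec,
          add_sub_cancel_right]
    have := hmin _ hμ
    simp only [Pi.zero_apply]
    linarith
  have h := hpsd.dotProduct_mulVec_nonneg w
  rw [Matrix.add_mulVec, Matrix.smul_mulVec, Matrix.one_mulVec, dotProduct] at h
  refine h.trans_eq (Finset.sum_congr rfl fun i _ => ?_)
  simp [Matrix.mulVec, dotProduct, SimpleGraph.adjMatrix_apply, mul_comm]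

/-- In a clique `S`, the number of neighbors in `S` of a vertex of `S` is `#S - 1`. -/
theorem SimpleGraph.IsClique.sum_adj_eq {V : Type*} [DecidableEq V] {G : SimpleGraph V}
    [DecidableRel G.Adj] {S : Finset V} (hS : G.IsClique (S : Set V)) {v : V} (hv : v ∈ S) :
    ∑ j ∈ S, (if G.Adj v j then (1 : ℝ) else 0) = S.card - 1 := by
  have h : ∀ j ∈ S, (if G.Adj v j then (1 : ℝ) else 0) = 1 - if v = j then 1 else 0 := by
    intro j hj
    by_cases hvj : v = j
    · simp [hvj]
    · simp [hvj, hS hv hj hvj]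
  rw [Finset.sum_congr rfl h, Finset.sum_sub_distrib]
  simp [hv]

/-- The quadratic form of `A + lam • 1`, evaluated on the vectors that are constant on `{x}`, on
the neighbors of `x` in the clique `K`, and on the non-neighbors of `x` in `K`. -/
theorem SimpleGraph.IsClique.cliqueVertexForm_nonneg {V : Type*} [Fintype V] [DecidableEq V]
    {G : SimpleGraph V} [DecidableRel G.Adj] {lam : ℝ}
    (hmin : ∀ μ : ℝ, G.adjEigenvalue μ → -lam ≤ μ)
    {a m : ℕ} {K : Finset V} {x : V} (hxK : x ∉ K)
    (hK : G.IsClique (K : Set V)) (hKcard : K.card = a + m)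
    (hxa : (K.filter fun y => G.Adj x y).card = a) (s t u : ℝ) :
    0 ≤ (t * a + lam * s) * s + a * ((s + t * (a - 1) + u * m + lam * t) * t)
      + m * ((t * a + u * (m - 1) + lam * u) * u) := by
  set N := K.filter fun y => G.Adj x y with hN
  set M := K.filter fun y => ¬ G.Adj x y with hM
  have hMcard : M.card = m := by
    have : N.card + M.card = K.card := K.card_filter_add_card_filter_not _
    omega
  have hNK : ∀ {v}, v ∈ N → v ∈ K ∧ G.Adj x v := fun h => Finset.mem_filter.1 h
  have hMK : ∀ {v}, v ∈ M → v ∈ K ∧ ¬ G.Adj x v := fun h => Finset.mem_filter.1 h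
  have hNc : G.IsClique (N : Set V) := hK.subset (Finset.coe_subset.2 (Finset.filter_subset _ _))
  have hMc : G.IsClique (M : Set V) := hK.subset (Finset.coe_subset.2 (Finset.filter_subset _ _))
  have hNM : ∀ {v v'}, v ∈ N → v' ∈ M → G.Adj v v' := fun h h' =>
    hK (hNK h).1 (hMK h').1 fun e => (hMK h').2 (e ▸ (hNK h).2)
  set w : V → ℝ := fun j => (if x = j then s else 0) + (if j ∈ N then t else 0)
    + (if j ∈ M then u else 0) with hw
  have hsum (g : V → ℝ) :
      ∑ j, g j * w j = g x * s + (∑ j ∈ N, g j) * t + (∑ j ∈ M, g j) * u := by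
    simp [hw, mul_add, Finset.sum_add_distrib, Finset.sum_mul]
  have hxN : x ∉ N := fun h => hxK (hNK h).1
  have hxM : x ∉ M := fun h => hxK (hMK h).1
  have hwx : w x = s := by simp [hw, hxN, hxM]
  have hwN : ∀ v ∈ N, w v = t := fun v hv => by
    have h1 : x ≠ v := fun e => hxN (e ▸ hv)
    have h2 : v ∉ M := fun h => (hMK h).2 (hNK hv).2
    simp [hw, h1, h2, hv]
  have hwM : ∀ v ∈ M, w v = u := fun v hv => by
    have h1 : x ≠ v := fun e => hxM (e ▸ hv)
    have h2 : v ∉ N := fun h => (hMK hv).2 (hNK h).2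
    simp [hw, h1, h2, hv]
  have hq := G.quadraticForm_nonneg_of_adjEigenvalue_ge hmin w
  simp only [hsum] at hq
  have eN : ∑ j ∈ N, (if G.Adj x j then (1 : ℝ) else 0) = a := by
    rw [Finset.sum_congr rfl fun j hj => if_pos (hNK hj).2]
    simp [hxa]
  have eM : ∑ j ∈ M, (if G.Adj x j then (1 : ℝ) else 0) = 0 :=
    Finset.sum_eq_zero fun j hj => if_neg (hMK hj).2
  have fN : ∀ v ∈ N, ((if G.Adj v x then (1 : ℝ) else 0) * s
      + (∑ j ∈ N, if G.Adj v j then (1 : ℝ) else 0) * t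
      + (∑ j ∈ M, if G.Adj v j then (1 : ℝ) else 0) * u + lam * w v)
      = s + t * (a - 1) + u * m + lam * t := fun v hv => by
    rw [hNc.sum_adj_eq hv, if_pos (hNK hv).2.symm, hwN v hv,
      Finset.sum_congr rfl fun j hj => if_pos (hNM hv hj)]
    simp [hxa, hMcard]
    ring
  have fM : ∀ v ∈ M, ((if G.Adj v x then (1 : ℝ) else 0) * s
      + (∑ j ∈ N, if G.Adj v j then (1 : ℝ) else 0) * t
      + (∑ j ∈ M, if G.Adj v j then (1 : ℝ) else 0) * u + lam * w v)
      = t * a + u * (m - 1) + lam * u := fun v hv => by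
    rw [hMc.sum_adj_eq hv, if_neg fun h => (hMK hv).2 h.symm, hwM v hv,
      Finset.sum_congr rfl fun j hj => if_pos (hNM hj hv).symm]
    simp [hxa, hMcard]
    ring
  rw [Finset.sum_congr rfl fN, Finset.sum_congr rfl fM, eN, eM, hwx] at hq
  simp only [Finset.sum_const, hxa, hMcard, nsmul_eq_mul, G.irrefl, if_false] at hq
  linarith

/-- if `λmin(G) ≥ -λ` and `G` contains `H(a,m)` as an induced subgraph (a clique `K`
of order `a + m` together with a vertex `x ∉ K` having exactly `a` neighbors in `K`), then
`(a − λ(λ−1))·(m − (λ−1)²) ≤ (λ(λ−1))²`. -/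
theorem stmt_0 {V : Type*} [Fintype V] [DecidableEq V] (G : SimpleGraph V) [DecidableRel G.Adj]
    (lam : ℝ) (hlam : 1 ≤ lam)
    (hmin : ∀ μ : ℝ, G.adjEigenvalue μ → -lam ≤ μ)
    (a m : ℕ) (K : Finset V) (x : V) (hxK : x ∉ K)
    (hK : G.IsClique (K : Set V)) (hKcard : K.card = a + m)
    (hxa : (K.filter fun y => G.Adj x y).card = a) :
    ((a : ℝ) - lam * (lam - 1)) * ((m : ℝ) - (lam - 1) ^ 2) ≤ (lam * (lam - 1)) ^ 2 := by
  have ha : (0 : ℝ) ≤ a := a.cast_nonneg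
  have hm : (0 : ℝ) ≤ m := m.cast_nonneg
  have hc : 0 ≤ lam - 1 := sub_nonneg.2 hlam
  have hl : 0 < lam := by linarith
  suffices h : 0 ≤ -(a * (m + (lam - 1))) + lam * (m + (lam - 1)) * (a + (lam - 1))
      - lam * a * m by linarith
  rcases ha.eq_or_lt with ha | ha
  · rw [← ha]
    have : 0 ≤ lam * (m + (lam - 1)) * (lam - 1) := by positivity
    linarith
  rcases hm.eq_or_lt with hm | hm
  · rw [← hm]
    have : 0 ≤ (lam - 1) * (a * (lam - 1) + lam * (lam - 1)) := by positivity
    linarith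
  have hform := hK.cliqueVertexForm_nonneg hmin hxK hKcard hxa
    (-(a * (m + (lam - 1)))) (lam * (m + (lam - 1))) (-(lam * a))
  have hpos : 0 < a * lam * (m + (lam - 1)) := by positivity
  refine nonneg_of_mul_nonneg_right (hform.trans_eq ?_) hpos
  ring
end

section
/- Let λ ≥ 1 be an integer and let G be a finite simple graph with λmin(G) ≥ −λ. Let C be a clique in G of order c. If c ≥ (λ(λ−1))² + λ(λ−1) + (λ−1)² + 2 (equivalently, c ≥ λ⁴ − 2λ³ + 3λ² − 3λ + 3), then every vertex of G outside C has either at most λ(λ−1) neighbors in C, or at least c − (λ−1)² neighbors in C. -/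
namespace SimpleGraph

variable {V : Type*} [Fintype V]

open Classical in
/-- If every adjacency eigenvalue is at least `-l`, then the quadratic form of the adjacency
matrix is bounded below by `-l` times the squared norm. -/
theorem neg_mul_sum_sq_le_of_adjEigenvalue (G : SimpleGraph V) (l : ℝ)
    (hmin : ∀ μ : ℝ, G.adjEigenvalue μ → -l ≤ μ) (v : V → ℝ) :
    0 ≤ ∑ i, v i * (∑ j, (if G.Adj i j then (1 : ℝ) else 0) * v j) + l * ∑ i, v i * v i := by
  set A : Matrix V V ℝ := Matrix.of fun i j => if G.Adj i j then (1 : ℝ) else 0 with hA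
  have hB : (A + l • (1 : Matrix V V ℝ)).IsHermitian := by
    ext i j
    simp [hA, Matrix.one_apply, G.adj_comm, eq_comm]
  have hpsd : (A + l • (1 : Matrix V V ℝ)).PosSemidef := by
    rw [hB.posSemidef_iff_eigenvalues_nonneg]
    intro i
    have h := hB.mulVec_eigenvectorBasis i
    have h2 := hmin (hB.eigenvalues i - l) ⟨(hB.eigenvectorBasis i).ofLp, ?_, ?_⟩
    · simpa using h2
    · intro h0
      apply hB.eigenvectorBasis.toBasis.ne_zero i
      ext k
      simpa using congrFun h0 k
    · rw [Matrix.add_mulVec, Matrix.smul_mulVec, Matrix.one_mulVec] at h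
      rw [sub_smul, ← h]
      simp [hA]
  have h := hpsd.dotProduct_mulVec_nonneg v
  rw [Matrix.add_mulVec, Matrix.smul_mulVec, Matrix.one_mulVec, dotProduct_add,
    dotProduct_smul] at h
  simpa [dotProduct, Matrix.mulVec, hA] using h

/-- The quadratic form of `A + l I` on a vector equal to `t` at `x`, to `p` on the neighbors of `x`
in a clique `C` and to `q` on the other vertices of `C`. -/
theorem clique_quadratic_form_nonneg [DecidableEq V] (G : SimpleGraph V) [DecidableRel G.Adj]
    (l : ℝ) (hmin : ∀ μ : ℝ, G.adjEigenvalue μ → -l ≤ μ)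
    (C : Finset V) (hC : G.IsClique (C : Set V)) (x : V) (hx : x ∉ C) (t p q a b : ℝ)
    (ha : a = (C.filter fun y => G.Adj x y).card) (hb : b = (C.filter fun y => ¬ G.Adj x y).card) :
    0 ≤ l * t ^ 2 + 2 * t * a * p + (a * p + b * q) ^ 2
      + (l - 1) * (a * p ^ 2 + b * q ^ 2) := by
  have hsum : ∀ α β : ℝ, ∑ y ∈ C, (if G.Adj x y then α else β) = a * α + b * β := by
    intro α β
    rw [Finset.sum_ite, Finset.sum_const, Finset.sum_const, nsmul_eq_mul, nsmul_eq_mul, ha, hb]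
  set v : V → ℝ := fun i => if i = x then t else if i ∈ C then (if G.Adj x i then p else q) else 0
    with hv
  have hvx : v x = t := by simp [hv]
  have hvC : ∀ i ∈ C, v i = if G.Adj x i then p else q := by
    intro i hi
    have hne : i ≠ x := fun h => hx (h ▸ hi)
    simp [hv, hi, hne]
  have hsupp : ∀ f : V → ℝ, (∀ i, v i = 0 → f i = 0) → ∑ i, f i = f x + ∑ i ∈ C, f i := by
    intro f hf
    rw [← Finset.sum_insert hx]
    refine (Finset.sum_subset (Finset.subset_univ _) fun i _ hi => hf i ?_).symm
    rw [Finset.mem_insert, not_or] at hi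
    simp [hv, hi.1, hi.2]
  have hS : ∑ i ∈ C, v i = a * p + b * q := by
    rw [Finset.sum_congr rfl hvC, hsum]
  have hrow : ∀ i ∈ C, ∑ j, (if G.Adj i j then (1 : ℝ) else 0) * v j
      = (if G.Adj x i then t else 0) + (a * p + b * q - v i) := by
    intro i hi
    rw [hsupp _ (fun j hj => by simp [hj]), hvx, ← hS,
      ← Finset.add_sum_erase C _ hi, ← Finset.add_sum_erase C v hi]
    have : ∑ j ∈ C.erase i, (if G.Adj i j then (1 : ℝ) else 0) * v j = ∑ j ∈ C.erase i, v j := by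
      refine Finset.sum_congr rfl fun j hj => ?_
      rw [Finset.mem_erase] at hj
      rw [if_pos (hC hi hj.2 (Ne.symm hj.1)), one_mul]
    rw [this]
    simp [G.adj_comm i x]
  have hrowx : ∑ j, (if G.Adj x j then (1 : ℝ) else 0) * v j = a * p := by
    rw [hsupp _ (fun j hj => by simp [hj])]
    have : ∑ j ∈ C, (if G.Adj x j then (1 : ℝ) else 0) * v j
        = ∑ j ∈ C, if G.Adj x j then p else 0 := by
      refine Finset.sum_congr rfl fun j hj => ?_
      rw [hvC j hj]
      split_ifs <;> simp
    rw [this, hsum]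
    simp
  have hsq : ∑ i, v i * v i = t ^ 2 + (a * p ^ 2 + b * q ^ 2) := by
    rw [hsupp _ (fun j hj => by simp [hj]), hvx, ← hsum, sq]
    congr 1
    refine Finset.sum_congr rfl fun j hj => ?_
    rw [hvC j hj]
    split_ifs <;> ring
  have hquad : ∑ i, v i * (∑ j, (if G.Adj i j then (1 : ℝ) else 0) * v j)
      = t * (a * p) + (a * (p * (t + (a * p + b * q - p))) + b * (q * (a * p + b * q - q))) := by
    rw [hsupp _ (fun j hj => by simp [hj]), hvx, hrowx, ← hsum]
    congr 1
    refine Finset.sum_congr rfl fun j hj => ?_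
    rw [hrow j hj, hvC j hj]
    split_ifs <;> ring
  have h := G.neg_mul_sum_sq_le_of_adjEigenvalue l hmin v
  rw [hsq] at h
  have h' : 0 ≤ ∑ i, v i * (∑ j, (if G.Adj i j then (1 : ℝ) else 0) * v j)
      + l * (t ^ 2 + (a * p ^ 2 + b * q ^ 2)) := by
    convert h
  rw [hquad] at h'
  linarith

end SimpleGraph

/-- a vertex outside a large clique `C` has either at most `λ(λ−1)` or at least
`|C| − (λ−1)²` neighbors in `C`. -/
theorem stmt_1 {V : Type*} [Fintype V] [DecidableEq V] (G : SimpleGraph V) [DecidableRel G.Adj]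
    (lam : ℕ) (hlam : 1 ≤ lam)
    (hmin : ∀ μ : ℝ, G.adjEigenvalue μ → -(lam : ℝ) ≤ μ)
    (C : Finset V) (hC : G.IsClique (C : Set V))
    (hc : (lam * (lam - 1)) ^ 2 + lam * (lam - 1) + (lam - 1) ^ 2 + 2 ≤ C.card)
    (x : V) (hx : x ∉ C) :
    (C.filter fun y => G.Adj x y).card ≤ lam * (lam - 1) ∨
      C.card - (lam - 1) ^ 2 ≤ (C.filter fun y => G.Adj x y).card := by
  by_contra! hcon
  obtain ⟨hKa, hac⟩ := hcon
  have hcard := C.card_filter_add_card_filter_not (fun y => G.Adj x y)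
  obtain ⟨m, rfl⟩ : ∃ m, lam = m + 1 := ⟨lam - 1, by omega⟩
  have hform := fun t p q => G.clique_quadratic_form_nonneg _ hmin C hC x hx t p q _ _ rfl rfl
  simp only [Nat.add_sub_cancel] at hc hKa hac
  generalize (C.filter fun y => G.Adj x y).card = a at *
  generalize (C.filter fun y => ¬ G.Adj x y).card = b at *
  have hbm : m ^ 2 + 1 ≤ b := by omega
  rw [← hcard] at hc
  have hc' : (((m : ℝ) + 1) * m) ^ 2 + (m + 1) * m + m ^ 2 + 2 ≤ a + b := by exact_mod_cast hc
  have ha' : ((m : ℝ) + 1) * m + 1 ≤ a := by exact_mod_cast hKa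
  have hb' : (m : ℝ) ^ 2 + 1 ≤ b := by exact_mod_cast hbm
  have hm : (0 : ℝ) ≤ m := m.cast_nonneg
  have h := hform (-(a * (b + m))) ((m + 1) * (b + m)) (-((m + 1) * a))
  push_cast at h
  have hpos : (0 : ℝ) < (m + 1) * (b + m) * a := by
    have : (0 : ℝ) < a := by nlinarith
    have : (0 : ℝ) < b := by nlinarith
    positivity
  have hneg : ((m : ℝ) + 1) * m * (a + b + m) - a * (b + m) < 0 := by
    nlinarith [mul_nonneg (sub_nonneg.2 ha') (sub_nonneg.2 hb')]
  have hprod := mul_neg_of_pos_of_neg hpos hneg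
  refine absurd h (not_le.2 (lt_of_eq_of_lt ?_ hprod))
  ring
end

section
/- Let λ ≥ 1 be an integer, let G be a finite simple graph with λmin(G) ≥ −λ, let t ≥ 1 be an integer, and let P be a t-plex in G of order p. If p ≥ t·((λ(λ−1))² + λ(λ−1) + (λ−1)² + (t−1)·((λ−1)²+1) + 2), then every vertex of G outside P has either at most t·λ(λ−1) neighbors in P, or at least p − t·(λ−1)² neighbors in P. -/
/-- `G.IsPlex t P` means that the finite vertex set `P` induces a `t`-plex in `G`: every vertex
of `P` is adjacent to all but at most `t - 1` of the other vertices of `P`. -/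
def SimpleGraph.IsPlex {V : Type*} [DecidableEq V] (G : SimpleGraph V) [DecidableRel G.Adj]
    (t : ℕ) (P : Finset V) : Prop :=
  ∀ x ∈ P, ((P.erase x).filter fun y => ¬ G.Adj x y).card ≤ t - 1

namespace SimpleGraph

variable {V : Type*} [Fintype V] [DecidableEq V] (G : SimpleGraph V) [DecidableRel G.Adj]

/-- If every adjacency eigenvalue is at least `-l`, then `A + l I` is positive semidefinite. -/
theorem adjMatrix_quadratic_nonneg {l : ℝ} (hmin : ∀ μ : ℝ, G.adjEigenvalue μ → -l ≤ μ)
    (w : V → ℝ) :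
    0 ≤ ∑ i, ∑ j, (if G.Adj i j then w i * w j else 0) + l * ∑ i, w i ^ 2 := by
  have hH : (G.adjMatrix ℝ + l • (1 : Matrix V V ℝ)).IsHermitian := by
    ext i j
    simp [Matrix.one_apply, G.adj_comm, eq_comm]
  have hpsd : (G.adjMatrix ℝ + l • (1 : Matrix V V ℝ)).PosSemidef := by
    rw [hH.posSemidef_iff_eigenvalues_nonneg]
    intro i
    have he := hH.mulVec_eigenvectorBasis i
    have h0 : (hH.eigenvectorBasis i : V → ℝ) ≠ 0 := by
      intro h
      apply hH.eigenvectorBasis.orthonormal.ne_zero i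
      ext j
      exact congrFun h j
    have := hmin (hH.eigenvalues i - l) ⟨_, h0, by
      have hA : (Matrix.of fun i j => @ite ℝ (G.Adj i j) (Classical.propDecidable _) 1 0)
          = G.adjMatrix ℝ := by
        ext i j
        simp [adjMatrix_apply]
      rw [hA, sub_smul, ← he, Matrix.add_mulVec, Matrix.smul_mulVec, Matrix.one_mulVec]
      simp⟩
    simpa using this
  have h := hpsd.dotProduct_mulVec_nonneg w
  rw [star_trivial, Matrix.add_mulVec, Matrix.smul_mulVec, Matrix.one_mulVec, dotProduct_add,
    dotProduct_smul, smul_eq_mul] at h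
  have h1 : ∑ i, ∑ j, (if G.Adj i j then w i * w j else 0)
      = w ⬝ᵥ (G.adjMatrix ℝ).mulVec w := by
    simp only [dotProduct, Matrix.mulVec, Finset.mul_sum, adjMatrix_apply]
    refine Finset.sum_congr rfl fun i _ => Finset.sum_congr rfl fun j _ => ?_
    split_ifs <;> ring
  have h2 : ∑ i, w i ^ 2 = w ⬝ᵥ w := by
    simp [dotProduct, pow_two]
  rwa [h1, h2]

variable {G}

/-- The quadratic form of `A + l I` at a vector with value `α` at `x ∉ P` and `u` on `P`, written
through the non-adjacent pairs of `P`. -/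
theorem plex_quadratic_nonneg {l : ℝ} (hmin : ∀ μ : ℝ, G.adjEigenvalue μ → -l ≤ μ)
    {P : Finset V} {x : V} (hx : x ∉ P) (α : ℝ) (u : V → ℝ) :
    0 ≤ l * α ^ 2 + 2 * α * ∑ y ∈ P.filter (fun y => G.Adj x y), u y + (∑ y ∈ P, u y) ^ 2
      + (l - 1) * ∑ y ∈ P, u y ^ 2
      + ∑ y ∈ P, ∑ z ∈ (P.erase y).filter (fun z => ¬ G.Adj y z), -(u y * u z) := by
  have h := G.adjMatrix_quadratic_nonneg hmin
    (fun v => if v = x then α else if v ∈ P then u v else 0)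
  set w : V → ℝ := fun v => if v = x then α else if v ∈ P then u v else 0 with hw
  have hwx : w x = α := by simp [hw]
  have hwP : ∀ y ∈ P, w y = u y := by
    intro y hy
    have : y ≠ x := fun h => hx (h ▸ hy)
    simp [hw, this, hy]
  have hw0 : ∀ y, y ∉ insert x P → w y = 0 := by
    intro y hy
    simp only [Finset.mem_insert, not_or] at hy
    simp [hw, hy.1, hy.2]
  have hsum : ∀ f : V → ℝ, (∀ y, w y = 0 → f y = 0) → ∑ y, f y = f x + ∑ y ∈ P, f y := by
    intro f hf
    rw [← Finset.sum_insert hx]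
    exact (Finset.sum_subset (Finset.subset_univ _) fun y _ hy => hf y (hw0 y hy)).symm
  have h1 : ∑ i, w i ^ 2 = α ^ 2 + ∑ y ∈ P, u y ^ 2 := by
    rw [hsum _ (by intro y hy; simp [hy]), hwx]
    congr 1
    exact Finset.sum_congr rfl fun y hy => by rw [hwP y hy]
  have h2 : ∀ i, ∑ j, (if G.Adj i j then w i * w j else 0)
      = (if G.Adj i x then w i * α else 0) + ∑ y ∈ P, (if G.Adj i y then w i * u y else 0) := by
    intro i
    rw [hsum _ (by intro y hy; simp [hy]), hwx]
    congr 1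
    exact Finset.sum_congr rfl fun y hy => by rw [hwP y hy]
  have h3 : ∀ y ∈ P, ∑ z ∈ P, (if G.Adj y z then u y * u z else 0)
      = u y * ∑ z ∈ P, u z - u y ^ 2
        + ∑ z ∈ (P.erase y).filter (fun z => ¬ G.Adj y z), -(u y * u z) := by
    intro y hy
    rw [Finset.mul_sum, ← Finset.add_sum_erase P _ hy, ← Finset.add_sum_erase P _ hy,
      Finset.sum_filter]
    simp only [G.loopless.irrefl, if_false]
    rw [show ∀ p q : ℝ, u y * u y + p - u y ^ 2 + q = p + q by intros; ring,
      ← Finset.sum_add_distrib, zero_add]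
    refine Finset.sum_congr rfl fun z _ => ?_
    by_cases hz : G.Adj y z <;> simp [hz]
  have h4 : ∑ i, ∑ j, (if G.Adj i j then w i * w j else 0)
      = 2 * α * ∑ y ∈ P.filter (fun y => G.Adj x y), u y + (∑ y ∈ P, u y) ^ 2 - ∑ y ∈ P, u y ^ 2
      + ∑ y ∈ P, ∑ z ∈ (P.erase y).filter (fun z => ¬ G.Adj y z), -(u y * u z) := by
    rw [Finset.sum_congr rfl fun i _ => h2 i, hsum _ (by intro y hy; simp [hy]), hwx]
    have h5 : ∑ y ∈ P, ((if G.Adj y x then w y * α else 0)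
        + ∑ z ∈ P, (if G.Adj y z then w y * u z else 0))
        = ∑ y ∈ P, ((if G.Adj x y then α * u y else 0)
        + (u y * ∑ z ∈ P, u z - u y ^ 2
        + ∑ z ∈ (P.erase y).filter (fun z => ¬ G.Adj y z), -(u y * u z))) := by
      refine Finset.sum_congr rfl fun y hy => ?_
      rw [← h3 y hy, hwP y hy]
      simp only [G.adj_comm y x, mul_comm (u y) α]
    rw [h5, Finset.sum_add_distrib, Finset.sum_add_distrib, Finset.sum_sub_distrib,
      ← Finset.sum_mul, ← Finset.sum_filter, ← Finset.mul_sum]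
    simp only [G.loopless.irrefl, if_false]
    ring
  rw [h4, h1] at h
  linarith

/-- The test vector constant on the neighbors and on the non-neighbors of `x` in a plex. -/
theorem IsPlex.card_mul_le {k r : ℕ} (hmin : ∀ μ : ℝ, G.adjEigenvalue μ → -((k : ℝ) + 1) ≤ μ)
    {P : Finset V} (hP : G.IsPlex (r + 1) P) {x : V} (hx : x ∉ P) {a b : ℝ}
    (ha : ((P.filter fun y => G.Adj x y).card : ℝ) = a)
    (hb : ((P.filter fun y => ¬ G.Adj x y).card : ℝ) = b) (ha0 : 0 < a) (hb0 : 0 < b) :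
    a * (b + (k + r)) ≤ (k + 1) * (k + r) * (a + b + (k + r)) := by
  have key : ∀ α β γ : ℝ, 0 ≤ (k + 1) * α ^ 2 + 2 * α * (a * β) + (a * β + b * γ) ^ 2
      + (k + r) * (a * β ^ 2 + b * γ ^ 2) := by
    intro α β γ
    set u : V → ℝ := fun y => if G.Adj x y then β else γ with hu
    have h := plex_quadratic_nonneg hmin hx α u
    have e1 : ∑ y ∈ P.filter (fun y => G.Adj x y), u y = a * β := by
      rw [← ha, ← nsmul_eq_mul, ← Finset.sum_const]
      exact Finset.sum_congr rfl fun y hy => by simp [hu, (Finset.mem_filter.1 hy).2]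
    have e2 : ∑ y ∈ P, u y = a * β + b * γ := by
      simp [hu, Finset.sum_ite, ha, hb]
    have e3 : ∑ y ∈ P, u y ^ 2 = a * β ^ 2 + b * γ ^ 2 := by
      simp [hu, ite_pow, Finset.sum_ite, ha, hb]
    have e4 : ∑ y ∈ P, ∑ z ∈ (P.erase y).filter (fun z => ¬ G.Adj y z), -(u y * u z)
        ≤ r * ∑ y ∈ P, u y ^ 2 := by
      have hswap : ∑ y ∈ P, ∑ z ∈ (P.erase y).filter (fun z => ¬ G.Adj y z), u z ^ 2
          = ∑ y ∈ P, ∑ z ∈ (P.erase y).filter (fun z => ¬ G.Adj y z), u y ^ 2 := by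
        apply Finset.sum_comm'
        intro y z
        simp only [Finset.mem_filter, Finset.mem_erase, G.adj_comm y z, ne_comm (a := y)]
        tauto
      have hle : ∑ y ∈ P, ∑ z ∈ (P.erase y).filter (fun z => ¬ G.Adj y z), u y ^ 2
          ≤ r * ∑ y ∈ P, u y ^ 2 := by
        rw [Finset.mul_sum]
        refine Finset.sum_le_sum fun y hy => ?_
        rw [Finset.sum_const, nsmul_eq_mul]
        have := hP y hy
        have h' : ((((P.erase y).filter fun z => ¬ G.Adj y z).card : ℕ) : ℝ) ≤ r := by
          exact_mod_cast this
        exact mul_le_mul_of_nonneg_right h' (sq_nonneg _)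
      have : ∑ y ∈ P, ∑ z ∈ (P.erase y).filter (fun z => ¬ G.Adj y z), -(u y * u z)
          ≤ ∑ y ∈ P, ∑ z ∈ (P.erase y).filter (fun z => ¬ G.Adj y z),
            (u y ^ 2 / 2 + u z ^ 2 / 2) := by
        refine Finset.sum_le_sum fun y _ => Finset.sum_le_sum fun z _ => ?_
        nlinarith [sq_nonneg (u y + u z)]
      simp only [Finset.sum_add_distrib, ← Finset.sum_div] at this
      linarith
    rw [e3] at e4
    rw [e1, e2, e3] at h
    linarith
  have h := key (-(a * (b + (k + r)))) ((k + 1) * (b + (k + r))) (-(a * (k + 1)))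
  have hk : (0 : ℝ) ≤ k := Nat.cast_nonneg k
  have hr : (0 : ℝ) ≤ r := Nat.cast_nonneg r
  have hpos : (0 : ℝ) < (k + 1) * a * (b + (k + r)) := by positivity
  by_contra! hlt
  nlinarith [mul_pos hpos (sub_pos.2 hlt)]

/-- The test vector with value `α` at `x`, `1` on `C` and `-s / |D|` on `D`. -/
theorem IsPlex.quadratic_disjoint_nonneg {k r : ℕ}
    (hmin : ∀ μ : ℝ, G.adjEigenvalue μ → -((k : ℝ) + 1) ≤ μ)
    {P : Finset V} (hP : G.IsPlex (r + 1) P) {x : V} (hx : x ∉ P) {C D : Finset V}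
    (hC : C ⊆ P) (hD : D ⊆ P) (hCD : Disjoint C D) (hD0 : D.Nonempty) (α : ℝ) {s q : ℝ}
    (hs : 0 ≤ s)
    (hq : ((C.filter fun y => G.Adj x y).card : ℝ)
      - s / D.card * (D.filter fun y => G.Adj x y).card = q) :
    0 ≤ (k + 1) * α ^ 2 + 2 * α * q + (C.card - s) ^ 2 + k * C.card
      + (k * s ^ 2 + 2 * s * C.card * r) / D.card := by
  have hd : (0 : ℝ) < D.card := by exact_mod_cast hD0.card_pos
  set c : ℝ := s / D.card with hc
  have hc0 : 0 ≤ c := by positivity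
  set u : V → ℝ := fun y => (if y ∈ C then 1 else 0) - c * (if y ∈ D then 1 else 0) with hu
  have h := plex_quadratic_nonneg hmin hx α u
  have hPC : P ∩ C = C := Finset.inter_eq_right.2 hC
  have hPD : P ∩ D = D := Finset.inter_eq_right.2 hD
  have hnot : ∀ y, ¬ (y ∈ C ∧ y ∈ D) := fun y hy => Finset.disjoint_left.1 hCD hy.1 hy.2
  have e1 : ∑ y ∈ P.filter (fun y => G.Adj x y), u y = q := by
    rw [← hq, Finset.sum_sub_distrib, ← Finset.mul_sum]
    simp only [Finset.sum_boole, Finset.filter_filter]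
    have hF : ∀ E ⊆ P, (P.filter fun y => G.Adj x y ∧ y ∈ E) = E.filter fun y => G.Adj x y := by
      intro E hE
      ext y
      simp only [Finset.mem_filter]
      exact ⟨fun h => ⟨h.2.2, h.2.1⟩, fun h => ⟨hE h.1, h.2, h.1⟩⟩
    rw [hF C hC, hF D hD]
  have e2 : ∑ y ∈ P, u y = C.card - s := by
    rw [Finset.sum_sub_distrib, ← Finset.mul_sum]
    simp only [Finset.sum_boole, Finset.filter_mem_eq_inter, hPC, hPD]
    rw [hc, div_mul_cancel₀ _ hd.ne']
  have e3 : ∑ y ∈ P, u y ^ 2 = C.card + s ^ 2 / D.card := by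
    have : ∀ y ∈ P, u y ^ 2 = (if y ∈ C then 1 else 0) + c ^ 2 * (if y ∈ D then 1 else 0) := by
      intro y _
      have := hnot y
      by_cases h1 : y ∈ C <;> by_cases h2 : y ∈ D <;> simp_all
    rw [Finset.sum_congr rfl this, Finset.sum_add_distrib, ← Finset.mul_sum]
    simp only [Finset.sum_boole, Finset.filter_mem_eq_inter, hPC, hPD]
    rw [hc]
    field_simp
  have e4 : ∑ y ∈ P, ∑ z ∈ (P.erase y).filter (fun z => ¬ G.Adj y z), -(u y * u z)
      ≤ 2 * c * (C.card * r) := by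
    have hswap : ∑ y ∈ P, ∑ z ∈ (P.erase y).filter (fun z => ¬ G.Adj y z),
          (if z ∈ C then (1 : ℝ) else 0)
        = ∑ y ∈ P, ∑ z ∈ (P.erase y).filter (fun z => ¬ G.Adj y z),
          (if y ∈ C then (1 : ℝ) else 0) := by
      apply Finset.sum_comm'
      intro y z
      simp only [Finset.mem_filter, Finset.mem_erase, G.adj_comm y z, ne_comm (a := y)]
      tauto
    have hle : ∑ y ∈ P, ∑ z ∈ (P.erase y).filter (fun z => ¬ G.Adj y z),
          (if y ∈ C then (1 : ℝ) else 0) ≤ C.card * r := by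
      have : ∀ y ∈ P, ∑ z ∈ (P.erase y).filter (fun z => ¬ G.Adj y z),
          (if y ∈ C then (1 : ℝ) else 0) ≤ (if y ∈ C then (1 : ℝ) else 0) * r := by
        intro y hy
        rw [Finset.sum_const, nsmul_eq_mul, mul_comm]
        have h' : ((((P.erase y).filter fun z => ¬ G.Adj y z).card : ℕ) : ℝ) ≤ r := by
          exact_mod_cast hP y hy
        refine mul_le_mul_of_nonneg_left h' ?_
        split_ifs <;> norm_num
      refine (Finset.sum_le_sum this).trans_eq ?_
      rw [← Finset.sum_mul, Finset.sum_boole, Finset.filter_mem_eq_inter, hPC]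
    have : ∑ y ∈ P, ∑ z ∈ (P.erase y).filter (fun z => ¬ G.Adj y z), -(u y * u z)
        ≤ ∑ y ∈ P, ∑ z ∈ (P.erase y).filter (fun z => ¬ G.Adj y z),
          (c * (if y ∈ C then (1 : ℝ) else 0) + c * (if z ∈ C then (1 : ℝ) else 0)) := by
      refine Finset.sum_le_sum fun y _ => Finset.sum_le_sum fun z _ => ?_
      have hind : ∀ (E : Finset V) (v : V),
          0 ≤ (if v ∈ E then (1 : ℝ) else 0) ∧ (if v ∈ E then (1 : ℝ) else 0) ≤ 1 := by
        intro E v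
        split_ifs <;> norm_num
      obtain ⟨hyC, -⟩ := hind C y
      obtain ⟨hzC, -⟩ := hind C z
      obtain ⟨hyD, hyD'⟩ := hind D y
      obtain ⟨hzD, hzD'⟩ := hind D z
      simp only [hu]
      linarith [mul_nonneg hyC hzC, mul_nonneg (mul_nonneg hc0 hyD) (mul_nonneg hc0 hzD),
        mul_nonneg (mul_nonneg hc0 hyC) (sub_nonneg.2 hzD'),
        mul_nonneg (mul_nonneg hc0 hzC) (sub_nonneg.2 hyD')]
    simp only [Finset.sum_add_distrib, ← Finset.mul_sum] at this
    rw [hswap] at this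
    nlinarith [mul_le_mul_of_nonneg_left hle hc0]
  rw [e1, e2, e3] at h
  have e5 : (k * s ^ 2 + 2 * s * C.card * r) / (D.card : ℝ)
      = k * (s ^ 2 / D.card) + 2 * c * (C.card * r) := by
    rw [hc]
    field_simp
  rw [e5]
  linarith

/-- A few neighbors of `x` in a plex against all its non-neighbors. -/
theorem IsPlex.few_neighbors_bound {k r : ℕ}
    (hmin : ∀ μ : ℝ, G.adjEigenvalue μ → -((k : ℝ) + 1) ≤ μ)
    {P : Finset V} (hP : G.IsPlex (r + 1) P) {x : V} (hx : x ∉ P) {n : ℕ}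
    (hn : n ≤ (P.filter fun y => G.Adj x y).card)
    (hb : 0 < (P.filter fun y => ¬ G.Adj x y).card) (α : ℝ) {s : ℝ} (hs : 0 ≤ s) :
    0 ≤ (k + 1) * α ^ 2 + 2 * α * n + (n - s) ^ 2 + k * n
      + (k * s ^ 2 + 2 * s * n * r) / (P.filter fun y => ¬ G.Adj x y).card := by
  obtain ⟨C, hC, rfl⟩ := Finset.exists_subset_card_eq hn
  have hC' : ∀ y ∈ C, G.Adj x y := fun y hy => (Finset.mem_filter.1 (hC hy)).2
  refine hP.quadratic_disjoint_nonneg hmin hx (hC.trans (Finset.filter_subset _ _))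
    (Finset.filter_subset _ _)
    ((Finset.disjoint_filter_filter_not P P _).mono_left hC) (Finset.card_pos.1 hb) α hs ?_
  rw [Finset.filter_true_of_mem hC', Finset.filter_filter]
  simp

/-- A few non-neighbors of `x` in a plex against all its neighbors. -/
theorem IsPlex.few_nonneighbors_bound {k r : ℕ}
    (hmin : ∀ μ : ℝ, G.adjEigenvalue μ → -((k : ℝ) + 1) ≤ μ)
    {P : Finset V} (hP : G.IsPlex (r + 1) P) {x : V} (hx : x ∉ P) {n : ℕ}
    (hn : n ≤ (P.filter fun y => ¬ G.Adj x y).card)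
    (ha : 0 < (P.filter fun y => G.Adj x y).card) (α : ℝ) {s : ℝ} (hs : 0 ≤ s) :
    0 ≤ (k + 1) * α ^ 2 + 2 * α * (-s) + (n - s) ^ 2 + k * n
      + (k * s ^ 2 + 2 * s * n * r) / (P.filter fun y => G.Adj x y).card := by
  obtain ⟨C, hC, rfl⟩ := Finset.exists_subset_card_eq hn
  have hC' : ∀ y ∈ C, ¬ G.Adj x y := fun y hy => (Finset.mem_filter.1 (hC hy)).2
  refine hP.quadratic_disjoint_nonneg hmin hx (hC.trans (Finset.filter_subset _ _))
    (Finset.filter_subset _ _)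
    ((Finset.disjoint_filter_filter_not P P _).symm.mono_left hC) (Finset.card_pos.1 ha) α hs ?_
  have ha' : ((P.filter fun y => G.Adj x y).card : ℝ) ≠ 0 := by exact_mod_cast ha.ne'
  rw [Finset.filter_false_of_mem hC', Finset.filter_filter]
  simp [ha']

end SimpleGraph

theorem plex_product_lt {k r a b : ℝ} (hk : 1 ≤ k) (hr : 0 ≤ r) (hkr : r ≤ (k - 1) * r)
    (ha : (r + 1) * ((k + 1) * k) + 1 ≤ a) (hb : (r + 1) * k ^ 2 + 1 ≤ b)
    (hp : (r + 1) * (((k + 1) * k) ^ 2 + (k + 1) * k + k ^ 2 + r * (k ^ 2 + 1) + 2) ≤ a + b) :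
    (k + 1) * (k + r) * (a + b + (k + r)) < a * (b + (k + r)) := by
  have hκ : k + r ≤ (r + 1) * k := by nlinarith
  have h1 : r + 1 ≤ a - (k + 1) * (k + r) := by nlinarith
  have h2 : r + 1 ≤ b - k * (k + r) := by nlinarith
  have h3 : (k + 1) ^ 2 * (k + r) ^ 2 ≤ (r + 1) ^ 2 * ((k + 1) * k) ^ 2 := by
    have := mul_le_mul hκ hκ (by linarith) (by positivity)
    nlinarith [mul_le_mul_of_nonneg_left this (sq_nonneg (k + 1))]
  have h4 : (r + 1) * (((k + 1) * k) ^ 2 + 2) ≤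
      (a - (k + 1) * (k + r)) + (b - k * (k + r)) := by
    have e1 : (k + 1) * (k + r) ≤ (k + 1) * ((r + 1) * k) :=
      mul_le_mul_of_nonneg_left hκ (by linarith)
    have e2 : k * (k + r) ≤ k * ((r + 1) * k) := mul_le_mul_of_nonneg_left hκ (by linarith)
    have e3 : 0 ≤ (r + 1) * (r * (k ^ 2 + 1)) := by positivity
    nlinarith
  have h5 := mul_nonneg (sub_nonneg.2 h1) (sub_nonneg.2 h2)
  have h6 := mul_le_mul_of_nonneg_left h4 (show 0 ≤ r + 1 by linarith)
  have h7 : (k + 1) ^ 2 * (k + r) ^ 2 < (a - (k + 1) * (k + r)) * (b - k * (k + r)) := by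
    nlinarith
  nlinarith

/-- a vertex outside a large `t`-plex `P` has either at most `t·λ(λ−1)` or at least
`|P| − t·(λ−1)²` neighbors in `P`. -/
theorem stmt_2 {V : Type*} [Fintype V] [DecidableEq V] (G : SimpleGraph V) [DecidableRel G.Adj]
    (lam : ℕ) (hlam : 1 ≤ lam)
    (hmin : ∀ μ : ℝ, G.adjEigenvalue μ → -(lam : ℝ) ≤ μ)
    (t : ℕ) (ht : 1 ≤ t) (P : Finset V) (hP : G.IsPlex t P)
    (hp : t * ((lam * (lam - 1)) ^ 2 + lam * (lam - 1) + (lam - 1) ^ 2 +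
        (t - 1) * ((lam - 1) ^ 2 + 1) + 2) ≤ P.card)
    (x : V) (hx : x ∉ P) :
    (P.filter fun y => G.Adj x y).card ≤ t * (lam * (lam - 1)) ∨
      P.card - t * (lam - 1) ^ 2 ≤ (P.filter fun y => G.Adj x y).card := by
  obtain ⟨k, rfl⟩ := Nat.exists_eq_add_of_le' hlam
  obtain ⟨r, rfl⟩ := Nat.exists_eq_add_of_le' ht
  simp only [Nat.add_sub_cancel] at hp ⊢
  push_cast at hmin
  have hcard := Finset.card_filter_add_card_filter_not (s := P) (fun y => G.Adj x y)
  by_contra! hcon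
  obtain ⟨hA, hB⟩ := hcon
  have hW := fun h1 h2 => hP.card_mul_le hmin hx (a := (P.filter fun y => G.Adj x y).card)
    (b := (P.filter fun y => ¬ G.Adj x y).card) rfl rfl h1 h2
  have hS1 := fun n h1 h2 α s hs =>
    hP.few_neighbors_bound hmin hx (n := n) h1 h2 α (s := s) hs
  have hS2 := fun n h1 h2 α s hs =>
    hP.few_nonneighbors_bound hmin hx (n := n) h1 h2 α (s := s) hs
  generalize (P.filter fun y => G.Adj x y).card = a at *
  generalize (P.filter fun y => ¬ G.Adj x y).card = b at *
  rw [← hcard] at hp hB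
  replace hB : (r + 1) * k ^ 2 + 1 ≤ b := by omega
  replace hA : (r + 1) * ((k + 1) * k) + 1 ≤ a := hA
  have ha0 : 0 < a := by omega
  have hb0 : 0 < b := by omega
  have hA' : ((r : ℝ) + 1) * ((k + 1) * k) + 1 ≤ a := by exact_mod_cast hA
  have hB' : ((r : ℝ) + 1) * k ^ 2 + 1 ≤ b := by exact_mod_cast hB
  have hp' : ((r : ℝ) + 1) * (((k + 1) * k) ^ 2 + (k + 1) * k + k ^ 2 + r * (k ^ 2 + 1) + 2)
      ≤ a + b := by exact_mod_cast hp
  have hr : (0 : ℝ) ≤ r := Nat.cast_nonneg r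
  have haR : (0 : ℝ) < a := by exact_mod_cast ha0
  have hbR : (0 : ℝ) < b := by exact_mod_cast hb0
  have hW := hW haR hbR
  rcases Nat.eq_zero_or_pos k with rfl | hk
  · have h1 := hS1 1 ha0 hb0 (-1) 1 zero_le_one
    have h2 := hS2 1 hb0 ha0 1 1 zero_le_one
    norm_num at h1 h2 hp'
    rw [le_div_iff₀ (by assumption_mod_cast)] at h1 h2
    have h1' : b ≤ 2 * r := by exact_mod_cast (by linarith : (b : ℝ) ≤ 2 * r)
    have h2' : a ≤ 2 * r := by exact_mod_cast (by linarith : (a : ℝ) ≤ 2 * r)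
    norm_num at hp
    rcases r with _ | _ | r <;> nlinarith
  by_cases hkr : 2 ≤ k ∨ r = 0
  · have hkr' : (r : ℝ) ≤ (k - 1) * r := by
      rcases hkr with h | rfl
      · have : (2 : ℝ) ≤ k := by exact_mod_cast h
        nlinarith
      · simp
    exact absurd hW (not_le.2 (plex_product_lt (by exact_mod_cast hk) hr hkr' hA' hB' hp'))
  push Not at hkr
  obtain rfl : k = 1 := by omega
  have hr1 : (1 : ℝ) ≤ r := by exact_mod_cast Nat.one_le_iff_ne_zero.2 hkr.2
  norm_num at hA hB hA' hB' hp' hW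
  rcases Nat.lt_or_ge a ((r + 1) * 2 + 2) with h | h
  · have h1 := hS1 3 (by omega) hb0 (-3 / 2) (27 / 10) (by norm_num)
    have ha' : (a : ℝ) = (r + 1) * 2 + 1 := by
      exact_mod_cast (by omega : a = (r + 1) * 2 + 1)
    norm_num at h1
    have h3 : (141 : ℝ) / 100 ≤ (729 / 100 + 81 / 5 * r) / b := by
      linarith
    rw [le_div_iff₀ hbR] at h3
    nlinarith [sq_nonneg ((r : ℝ) - 6 / 10)]
  rcases Nat.lt_or_ge b (r + 1 + 2) with h' | h'
  · have h1 := hS2 2 (by omega) ha0 2 4 (by norm_num)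
    have hb' : (b : ℝ) = r + 1 + 1 := by
      exact_mod_cast (by omega : b = r + 1 + 1)
    norm_num at h1
    have h3 : (2 : ℝ) ≤ (16 + 16 * r) / a := by
      linarith
    rw [le_div_iff₀ haR] at h3
    nlinarith
  have h1 : ((r : ℝ) + 1) * 2 + 2 ≤ a := by exact_mod_cast h
  have h2 : (r : ℝ) + 1 + 2 ≤ b := by exact_mod_cast h'
  nlinarith [mul_nonneg (sub_nonneg.2 h1) (sub_nonneg.2 h2)]
end

section
/- Let λ ≥ 1 be an integer. There exists a positive integer n₁(λ) with n₁(λ) ≥ ((λ−1)²+1)·((λ(λ−1))² + λ(λ−1) + (λ−1)² + (λ−1)²·((λ−1)²+1) + 2) such that for every integer n ≥ n₁(λ) there exist integers K₁(λ,n) and C₁(λ,n) with the following property. For every connected k-regular finite simple graph G with λmin(G) ≥ −λ and k ≥ K₁(λ,n), there exist ((λ−1)²+1)-plexes P₁, P₂, …, P_s in G satisfying: (1) every vertex x of G lies in at least 1 and at most λ of the plexes P₁, …, P_s; (2) for every vertex x of G, the number of neighbors y of x such that no Pᵢ contains both x and y is at most C₁(λ,n); (3) each Pᵢ has at least n vertices;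 (4) |V(Pᵢ) ∩ V(Pⱼ)| ≤ λ−1 for all 1 ≤ i < j ≤ s; (5) for each i, every vertex of G not in Pᵢ has at most ((λ−1)²+1)·λ(λ−1) neighbors in Pᵢ. -/
open Finset

namespace SimpleGraph

/-- The real-valued indicator function of a finite set of vertices. -/
def ind {V : Type*} [DecidableEq V] (S : Finset V) : V → ℝ := fun v => if v ∈ S then 1 else 0

theorem sum_ind {V : Type*} [DecidableEq V] (P S : Finset V) : ∑ v ∈ P, ind S v = (P ∩ S).card := by
  simp [ind]

section Energy

variable {V : Type*} [Fintype V] [DecidableEq V] (G : SimpleGraph V) [DecidableRel G.Adj]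

/-- The bilinear form of the matrix `A + l • 1`, where `A` is the adjacency matrix of `G`. -/
noncomputable def energy (l : ℝ) : LinearMap.BilinForm ℝ (V → ℝ) :=
  Matrix.toBilin' (G.adjMatrix ℝ + l • (1 : Matrix V V ℝ))

theorem energy_symm (l : ℝ) (w z : V → ℝ) : G.energy l w z = G.energy l z w := by
  simp only [energy, Matrix.toBilin'_apply]
  rw [Finset.sum_comm]
  refine Finset.sum_congr rfl fun u _ => Finset.sum_congr rfl fun v _ => ?_
  simp only [Matrix.add_apply, adjMatrix_apply, Matrix.smul_apply, Matrix.one_apply,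
    G.adj_comm v u, eq_comm (a := v) (b := u)]
  ring

theorem energy_ind (l : ℝ) (w : V → ℝ) (S : Finset V) :
    G.energy l w (ind S) =
      ∑ v, w v * ((S.filter fun y => G.Adj v y).card + if v ∈ S then l else 0) := by
  simp only [energy, Matrix.toBilin'_apply]
  refine Finset.sum_congr rfl fun u _ => ?_
  simp only [mul_assoc, ← Finset.mul_sum]
  congr 1
  simp [ind, Matrix.one_apply, Finset.sum_add_distrib]

theorem energy_ind_ind (l : ℝ) (R S : Finset V) :
    G.energy l (ind R) (ind S) =
      ∑ v ∈ R, ((S.filter fun y => G.Adj v y).card + if v ∈ S then l else 0) := by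
  rw [energy_ind]
  simp [ind]

theorem energy_singleton (l : ℝ) (x : V) : G.energy l (ind {x}) (ind {x}) = l := by
  simp [energy_ind_ind, Finset.filter_singleton]

theorem energy_ind_self_le (l : ℝ) (S : Finset V) :
    G.energy l (ind S) (ind S) ≤ S.card * (S.card - 1 + l) := by
  rw [energy_ind_ind, ← nsmul_eq_mul]
  refine Finset.sum_le_card_nsmul _ _ _ fun v hv => ?_
  have h : (S.filter fun y => G.Adj v y) ⊆ S.erase v := fun y hy => by
    simp only [Finset.mem_filter, Finset.mem_erase] at hy ⊢
    exact ⟨hy.2.ne', hy.1⟩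
  have h2 := Finset.card_le_card h
  rw [Finset.card_erase_of_mem hv] at h2
  have h3 : 1 ≤ S.card := Finset.card_pos.2 ⟨v, hv⟩
  have h4 : ((S.filter fun y => G.Adj v y).card : ℝ) ≤ ((S.card - 1 : ℕ) : ℝ) := by
    exact_mod_cast h2
  rw [Nat.cast_sub h3] at h4
  simp only [hv, if_true]
  push_cast at h4
  linarith

theorem energy_independent (l : ℝ) {S : Finset V} (h : ∀ x ∈ S, ∀ y ∈ S, ¬ G.Adj x y) :
    G.energy l (ind S) (ind S) = S.card * l := by
  rw [energy_ind_ind, ← nsmul_eq_mul]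
  refine Finset.sum_eq_card_nsmul fun v hv => ?_
  rw [Finset.filter_false_of_mem (h v hv)]
  simp [hv]

theorem energy_complete (l : ℝ) {R S : Finset V} (h : ∀ x ∈ R, ∀ y ∈ S, G.Adj x y) :
    G.energy l (ind R) (ind S) = R.card * S.card := by
  rw [energy_ind_ind, ← nsmul_eq_mul]
  refine Finset.sum_eq_card_nsmul fun v hv => ?_
  have hvS : v ∉ S := fun hS => G.irrefl (h v hv v hS)
  rw [Finset.filter_true_of_mem (h v hv)]
  simp [hvS]

theorem energy_empty (l : ℝ) {R S : Finset V} (h : ∀ x ∈ R, ∀ y ∈ S, x ≠ y ∧ ¬ G.Adj x y) :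
    G.energy l (ind R) (ind S) = 0 := by
  rw [energy_ind_ind]
  refine Finset.sum_eq_zero fun v hv => ?_
  have hvS : v ∉ S := fun hS => (h v hv v hS).1 rfl
  rw [Finset.filter_false_of_mem fun y hy => (h v hv y hy).2]
  simp [hvS]

theorem energy_nonneg {l : ℝ} (h : ∀ μ : ℝ, G.adjEigenvalue μ → -l ≤ μ) (w : V → ℝ) :
    0 ≤ G.energy l w w := by
  have hH : (G.adjMatrix ℝ + l • (1 : Matrix V V ℝ)).IsHermitian := by
    refine Matrix.IsHermitian.add ?_ ?_
    · rw [Matrix.IsHermitian, Matrix.conjTranspose_eq_transpose_of_trivial]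
      exact G.isSymm_adjMatrix
    · simp [Matrix.IsHermitian]
  have hP : (G.adjMatrix ℝ + l • (1 : Matrix V V ℝ)).PosSemidef := by
    rw [hH.posSemidef_iff_eigenvalues_nonneg]
    intro i
    have hv := hH.mulVec_eigenvectorBasis i
    have h1 : -l ≤ hH.eigenvalues i - l := by
      refine h _ ⟨(hH.eigenvectorBasis i).ofLp, ?_, ?_⟩
      · intro h0
        refine hH.eigenvectorBasis.orthonormal.ne_zero i ?_
        ext v
        simpa using congrFun h0 v
      · rw [Matrix.add_mulVec, Matrix.smul_mulVec, Matrix.one_mulVec] at hv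
        rw [sub_smul, ← hv, add_sub_cancel_right]
        congr 1
        ext i j
        simp [adjMatrix_apply]
    simp only [Pi.zero_apply]
    linarith
  have := hP.dotProduct_mulVec_nonneg w
  simpa only [energy, Matrix.toBilin'_apply', star_trivial] using this

end Energy

section Forbidden

variable {V : Type*} [Fintype V] [DecidableEq V] {G : SimpleGraph V} [DecidableRel G.Adj] {l : ℕ}

theorem card_le_of_half_adjacent (hE : ∀ w, 0 ≤ G.energy l w w) {x : V} {S T : Finset V}
    (hST : S.card = T.card)
    (h : ∀ s ∈ S, ∀ t ∈ T, G.Adj s t)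
    (hxS : ∀ s ∈ S, G.Adj x s) (hxT : ∀ t ∈ T, x ≠ t ∧ ¬ G.Adj x t) : S.card ≤ l ^ 3 := by
  have key := hE ((l : ℝ) • ind {x} + (ind T - ind S))
  have h1 := G.energy_singleton l x
  have h2 := G.energy_ind_self_le l S
  have h3 := G.energy_ind_self_le l T
  have h4 : G.energy l (ind S) (ind T) = S.card * T.card := G.energy_complete l h
  have h5 : G.energy l (ind {x}) (ind S) = S.card := by
    rw [G.energy_complete l (by simpa using hxS)]; simp
  have h6 : G.energy l (ind {x}) (ind T) = 0 := G.energy_empty l (by simpa using hxT)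
  simp only [map_add, map_smul, map_sub, LinearMap.add_apply, LinearMap.smul_apply,
    LinearMap.sub_apply, smul_eq_mul, G.energy_symm l (ind S) (ind {x}),
    G.energy_symm l (ind T) (ind {x}), G.energy_symm l (ind T) (ind S), h1, h4, h5, h6] at key
  rw [← hST] at key h3
  have h7 : (S.card : ℝ) ≤ (l : ℝ) ^ 3 := by nlinarith [(Nat.cast_nonneg S.card : (0 : ℝ) ≤ _)]
  exact_mod_cast h7

theorem not_claw (hl : 1 ≤ l) (hE : ∀ w, 0 ≤ G.energy l w w) {x : V} {S : Finset V}
    (hS : ∀ s ∈ S, ∀ t ∈ S, ¬ G.Adj s t) (hx : ∀ s ∈ S, G.Adj x s) : S.card ≤ l ^ 2 := by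
  have key := hE (ind S - (l : ℝ) • ind {x})
  have h1 := G.energy_singleton l x
  have h2 := G.energy_independent l hS
  have h5 : G.energy l (ind {x}) (ind S) = S.card := by
    rw [G.energy_complete l (by simpa using hx)]; simp
  simp only [map_smul, map_sub, LinearMap.smul_apply,
    LinearMap.sub_apply, smul_eq_mul, G.energy_symm l (ind S) (ind {x}), h1, h2, h5] at key
  have hl' : (0 : ℝ) < l := by exact_mod_cast hl
  have h7 : (S.card : ℝ) ≤ (l : ℝ) ^ 2 := by
    by_contra hc
    nlinarith [mul_pos hl' (sub_pos.2 (not_le.1 hc))]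
  exact_mod_cast h7

end Forbidden

theorem exists_clique_or_independent (a b : ℕ) : ∃ R : ℕ, ∀ (V : Type) [DecidableEq V]
    (G : SimpleGraph V) [DecidableRel G.Adj] (S : Finset V), R ≤ S.card →
      (∃ T ⊆ S, T.card = a ∧ G.IsClique T) ∨
        ∃ T ⊆ S, T.card = b ∧ ∀ x ∈ T, ∀ y ∈ T, ¬ G.Adj x y := by
  induction a generalizing b with
  | zero => exact ⟨0, fun V _ G _ S _ => Or.inl ⟨∅, by simp⟩⟩
  | succ a iha =>
    induction b with
    | zero => exact ⟨0, fun V _ G _ S _ => Or.inr ⟨∅, by simp⟩⟩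
    | succ b ihb =>
      obtain ⟨R₁, h₁⟩ := iha (b + 1)
      obtain ⟨R₂, h₂⟩ := ihb
      refine ⟨R₁ + R₂ + 1, fun V _ G _ S hS => ?_⟩
      obtain ⟨x, hx⟩ : S.Nonempty := Finset.card_pos.1 (by omega)
      have hc := Finset.card_filter_add_card_filter_not (s := S.erase x) (fun y => G.Adj x y)
      rw [Finset.card_erase_of_mem hx] at hc
      by_cases hR : R₁ ≤ ((S.erase x).filter fun y => G.Adj x y).card
      · obtain ⟨T, hT, hTc, hT'⟩ | ⟨T, hT, hT'⟩ := h₁ V G _ hR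
        · refine Or.inl ⟨insert x T, ?_, ?_, ?_⟩
          · intro y hy
            obtain rfl | hy := Finset.mem_insert.1 hy
            · exact hx
            · exact Finset.mem_of_mem_erase (Finset.mem_filter.1 (hT hy)).1
          · rw [Finset.card_insert_of_notMem, hTc]
            exact fun h => by simpa using hT h
          · rw [Finset.coe_insert, isClique_insert]
            exact ⟨hT', fun y hy _ => (Finset.mem_filter.1 (hT hy)).2⟩
        · exact Or.inr ⟨T, hT.trans ((Finset.filter_subset _ _).trans (Finset.erase_subset _ _)),
            hT'⟩
      · obtain ⟨T, hT, hT'⟩ | ⟨T, hT, hTc, hT'⟩ :=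
          h₂ V G ((S.erase x).filter fun y => ¬ G.Adj x y) (by omega)
        · exact Or.inl ⟨T, hT.trans ((Finset.filter_subset _ _).trans (Finset.erase_subset _ _)),
            hT'⟩
        · refine Or.inr ⟨insert x T, ?_, ?_, ?_⟩
          · intro y hy
            obtain rfl | hy := Finset.mem_insert.1 hy
            · exact hx
            · exact Finset.mem_of_mem_erase (Finset.mem_filter.1 (hT hy)).1
          · rw [Finset.card_insert_of_notMem, hTc]
            exact fun h => by simpa using hT h
          · have hn : ∀ y ∈ T, ¬ G.Adj x y := fun y hy => (Finset.mem_filter.1 (hT hy)).2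
            intro y hy z hz
            obtain rfl | hyT := Finset.mem_insert.1 hy <;>
              obtain rfl | hzT := Finset.mem_insert.1 hz
            · exact G.irrefl
            · exact hn z hzT
            · exact fun h => hn y hyT h.symm
            · exact hT' y hyT z hzT

/-- Vertices each with few bad elements in a large set leave many elements good for all. -/
theorem exists_subset_avoiding {V : Type*} [DecidableEq V] {m q : ℕ} (C W : Finset V) (B : V → Finset V)
    (hB : ∀ v ∈ W, (B v).card ≤ m) (hC : q + W.card * m ≤ C.card) :
    ∃ D ⊆ C, D.card = q ∧ ∀ v ∈ W, ∀ y ∈ D, y ∉ B v := by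
  have h1 := Finset.card_biUnion_le_card_mul W B m hB
  have h2 := Finset.le_card_sdiff (W.biUnion B) C
  obtain ⟨D, hD, hDc⟩ := Finset.exists_subset_card_eq (s := C \ W.biUnion B) (n := q) (by omega)
  refine ⟨D, hD.trans Finset.sdiff_subset, hDc, fun v hv y hy hyB => ?_⟩
  exact (Finset.mem_sdiff.1 (hD hy)).2 (Finset.mem_biUnion.2 ⟨v, hv, hyB⟩)

section QuasiClique

variable {V : Type*} [Fintype V] [DecidableEq V]

/-- The vertices adjacent to all but at most `m` of the other vertices of `C`. -/
def nearSet (G : SimpleGraph V) [DecidableRel G.Adj] (m : ℕ) (C : Finset V) : Finset V :=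
  univ.filter fun x => (C.filter fun y => x ≠ y ∧ ¬ G.Adj x y).card ≤ m

/-- `P` is the set of vertices near to some clique of size `N`. -/
def IsQuasiClique (G : SimpleGraph V) [DecidableRel G.Adj] (m N : ℕ) (P : Finset V) : Prop :=
  ∃ C : Finset V, G.IsClique C ∧ C.card = N ∧ G.nearSet m C = P

variable {G : SimpleGraph V} [DecidableRel G.Adj] {l : ℕ}

theorem mem_nearSet {m : ℕ} {C : Finset V} {x : V} :
    x ∈ G.nearSet m C ↔ (C.filter fun y => x ≠ y ∧ ¬ G.Adj x y).card ≤ m := by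
  simp [nearSet]

theorem IsClique.subset_nearSet {m : ℕ} {C : Finset V} (hC : G.IsClique C) :
    C ⊆ G.nearSet m C := by
  intro x hx
  rw [mem_nearSet, Finset.filter_false_of_mem]
  · simp
  · rintro y hy ⟨h, h'⟩
    exact h' (hC hx hy h)

theorem card_adj_le_of_notMem_nearSet (hE : ∀ w, 0 ≤ G.energy l w w) {C : Finset V}
    (hC : G.IsClique C) {x : V} (hx : x ∉ G.nearSet (l ^ 3) C) :
    (C.filter fun y => G.Adj x y).card ≤ l ^ 3 := by
  by_contra! h
  rw [mem_nearSet, not_le] at hx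
  obtain ⟨S, hS, hSc⟩ := Finset.exists_subset_card_eq h
  obtain ⟨T, hT, hTc⟩ := Finset.exists_subset_card_eq hx
  have hS' := fun s (hs : s ∈ S) => Finset.mem_filter.1 (hS hs)
  have hT' := fun t (ht : t ∈ T) => Finset.mem_filter.1 (hT ht)
  have := card_le_of_half_adjacent hE (x := x) (S := S) (T := T) (hSc.trans hTc.symm)
    (fun s hs t ht => hC (hS' s hs).1 (hT' t ht).1 fun h => (hT' t ht).2.2 (h ▸ (hS' s hs).2))
    (fun s hs => (hS' s hs).2) (fun t ht => (hT' t ht).2)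
  omega

theorem nearSet_eq_of_card_inter (hE : ∀ w, 0 ≤ G.energy l w w) {C C' : Finset V}
    (hC : G.IsClique C) (hC' : G.IsClique C')
    (hN : (l ^ 3 + 1) + (l ^ 3 + 2) * (l ^ 3 + 1) ≤ C.card)
    (h : 2 * l ^ 3 + 1 < (C' ∩ G.nearSet (l ^ 3) C).card) :
    G.nearSet (l ^ 3) C = G.nearSet (l ^ 3) C' := by
  have bad : ∀ v ∈ G.nearSet (l ^ 3) C,
      (C.filter fun y => v = y ∨ ¬ G.Adj v y).card ≤ l ^ 3 + 1 := by
    intro v hv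
    rw [mem_nearSet] at hv
    have : (C.filter fun y => v = y ∨ ¬ G.Adj v y) ⊆
        insert v (C.filter fun y => v ≠ y ∧ ¬ G.Adj v y) := by
      intro y hy
      simp only [Finset.mem_filter, Finset.mem_insert] at hy ⊢
      tauto
    exact (Finset.card_le_card this).trans ((Finset.card_insert_le _ _).trans (by omega))
  ext x
  by_contra hne
  by_cases hx : x ∈ G.nearSet (l ^ 3) C
  · have hx' : x ∉ G.nearSet (l ^ 3) C' := fun h => hne ⟨fun _ => h, fun _ => hx⟩
    have h1 := card_adj_le_of_notMem_nearSet hE hC' hx'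
    have h2 := Finset.le_card_sdiff (C'.filter fun y => G.Adj x y) (C' ∩ G.nearSet (l ^ 3) C)
    obtain ⟨T, hT, hTc⟩ := Finset.exists_subset_card_eq (n := l ^ 3 + 1)
      (s := (C' ∩ G.nearSet (l ^ 3) C) \ C'.filter fun y => G.Adj x y) (by omega)
    have hT' : ∀ t ∈ T, t ∈ C' ∧ t ∈ G.nearSet (l ^ 3) C ∧ ¬ G.Adj x t := fun t ht => by
      have := hT ht
      simp only [Finset.mem_sdiff, Finset.mem_inter, Finset.mem_filter] at this
      tauto
    obtain ⟨D, hD, hDc, hD'⟩ := exists_subset_avoiding (q := l ^ 3 + 1) C (insert x T)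
      (fun v => C.filter fun y => v = y ∨ ¬ G.Adj v y) (m := l ^ 3 + 1)
      (fun v hv => by
        obtain rfl | hv := Finset.mem_insert.1 hv
        · exact bad _ hx
        · exact bad _ (hT' v hv).2.1)
      (by have := Finset.card_insert_le x T
          have := Nat.mul_le_mul_right (l ^ 3 + 1) (this.trans_eq (congrArg (· + 1) hTc))
          simp only [add_assoc, Nat.reduceAdd] at this
          omega)
    have hadj : ∀ v ∈ insert x T, ∀ y ∈ D, G.Adj v y := fun v hv y hy => by
      have := hD' v hv y hy
      simp only [Finset.mem_filter, hD hy, true_and] at this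
      tauto
    have := card_le_of_half_adjacent hE (x := x) (S := D) (T := T) (hDc.trans hTc.symm)
      (fun s hs t ht => (hadj t (Finset.mem_insert_of_mem ht) s hs).symm)
      (fun s hs => hadj x (Finset.mem_insert_self _ _) s hs)
      (fun t ht => ⟨fun h => hx' (h ▸ hC'.subset_nearSet (hT' t ht).1), (hT' t ht).2.2⟩)
    omega
  · have hx' : x ∈ G.nearSet (l ^ 3) C' := by tauto
    have h1 := card_adj_le_of_notMem_nearSet hE hC hx
    have hxC : x ∉ C := fun h => hx (hC.subset_nearSet h)
    have h2 := Finset.le_card_sdiff (C'.filter fun y => x ≠ y ∧ ¬ G.Adj x y)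
      (C' ∩ G.nearSet (l ^ 3) C)
    rw [mem_nearSet] at hx'
    obtain ⟨T, hT, hTc⟩ := Finset.exists_subset_card_eq (n := l ^ 3 + 1)
      (s := (C' ∩ G.nearSet (l ^ 3) C) \ C'.filter fun y => x ≠ y ∧ ¬ G.Adj x y) (by omega)
    have hT' : ∀ t ∈ T, t ∈ C' ∧ t ∈ G.nearSet (l ^ 3) C ∧ G.Adj x t := fun t ht => by
      have := hT ht
      simp only [Finset.mem_sdiff, Finset.mem_inter, Finset.mem_filter] at this
      have hxt : x ≠ t := fun h => hx (h ▸ this.1.2)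
      tauto
    obtain ⟨D, hD, hDc, hD'⟩ := exists_subset_avoiding (q := l ^ 3 + 1) C (insert x T)
      (fun v => C.filter fun y => if v = x then G.Adj v y else v = y ∨ ¬ G.Adj v y)
      (m := l ^ 3 + 1)
      (fun v hv => by
        by_cases hvx : v = x
        · subst hvx
          simp only [if_true]
          omega
        · simp only [hvx, if_false]
          exact bad _ (hT' v (Finset.mem_of_mem_insert_of_ne hv hvx)).2.1)
      (by have := Finset.card_insert_le x T
          have := Nat.mul_le_mul_right (l ^ 3 + 1) (this.trans_eq (congrArg (· + 1) hTc))
          simp only [add_assoc, Nat.reduceAdd] at this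
          omega)
    have hadj : ∀ v ∈ T, ∀ y ∈ D, G.Adj v y := fun v hv y hy => by
      have := hD' v (Finset.mem_insert_of_mem hv) y hy
      have hvx : v ≠ x := (hT' v hv).2.2.ne'
      simp only [Finset.mem_filter, hD hy, true_and, hvx, if_false] at this
      tauto
    have hnadj : ∀ y ∈ D, ¬ G.Adj x y := fun y hy => by
      have := hD' x (Finset.mem_insert_self _ _) y hy
      simpa only [Finset.mem_filter, hD hy, true_and, if_true] using this
    have := card_le_of_half_adjacent hE (x := x) (S := T) (T := D) (hTc.trans hDc.symm)
      hadj (fun t ht => (hT' t ht).2.2)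
      (fun s hs => ⟨fun h => hxC (h ▸ hD hs), hnadj s hs⟩)
    omega

theorem energy_sub_smul_ind_le {w : V → ℝ} {P D : Finset V} {q : ℕ} (hq : 0 < q)
    (hD : D.card = q) (hin : ∀ v ∈ P, w v ≠ 0 → v ∉ D ∧ ∀ y ∈ D, G.Adj v y)
    (hout : ∀ v ∉ P, w v ≠ 0 → v ∉ D ∧ ∀ y ∈ D, ¬ G.Adj v y) :
    G.energy l (w - ((∑ v ∈ P, w v) / q) • ind D) (w - ((∑ v ∈ P, w v) / q) • ind D) ≤
      G.energy l w w - (1 - (l : ℝ) / q) * (∑ v ∈ P, w v) ^ 2 := by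
  set s := ∑ v ∈ P, w v with hs
  have h1 : G.energy l w (ind D) = q * s := by
    rw [energy_ind, hs, Finset.mul_sum, ← Finset.sum_subset (Finset.subset_univ P)]
    · refine Finset.sum_congr rfl fun v hv => ?_
      by_cases h0 : w v = 0
      · simp [h0]
      · rw [Finset.filter_true_of_mem (hin v hv h0).2, hD]
        simp [(hin v hv h0).1, mul_comm]
    · intro v _ hv
      by_cases h0 : w v = 0
      · simp [h0]
      · rw [Finset.filter_false_of_mem (hout v hv h0).2]
        simp [(hout v hv h0).1]
  have h2 := G.energy_ind_self_le l D
  have hq' : (0 : ℝ) < q := by exact_mod_cast hq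
  rw [hD] at h2
  simp only [map_smul, map_sub, LinearMap.smul_apply, LinearMap.sub_apply, smul_eq_mul,
    G.energy_symm l (ind D) w, h1]
  have h3 : (s / q) ^ 2 * G.energy l (ind D) (ind D) ≤ (s / q) ^ 2 * (q * (q - 1 + l)) :=
    mul_le_mul_of_nonneg_left h2 (sq_nonneg _)
  have h4 : (s / q) ^ 2 * (q * (q - 1 + l)) = s ^ 2 - s ^ 2 / q + l / q * s ^ 2 := by
    field_simp
  have h5 : s / q * (q * s) = s ^ 2 := by field_simp
  have h6 : 0 ≤ s ^ 2 / q := by positivity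
  nlinarith

theorem IsQuasiClique.le_card {m N : ℕ} {P : Finset V} (h : G.IsQuasiClique m N P) :
    N ≤ P.card := by
  obtain ⟨C, hC, rfl, rfl⟩ := h
  exact Finset.card_le_card hC.subset_nearSet

/-- Attaching to a weight function, for each quasi-clique `P`, a small clique that is complete to
the support inside `P` and anticomplete to the support outside `P`. -/
theorem exists_attached_weight (hE : ∀ w, 0 ≤ G.energy l w w) {N q : ℕ} (hq : 0 < q)
    {F : Finset (Finset V)} (hF : ∀ P ∈ F, G.IsQuasiClique (l ^ 3) N P) {U : Finset V}
    (hN₀ : (l ^ 3 + 1) + (l ^ 3 + 2) * (l ^ 3 + 1) ≤ N)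
    (hN : q + F.card * (2 * l ^ 3 + 1) + (U.card + F.card * q) * (l ^ 3 + 1) ≤ N) {a : V → ℝ}
    (ha : ∀ v ∉ U, a v = 0) (E : Finset (Finset V)) (hEF : E ⊆ F) :
    ∃ (w : V → ℝ) (S : Finset V), Disjoint S U ∧ S.card ≤ E.card * q ∧
      (∀ v ∉ S, w v = a v) ∧ (∀ P ∈ F, P ∉ E → Disjoint S P) ∧
      G.energy l w w ≤ G.energy l a a - (1 - (l : ℝ) / q) * ∑ P ∈ E, (∑ v ∈ P, a v) ^ 2 := by
  induction E using Finset.induction_on with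
  | empty => exact ⟨a, ∅, by simp⟩
  | insert P E hP ih =>
    obtain ⟨w, S, hSU, hSc, hw, hSd, hen⟩ := ih ((Finset.subset_insert _ _).trans hEF)
    have hPF : P ∈ F := hEF (Finset.mem_insert_self _ _)
    have hSP : Disjoint S P := hSd P hPF hP
    obtain ⟨C, hC, hCN, hCP⟩ := hF P hPF
    have hE1 : E.card + 1 ≤ F.card := by
      rw [← Finset.card_insert_of_notMem hP]; exact Finset.card_le_card hEF
    have hother : ∀ P' ∈ F.erase P, (C ∩ P').card ≤ 2 * l ^ 3 + 1 := by
      intro P' hP'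
      obtain ⟨C', hC', hCN', rfl⟩ := hF P' (Finset.mem_of_mem_erase hP')
      by_contra! h
      have := nearSet_eq_of_card_inter hE hC' hC (by omega) h
      exact Finset.ne_of_mem_erase hP' (this.trans hCP)
    have hu := Finset.card_biUnion_le_card_mul (F.erase P) (fun P' => C ∩ P') _ hother
    have hu2 := Nat.mul_le_mul_right (2 * l ^ 3 + 1) (Finset.card_erase_le (s := F) (a := P))
    have hsd := Finset.le_card_sdiff ((F.erase P).biUnion fun P' => C ∩ P') C
    obtain ⟨D, hD, hDq, hDv⟩ := exists_subset_avoiding (q := q) (m := l ^ 3 + 1)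
      (C \ (F.erase P).biUnion fun P' => C ∩ P') (U ∪ S)
      (fun v => C.filter fun y => if v ∈ P then v = y ∨ ¬ G.Adj v y else G.Adj v y)
      (fun v _ => by
        by_cases hvP : v ∈ P
        · simp only [hvP, if_true]
          rw [← hCP, mem_nearSet] at hvP
          have : (C.filter fun y => v = y ∨ ¬ G.Adj v y) ⊆
              insert v (C.filter fun y => v ≠ y ∧ ¬ G.Adj v y) := by
            intro y hy
            simp only [Finset.mem_filter, Finset.mem_insert] at hy ⊢
            tauto
          exact (Finset.card_le_card this).trans ((Finset.card_insert_le _ _).trans (by omega))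
        · simp only [hvP, if_false]
          rw [← hCP] at hvP
          exact (card_adj_le_of_notMem_nearSet hE hC hvP).trans (by omega))
      (by
        have h1 : (U ∪ S).card ≤ U.card + F.card * q :=
          (Finset.card_union_le _ _).trans (Nat.add_le_add_left
            (hSc.trans (Nat.mul_le_mul_right q (by omega))) _)
        have h2 := Nat.mul_le_mul_right (l ^ 3 + 1) h1
        omega)
    have hDC : D ⊆ C := hD.trans Finset.sdiff_subset
    have hDP : D ⊆ P := hDC.trans (hCP ▸ hC.subset_nearSet)
    have hbad : ∀ v ∈ U ∪ S, ∀ y ∈ D, ¬ if v ∈ P then v = y ∨ ¬ G.Adj v y else G.Adj v y :=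
      fun v hv y hy h => hDv v hv y hy (Finset.mem_filter.2 ⟨hDC hy, h⟩)
    have hDU : ∀ v ∈ U ∪ S, v ∉ D := fun v hv hvD => by
      have := hbad v hv v hvD
      simp [hDP hvD] at this
    have hsupp : ∀ v, w v ≠ 0 → v ∈ U ∪ S := fun v hv => by
      by_contra h
      rw [Finset.mem_union, not_or] at h
      exact hv ((hw v h.2).trans (ha v h.1))
    have hsum : ∑ v ∈ P, w v = ∑ v ∈ P, a v :=
      Finset.sum_congr rfl fun v hv => hw v (Finset.disjoint_right.1 hSP hv)
    have hstep := energy_sub_smul_ind_le (G := G) (l := l) (w := w) (P := P) (D := D) hq hDq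
      (fun v hv h0 => ⟨hDU v (hsupp v h0), fun y hy => by
        have := hbad v (hsupp v h0) y hy
        simp only [hv, if_true] at this
        tauto⟩)
      (fun v hv h0 => ⟨hDU v (hsupp v h0), fun y hy => by
        have := hbad v (hsupp v h0) y hy
        simpa only [hv, if_false] using this⟩)
    refine ⟨_, S ∪ D, ?_, ?_, ?_, ?_, hstep.trans ?_⟩
    · rw [Finset.disjoint_union_left]
      exact ⟨hSU, Finset.disjoint_right.2 fun v hv => hDU v (Finset.mem_union_left _ hv)⟩
    · rw [Finset.card_insert_of_notMem hP, add_mul, one_mul]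
      exact (Finset.card_union_le _ _).trans (by omega)
    · intro v hv
      rw [Finset.mem_union, not_or] at hv
      simp [ind, hv.2, hw v hv.1]
    · intro P' hP' hn
      rw [Finset.mem_insert, not_or] at hn
      rw [Finset.disjoint_union_left]
      refine ⟨hSd P' hP' hn.2, Finset.disjoint_left.2 fun v hv hvP' => ?_⟩
      refine (Finset.mem_sdiff.1 (hD hv)).2 (Finset.mem_biUnion.2 ⟨P', ?_, ?_⟩)
      · exact Finset.mem_erase.2 ⟨hn.1, hP'⟩
      · exact Finset.mem_inter.2 ⟨hDC hv, hvP'⟩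
    · rw [Finset.sum_insert hP, hsum]
      linarith

/-- The size of the cliques attached to quasi-cliques. -/
def attachSize (l : ℕ) : ℕ := l * ((l + 1) * (l ^ 2 + l + 2) ^ 2) + 1

/-- A clique size for which quasi-cliques behave like fat vertices of a Hoffman graph. -/
def fatSize (l : ℕ) : ℕ :=
  (l ^ 3 + 1) + (l ^ 3 + 2) * (l ^ 3 + 1) +
    (attachSize l + (l + 1) * (2 * l ^ 3 + 1) +
      (l ^ 2 + 2 + (l + 1) * attachSize l) * (l ^ 3 + 1))

theorem neg_one_lt_energy_sub (hE : ∀ w, 0 ≤ G.energy l w w) {N : ℕ} (hN : fatSize l ≤ N)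
    {F : Finset (Finset V)} (hF : ∀ P ∈ F, G.IsQuasiClique (l ^ 3) N P) (hFc : F.card ≤ l + 1)
    {U : Finset V} (hU : U.card ≤ l ^ 2 + 2) {a : V → ℝ} (ha : ∀ v ∉ U, a v = 0)
    (hs : ∀ P ∈ F, |∑ v ∈ P, a v| ≤ l ^ 2 + l + 2) :
    -1 < G.energy l a a - ∑ P ∈ F, (∑ v ∈ P, a v) ^ 2 := by
  have hq : 0 < attachSize l := Nat.succ_pos _
  have h1 : F.card * (2 * l ^ 3 + 1) ≤ (l + 1) * (2 * l ^ 3 + 1) := Nat.mul_le_mul_right _ hFc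
  have h2 : (U.card + F.card * attachSize l) * (l ^ 3 + 1) ≤
      (l ^ 2 + 2 + (l + 1) * attachSize l) * (l ^ 3 + 1) :=
    Nat.mul_le_mul_right _ (Nat.add_le_add hU (Nat.mul_le_mul_right _ hFc))
  unfold fatSize at hN
  obtain ⟨w, -, -, -, -, -, h⟩ := exists_attached_weight hE hq hF (U := U)
    (by omega) (by omega) ha F subset_rfl
  have hw := hE w
  have hsum : ∑ P ∈ F, (∑ v ∈ P, a v) ^ 2 ≤ (l + 1) * ((l : ℝ) ^ 2 + l + 2) ^ 2 := by
    calc ∑ P ∈ F, (∑ v ∈ P, a v) ^ 2 ≤ ∑ P ∈ F, ((l : ℝ) ^ 2 + l + 2) ^ 2 :=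
          Finset.sum_le_sum fun P hP => sq_le_sq' (abs_le.1 (hs P hP)).1 (abs_le.1 (hs P hP)).2
      _ = F.card * ((l : ℝ) ^ 2 + l + 2) ^ 2 := by simp
      _ ≤ _ := by
          have : (F.card : ℝ) ≤ l + 1 := by exact_mod_cast hFc
          gcongr
  have hq' : (0 : ℝ) < attachSize l := by exact_mod_cast hq
  have hlt : (l : ℝ) / attachSize l * ∑ P ∈ F, (∑ v ∈ P, a v) ^ 2 < 1 := by
    rw [div_mul_eq_mul_div, div_lt_one hq']
    have h3 : (attachSize l : ℝ) = l * ((l + 1) * ((l : ℝ) ^ 2 + l + 2) ^ 2) + 1 := by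
      simp [attachSize]
    rw [h3]
    have := mul_le_mul_of_nonneg_left hsum (Nat.cast_nonneg l : (0 : ℝ) ≤ l)
    linarith
  linarith

theorem card_quasiCliques_le (hE : ∀ w, 0 ≤ G.energy l w w) {N : ℕ}
    (hN : fatSize l ≤ N) {F : Finset (Finset V)} (hF : ∀ P ∈ F, G.IsQuasiClique (l ^ 3) N P)
    {x : V} (hx : ∀ P ∈ F, x ∈ P) : F.card ≤ l := by
  by_contra! hc
  obtain ⟨E, hEF, hEc⟩ := Finset.exists_subset_card_eq (Nat.succ_le_of_lt hc)
  have hsum : ∀ P ∈ E, ∑ v ∈ P, ind {x} v = 1 := fun P hP => by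
    simp [sum_ind, hx P (hEF hP)]
  have key := neg_one_lt_energy_sub hE hN (fun P hP => hF P (hEF hP)) hEc.le (U := {x})
    (a := ind {x}) (by simp) (fun v hv => by simp_all [ind])
    (fun P hP => by
      rw [hsum P hP, abs_one]
      nlinarith [(Nat.cast_nonneg l : (0 : ℝ) ≤ l)])
  rw [energy_singleton, Finset.sum_congr rfl fun P hP => by rw [hsum P hP]] at key
  simp [hEc] at key

theorem card_quasiClique_inter_lt (hl : 1 ≤ l) (hE : ∀ w, 0 ≤ G.energy l w w) {N : ℕ}
    (hN : fatSize l ≤ N) {P P' : Finset V} (hP : G.IsQuasiClique (l ^ 3) N P)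
    (hP' : G.IsQuasiClique (l ^ 3) N P') (hne : P ≠ P') : (P ∩ P').card < l := by
  by_contra! hc
  obtain ⟨Y, hY, hYc⟩ := Finset.exists_subset_card_eq hc
  have hsum : ∀ Q ∈ ({P, P'} : Finset (Finset V)), ∑ v ∈ Q, ind Y v = l := fun Q hQ => by
    have : Y ⊆ Q := by
      simp only [Finset.mem_insert, Finset.mem_singleton] at hQ
      obtain rfl | rfl := hQ
      · exact hY.trans Finset.inter_subset_left
      · exact hY.trans Finset.inter_subset_right
    rw [sum_ind, Finset.inter_eq_right.2 this, hYc]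
  have key := neg_one_lt_energy_sub hE hN (F := {P, P'}) (by simp [hP, hP'])
    (by rw [Finset.card_pair hne]; omega) (U := Y) (by rw [hYc]; nlinarith)
    (a := ind Y) (fun v hv => by simp [ind, hv])
    (fun Q hQ => by
      rw [hsum Q hQ, abs_of_nonneg (Nat.cast_nonneg l)]
      nlinarith [(Nat.cast_nonneg l : (0 : ℝ) ≤ l)])
  rw [Finset.sum_congr rfl fun Q hQ => by rw [hsum Q hQ], Finset.sum_const,
    Finset.card_pair hne] at key
  have h1 := G.energy_ind_self_le l Y
  rw [hYc] at h1
  have hl' : (1 : ℝ) ≤ l := by exact_mod_cast hl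
  rw [nsmul_eq_mul] at key
  push_cast at key
  nlinarith

theorem IsQuasiClique.isPlex (hl : 1 ≤ l) (hE : ∀ w, 0 ≤ G.energy l w w) {N : ℕ}
    (hN : fatSize l ≤ N) {P : Finset V} (hP : G.IsQuasiClique (l ^ 3) N P) :
    G.IsPlex ((l - 1) ^ 2 + 1) P := by
  intro x hx
  by_contra! hc
  rw [Nat.add_sub_cancel] at hc
  obtain ⟨Y, hY, hYc⟩ := Finset.exists_subset_card_eq (Nat.succ_le_of_lt hc)
  have hY' : ∀ y ∈ Y, x ≠ y ∧ y ∈ P ∧ ¬ G.Adj x y := fun y hy => by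
    have := hY hy
    simp only [Finset.mem_filter, Finset.mem_erase] at this
    exact ⟨this.1.1.symm, this.1.2, this.2⟩
  obtain ⟨m, rfl⟩ := Nat.exists_eq_add_of_le' hl
  simp only [Nat.add_sub_cancel, Nat.succ_eq_add_one] at hYc
  have hsum : ∑ v ∈ P, (((m + 1 : ℕ) : ℝ) • ind {x} + ind Y) v = (m + 1) + (m ^ 2 + 1) := by
    have h1 : P ∩ {x} = {x} := Finset.inter_singleton_of_mem hx
    have h2 : P ∩ Y = Y := Finset.inter_eq_right.2 fun y hy => (hY' y hy).2.1
    simp only [Pi.add_apply, Pi.smul_apply, Finset.sum_add_distrib, smul_eq_mul,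
      ← Finset.mul_sum, sum_ind, h1, h2, hYc]
    simp
  have key := neg_one_lt_energy_sub hE hN (F := {P}) (by simpa using hP) (by simp)
    (U := insert x Y) ((Finset.card_insert_le _ _).trans (by rw [hYc]; nlinarith))
    (a := ((m + 1 : ℕ) : ℝ) • ind {x} + ind Y)
    (fun v hv => by
      rw [Finset.mem_insert, not_or] at hv
      simp [ind, hv.1, hv.2])
    (fun Q hQ => by
      rw [Finset.mem_singleton.1 hQ, hsum, abs_of_nonneg (by positivity)]
      push_cast
      nlinarith [(Nat.cast_nonneg m : (0 : ℝ) ≤ m)])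
  rw [Finset.sum_singleton, hsum] at key
  have h1 := G.energy_singleton (m + 1 : ℕ) x
  have h2 := G.energy_ind_self_le (m + 1 : ℕ) Y
  have h3 : G.energy (m + 1 : ℕ) (ind {x}) (ind Y) = 0 :=
    G.energy_empty _ (by simpa using fun y hy => ⟨(hY' y hy).1, (hY' y hy).2.2⟩)
  simp only [map_smul, map_add, LinearMap.smul_apply, LinearMap.add_apply, smul_eq_mul,
    G.energy_symm _ (ind Y) (ind {x}), h1, h3] at key
  rw [hYc] at h2
  push_cast at key h2
  nlinarith

theorem card_adj_quasiClique_le (hl : 1 ≤ l) (hE : ∀ w, 0 ≤ G.energy l w w) {N : ℕ}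
    (hN : fatSize l ≤ N) {P : Finset V} (hP : G.IsQuasiClique (l ^ 3) N P) {x : V}
    (hx : x ∉ P) : (P.filter fun y => G.Adj x y).card ≤ l * (l - 1) := by
  classical
  by_contra! hc
  set F : Finset (Finset V) := univ.filter fun Q => G.IsQuasiClique (l ^ 3) N Q ∧ x ∈ Q with hF
  have hF' : ∀ Q ∈ F, G.IsQuasiClique (l ^ 3) N Q ∧ x ∈ Q := fun Q hQ => by simpa [hF] using hQ
  have hFl : F.card ≤ l :=
    card_quasiCliques_le hE hN (fun Q hQ => (hF' Q hQ).1) (fun Q hQ => (hF' Q hQ).2)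
  have hPF : P ∉ F := fun h => hx (hF' P h).2
  obtain ⟨e, he⟩ := Nat.exists_eq_add_of_le hFl
  have hB := Finset.card_biUnion_le_card_mul F (fun Q => P ∩ Q) (l - 1) fun Q hQ =>
    Nat.le_sub_one_of_lt (card_quasiClique_inter_lt hl hE hN hP (hF' Q hQ).1
      fun h => hPF (h ▸ hQ))
  have hsd := Finset.le_card_sdiff (F.biUnion fun Q => P ∩ Q) (P.filter fun y => G.Adj x y)
  have hmul : l * (l - 1) = F.card * (l - 1) + e * (l - 1) := by rw [← add_mul, ← he]
  obtain ⟨Y, hY, hYc⟩ := Finset.exists_subset_card_eq (n := e * (l - 1) + 1)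
    (s := (P.filter fun y => G.Adj x y) \ F.biUnion fun Q => P ∩ Q) (by omega)
  have hY' : ∀ y ∈ Y, y ∈ P ∧ G.Adj x y ∧ ∀ Q ∈ F, y ∉ Q := fun y hy => by
    have := hY hy
    simp only [Finset.mem_sdiff, Finset.mem_filter, Finset.mem_biUnion, Finset.mem_inter,
      not_exists, not_and] at this
    exact ⟨this.1.1, this.1.2, fun Q hQ => this.2 Q hQ this.1.1⟩
  have hel : e ≤ l := by omega
  obtain ⟨m, rfl⟩ := Nat.exists_eq_add_of_le' hl
  rw [Nat.add_sub_cancel] at hYc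
  have hsumP : ∑ v ∈ P, (ind Y - ((m + 1 : ℕ) : ℝ) • ind {x}) v = e * m + 1 := by
    have h1 : P ∩ {x} = ∅ := Finset.inter_singleton_of_notMem hx
    have h2 : P ∩ Y = Y := Finset.inter_eq_right.2 fun y hy => (hY' y hy).1
    simp only [Pi.sub_apply, Pi.smul_apply, Finset.sum_sub_distrib, smul_eq_mul,
      ← Finset.mul_sum, sum_ind, h1, h2, hYc]
    simp
  have hsumF : ∀ Q ∈ F, ∑ v ∈ Q, (ind Y - ((m + 1 : ℕ) : ℝ) • ind {x}) v = -(m + 1) := by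
    intro Q hQ
    have h1 : Q ∩ {x} = {x} := Finset.inter_singleton_of_mem (hF' Q hQ).2
    have h2 : Q ∩ Y = ∅ := Finset.disjoint_iff_inter_eq_empty.1
      (Finset.disjoint_right.2 fun y hy => (hY' y hy).2.2 Q hQ)
    simp only [Pi.sub_apply, Pi.smul_apply, Finset.sum_sub_distrib, smul_eq_mul,
      ← Finset.mul_sum, sum_ind, h1, h2]
    simp
  have hem : e * m ≤ (m + 1) * m := Nat.mul_le_mul_right _ hel
  have hem' : (e : ℝ) * m ≤ (m + 1) * m := by exact_mod_cast hem
  have hm0 : (0 : ℝ) ≤ m := Nat.cast_nonneg m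
  have key := neg_one_lt_energy_sub hE hN (F := insert P F)
    (fun Q hQ => (Finset.mem_insert.1 hQ).elim (fun h => h ▸ hP) fun h => (hF' Q h).1)
    ((Finset.card_insert_le _ _).trans (by omega))
    (U := insert x Y) ((Finset.card_insert_le _ _).trans (by rw [hYc]; nlinarith))
    (a := ind Y - ((m + 1 : ℕ) : ℝ) • ind {x})
    (fun v hv => by
      rw [Finset.mem_insert, not_or] at hv
      simp [ind, hv.1, hv.2])
    (fun Q hQ => by
      obtain rfl | hQ := Finset.mem_insert.1 hQ
      · rw [hsumP, abs_of_nonneg (by positivity)]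
        push_cast
        nlinarith
      · rw [hsumF Q hQ, abs_neg, abs_of_nonneg (by positivity)]
        push_cast
        nlinarith)
  rw [Finset.sum_insert hPF, hsumP, Finset.sum_congr rfl fun Q hQ => by rw [hsumF Q hQ],
    Finset.sum_const, nsmul_eq_mul] at key
  have h1 := G.energy_singleton (m + 1 : ℕ) x
  have h2 := G.energy_ind_self_le (m + 1 : ℕ) Y
  have h3 : G.energy (m + 1 : ℕ) (ind {x}) (ind Y) = Y.card := by
    rw [G.energy_complete _ (by simpa using fun y hy => (hY' y hy).2.1)]; simp
  have he' : (m : ℝ) + 1 = F.card + e := by exact_mod_cast he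
  have hF0 : (F.card : ℝ) = m + 1 - e := by linarith
  have hel' : (e : ℝ) ≤ m + 1 := by exact_mod_cast hel
  simp only [map_smul, map_sub, LinearMap.smul_apply, LinearMap.sub_apply, smul_eq_mul,
    G.energy_symm _ (ind Y) (ind {x}), h1, h3] at key
  rw [hYc] at h2 key
  rw [hF0] at key
  push_cast at key h2
  nlinarith

end QuasiClique

end SimpleGraph

/-- structure theorem for connected regular graphs with smallest eigenvalue at
least `-λ`: for large valency they carry a nice family of `((λ−1)²+1)`-plexes. -/
theorem stmt_3 (lam : ℕ) (hlam : 1 ≤ lam) :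
    ∃ n₁ : ℕ, 0 < n₁ ∧
      ((lam - 1) ^ 2 + 1) * ((lam * (lam - 1)) ^ 2 + lam * (lam - 1) + (lam - 1) ^ 2 +
          (lam - 1) ^ 2 * ((lam - 1) ^ 2 + 1) + 2) ≤ n₁ ∧
      ∀ n : ℕ, n₁ ≤ n → ∃ K₁ C₁ : ℕ,
        ∀ (V : Type) [Fintype V] [DecidableEq V] (G : SimpleGraph V) [DecidableRel G.Adj]
          (k : ℕ), G.Connected → G.IsRegularOfDegree k →
          (∀ μ : ℝ, G.adjEigenvalue μ → -(lam : ℝ) ≤ μ) → K₁ ≤ k →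
          ∃ (s : ℕ) (P : Fin s → Finset V),
            (∀ i, G.IsPlex ((lam - 1) ^ 2 + 1) (P i)) ∧
            (∀ x : V, 1 ≤ (Finset.univ.filter fun i => x ∈ P i).card ∧
              (Finset.univ.filter fun i => x ∈ P i).card ≤ lam) ∧
            (∀ x : V,
              ((G.neighborFinset x).filter fun y => ∀ i, ¬(x ∈ P i ∧ y ∈ P i)).card ≤ C₁) ∧
            (∀ i, n ≤ (P i).card) ∧
            (∀ i j, i ≠ j → (P i ∩ P j).card ≤ lam - 1) ∧
            (∀ i, ∀ x ∉ P i, ((P i).filter fun y => G.Adj x y).card ≤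
              ((lam - 1) ^ 2 + 1) * (lam * (lam - 1))) := by
  classical
  refine ⟨((lam - 1) ^ 2 + 1) * ((lam * (lam - 1)) ^ 2 + lam * (lam - 1) + (lam - 1) ^ 2 +
    (lam - 1) ^ 2 * ((lam - 1) ^ 2 + 1) + 2), by positivity, le_rfl, fun n _ => ?_⟩
  obtain ⟨R, hR⟩ := SimpleGraph.exists_clique_or_independent (n + SimpleGraph.fatSize lam)
    (lam ^ 2 + 1)
  refine ⟨R + 1, R, fun V _ _ G _ k _ hreg hμ hk => ?_⟩
  have hE := G.energy_nonneg hμ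
  have hN : SimpleGraph.fatSize lam ≤ n + SimpleGraph.fatSize lam := Nat.le_add_left _ _
  let F : Finset (Finset V) := Finset.univ.filter fun Q =>
    G.IsQuasiClique (lam ^ 3) (n + SimpleGraph.fatSize lam) Q
  have hF : ∀ Q, Q ∈ F ↔ G.IsQuasiClique (lam ^ 3) (n + SimpleGraph.fatSize lam) Q :=
    fun Q => by simp [F]
  let P : Fin F.card → Finset V := fun i => (F.equivFin.symm i : Finset V)
  have hP : ∀ i, G.IsQuasiClique (lam ^ 3) (n + SimpleGraph.fatSize lam) (P i) :=
    fun i => (hF _).1 (F.equivFin.symm i).2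
  have hPinj : Function.Injective P := Subtype.val_injective.comp F.equivFin.symm.injective
  have hPsurj : ∀ Q ∈ F, ∃ i, P i = Q := fun Q hQ => ⟨F.equivFin ⟨Q, hQ⟩, by simp [P]⟩
  have hfew : ∀ x : V,
      ((G.neighborFinset x).filter fun y => ∀ i, ¬(x ∈ P i ∧ y ∈ P i)).card < R := by
    intro x
    by_contra hc
    rw [not_lt] at hc
    obtain ⟨T, hT, hTc, hTq⟩ | ⟨T, hT, hTc, hTi⟩ := hR V G _ hc
    · obtain ⟨y, hy⟩ : T.Nonempty := Finset.card_pos.1 (by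
        rw [hTc]; unfold SimpleGraph.fatSize; omega)
      obtain ⟨i, hi⟩ := hPsurj (G.nearSet (lam ^ 3) T) ((hF _).2 ⟨T, hTq, hTc, rfl⟩)
      refine (Finset.mem_filter.1 (hT hy)).2 i ⟨?_, hi ▸ hTq.subset_nearSet hy⟩
      rw [hi, SimpleGraph.mem_nearSet, Finset.filter_false_of_mem]
      · simp
      · rintro z hz ⟨-, h⟩
        exact h ((G.mem_neighborFinset x z).1 (Finset.mem_filter.1 (hT hz)).1)
    · have := SimpleGraph.not_claw hlam hE hTi fun s hs =>
        (G.mem_neighborFinset x s).1 (Finset.mem_filter.1 (hT hs)).1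
      omega
  refine ⟨F.card, P, fun i => (hP i).isPlex hlam hE hN, fun x => ⟨?_, ?_⟩, fun x => (hfew x).le,
    fun i => le_trans (Nat.le_add_right _ _) (hP i).le_card, fun i j hij => ?_,
    fun i x hx => ?_⟩
  · obtain ⟨y, hy, hy'⟩ : ∃ y ∈ G.neighborFinset x, ¬ ∀ i, ¬(x ∈ P i ∧ y ∈ P i) := by
      by_contra! hc
      have h1 := hfew x
      rw [Finset.filter_true_of_mem fun y hy i => not_and.2 (hc y hy i),
        G.card_neighborFinset_eq_degree, hreg x] at h1
      omega
    push Not at hy'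
    obtain ⟨i, hi, -⟩ := hy'
    exact Finset.card_pos.2 ⟨i, by simpa using hi⟩
  · rw [← Finset.card_image_of_injective _ hPinj]
    refine SimpleGraph.card_quasiCliques_le hE hN (x := x) ?_ ?_
    · intro Q hQ
      obtain ⟨i, -, rfl⟩ := Finset.mem_image.1 hQ
      exact hP i
    · intro Q hQ
      obtain ⟨i, hi, rfl⟩ := Finset.mem_image.1 hQ
      exact (Finset.mem_filter.1 hi).2
  · exact Nat.le_sub_one_of_lt
      (SimpleGraph.card_quasiClique_inter_lt hlam hE hN (hP i) (hP j) (hPinj.ne hij))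
  · exact (SimpleGraph.card_adj_quasiClique_le hlam hE hN (hP i) hx).trans
      (Nat.le_mul_of_pos_left _ (Nat.succ_pos _))
end

section
/- Let λ ≥ 1 be an integer. There exist a positive integer κ(λ) and a positive real number ε(λ) such that for every connected k-regular finite simple graph G with λmin(G) ≥ −λ and k ≥ κ(λ), every vertex of G lies in a clique of order at least (k − ε(λ)) / (λ·((λ−1)²+1)). -/
namespace SimpleGraph

open Finset

variable {V : Type*} {E : Type*} [NormedAddCommGroup E] [InnerProductSpace ℝ E]

/-- `v` represents `A + L • 1` as a Gram matrix, where `A` is the adjacency matrix of `G`. -/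
structure IsGramRep (G : SimpleGraph V) (L : ℝ) (v : V → E) : Prop where
  self : ∀ i, inner ℝ (v i) (v i) = L
  adj : ∀ i j, G.Adj i j → inner ℝ (v i) (v j) = 1
  not_adj : ∀ i j, i ≠ j → ¬ G.Adj i j → inner ℝ (v i) (v j) = 0

theorem exists_clique_or_indep (a b : ℕ) : ∃ N : ℕ, ∀ {V : Type} (G : SimpleGraph V) (S : Finset V),
    N ≤ #S → (∃ C ⊆ S, G.IsClique C ∧ #C = a) ∨ ∃ I ⊆ S, G.IsIndepSet I ∧ #I = b := by
  classical
  induction a generalizing b with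
  | zero => exact ⟨0, fun G S _ => Or.inl ⟨∅, by simp⟩⟩
  | succ a iha =>
    induction b with
    | zero => exact ⟨0, fun G S _ => Or.inr ⟨∅, by simp⟩⟩
    | succ b ihb =>
      obtain ⟨N₁, h₁⟩ := iha (b + 1)
      obtain ⟨N₂, h₂⟩ := ihb
      refine ⟨N₁ + N₂ + 1, fun {V} G S hS => ?_⟩
      obtain ⟨x, hx⟩ : S.Nonempty := by
        rw [← card_pos]; omega
      have hcard := card_erase_of_mem hx
      have hsplit : #{y ∈ S.erase x | G.Adj x y} + #{y ∈ S.erase x | ¬ G.Adj x y} = #(S.erase x) :=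
        card_filter_add_card_filter_not _
      rcases le_or_gt N₁ #{y ∈ S.erase x | G.Adj x y} with h | h
      · rcases h₁ G _ h with ⟨C, hC, hcl, hc⟩ | ⟨I, hI, hind, hi⟩
        · left
          have hxC : x ∉ C := fun hxC => by simpa using hC hxC
          refine ⟨insert x C, ?_, ?_, by rw [card_insert_of_notMem hxC, hc]⟩
          · exact insert_subset hx fun y hy =>
              mem_of_mem_erase (mem_of_mem_filter _ (hC hy))
          · rw [coe_insert]
            exact hcl.insert fun y hy _ => (mem_filter.1 (hC hy)).2
        · exact Or.inr ⟨I, fun y hy => mem_of_mem_erase (mem_of_mem_filter _ (hI hy)), hind, hi⟩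
      · rcases h₂ G {y ∈ S.erase x | ¬ G.Adj x y} (by omega) with ⟨C, hC, hcl, hc⟩ | ⟨I, hI, hind, hi⟩
        · exact Or.inl ⟨C, fun y hy => mem_of_mem_erase (mem_of_mem_filter _ (hC hy)), hcl, hc⟩
        · right
          have hxI : x ∉ I := fun hxI => by simpa using hI hxI
          refine ⟨insert x I, ?_, ?_, by rw [card_insert_of_notMem hxI, hi]⟩
          · exact insert_subset hx fun y hy =>
              mem_of_mem_erase (mem_of_mem_filter _ (hI hy))
          · rw [coe_insert]
            refine Set.Pairwise.insert hind fun y hy _ => ?_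
            have := (mem_filter.1 (hI hy)).2
            exact ⟨this, fun h => this h.symm⟩

/-- A graph whose complement has maximum degree less than `d` on `Q` has a clique containing a
proportion `1 / d` of `Q`. -/
theorem exists_clique_of_card_not_adj_le [DecidableEq V] (G : SimpleGraph V) [DecidableRel G.Adj]
    (Q : Finset V) (d : ℕ) (hd : ∀ y ∈ Q, #{q ∈ Q | ¬ G.Adj y q} ≤ d) :
    ∃ K ⊆ Q, G.IsClique K ∧ #Q ≤ d * #K := by
  classical
  obtain ⟨K, hK, hmax⟩ := exists_max_image (Q.powerset.filter fun K : Finset V => G.IsClique K) card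
    ⟨∅, by simp⟩
  simp only [mem_filter, mem_powerset] at hK hmax
  refine ⟨K, hK.1, hK.2, ?_⟩
  have hcover : Q ⊆ K.biUnion fun y => {q ∈ Q | ¬ G.Adj y q} := by
    intro q hq
    by_contra hcon
    simp only [mem_biUnion, mem_filter, not_exists, not_and, not_not] at hcon
    have hqK : q ∉ K := fun h => (hcon q h hq).ne rfl
    have := hmax (insert q K) ⟨insert_subset hq hK.1, by
      rw [coe_insert]
      exact hK.2.insert fun y hy _ => (hcon y hy hq).symm⟩
    rw [card_insert_of_notMem hqK] at this
    omega
  calc #Q ≤ _ := card_le_card hcover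
    _ ≤ #K * d := card_biUnion_le_card_mul _ _ _ fun y hy => hd y (hK.1 hy)
    _ = d * #K := mul_comm _ _

open scoped MatrixOrder in
theorem exists_isGramRep [Fintype V] [DecidableEq V] (G : SimpleGraph V) [DecidableRel G.Adj] (L : ℝ)
    (hG : ∀ (μ : ℝ) (w : V → ℝ), w ≠ 0 → (G.adjMatrix ℝ).mulVec w = μ • w → -L ≤ μ) :
    ∃ v : V → EuclideanSpace ℝ V, G.IsGramRep L v := by
  set M : Matrix V V ℝ := G.adjMatrix ℝ + L • 1 with hM
  have hherm : M.IsHermitian := by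
    simp [Matrix.IsHermitian, hM]
  have hpsd : M.PosSemidef := by
    rw [hherm.posSemidef_iff_eigenvalues_nonneg]
    intro i
    have h := hherm.mulVec_eigenvectorBasis i
    have := hG (hherm.eigenvalues i - L) (hherm.eigenvectorBasis i).ofLp
      (by simpa using hherm.eigenvectorBasis.toBasis.ne_zero i) (by
        have hadd : ∀ w, M.mulVec w = (G.adjMatrix ℝ).mulVec w + L • w := fun w => by
          rw [hM, Matrix.add_mulVec, Matrix.smul_mulVec, Matrix.one_mulVec]
        rw [sub_smul, ← h, hadd, add_sub_cancel_right])
    show (0 : ℝ) ≤ _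
    linarith
  obtain ⟨B, hB⟩ := CStarAlgebra.nonneg_iff_eq_star_mul_self.1 hpsd.nonneg
  have key : ∀ i j, inner ℝ (WithLp.toLp 2 fun a => B a i : EuclideanSpace ℝ V)
      (WithLp.toLp 2 fun a => B a j) = M i j := by
    intro i j
    rw [hB]
    simp [Matrix.mul_apply, PiLp.inner_apply, mul_comm]
  refine ⟨fun i => WithLp.toLp 2 fun a => B a i, ⟨fun i => ?_, fun i j h => ?_, fun i j hij h => ?_⟩⟩
  · rw [key]; simp [hM]
  · rw [key]; simp [hM, h, h.ne]
  · rw [key]; simp [hM, h, hij]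

namespace IsGramRep

variable {G : SimpleGraph V} {L : ℝ} {v : V → E}

theorem inner_le_one (hv : G.IsGramRep L v) {i j : V} (h : i ≠ j) : inner ℝ (v i) (v j) ≤ 1 := by
  by_cases hij : G.Adj i j
  · exact (hv.adj i j hij).le
  · rw [hv.not_adj i j h hij]; exact zero_le_one

theorem inner_sum_self_le (hv : G.IsGramRep L v) (S : Finset V) :
    inner ℝ (∑ i ∈ S, v i) (∑ i ∈ S, v i) ≤ #S * (L + #S - 1) := by
  classical
  rw [sum_inner, ← nsmul_eq_mul]
  refine sum_le_card_nsmul _ _ _ fun i hi => ?_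
  rw [inner_sum, ← add_sum_erase _ _ hi, hv.self, add_sub_assoc]
  have := sum_le_card_nsmul (S.erase i) (fun j => inner ℝ (v i) (v j)) 1 fun j hj =>
    hv.inner_le_one (ne_of_mem_erase hj).symm
  rw [card_erase_of_mem hi, nsmul_eq_mul, mul_one, Nat.cast_pred (card_pos.2 ⟨i, hi⟩)] at this
  gcongr

theorem inner_sum_eq_card (hv : G.IsGramRep L v) {y : V} {S : Finset V}
    (h : ∀ z ∈ S, G.Adj y z) : inner ℝ (v y) (∑ i ∈ S, v i) = #S := by
  rw [inner_sum, sum_congr rfl fun z hz => hv.adj y z (h z hz)]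
  simp

theorem inner_sum_eq_zero (hv : G.IsGramRep L v) {y : V} {S : Finset V}
    (h : ∀ z ∈ S, y ≠ z ∧ ¬ G.Adj y z) : inner ℝ (v y) (∑ i ∈ S, v i) = 0 := by
  rw [inner_sum]
  exact sum_eq_zero fun z hz => hv.not_adj y z (h z hz).1 (h z hz).2

/-- A neighbourhood contains no independent set of more than `L ^ 2` vertices. -/
theorem card_indepSet_le (hv : G.IsGramRep L v) (hL : 0 < L) {x : V} {I : Finset V}
    (hx : ∀ z ∈ I, G.Adj x z) (hI : G.IsIndepSet I) : (#I : ℝ) ≤ L ^ 2 := by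
  have h := real_inner_self_nonneg (x := L • v x - ∑ i ∈ I, v i)
  have hII : inner ℝ (∑ i ∈ I, v i) (∑ i ∈ I, v i) = #I * L := by
    classical
    rw [sum_inner, ← nsmul_eq_mul]
    refine sum_eq_card_nsmul fun i hi => ?_
    rw [inner_sum, ← add_sum_erase _ _ hi, hv.self, sum_eq_zero, add_zero]
    intro j hj
    have hne := (ne_of_mem_erase hj).symm
    exact hv.not_adj i j hne (hI hi (mem_of_mem_erase hj) hne)
  rw [inner_sub_left, inner_sub_right, inner_sub_right, hII, real_inner_smul_left,
    real_inner_smul_left, real_inner_smul_right, real_inner_smul_right,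
    real_inner_comm (v x) (∑ i ∈ I, v i), hv.inner_sum_eq_card hx, hv.self] at h
  refine le_of_mul_le_mul_left ?_ hL
  linarith

/-- A vertex cannot have many neighbours and many non-neighbours in the same clique. -/
theorem card_le_of_adj_of_not_adj (hv : G.IsGramRep L v) (hL : 0 < L) {y : V} {P N : Finset V}
    (hP : ∀ z ∈ P, G.Adj y z) (hN : ∀ z ∈ N, y ≠ z ∧ ¬ G.Adj y z)
    (hPN : ∀ p ∈ P, ∀ q ∈ N, G.Adj p q) (hcard : #P = #N) (hne : P.Nonempty) :
    (#P : ℝ) ≤ 2 * L * (L - 1) := by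
  set p := ∑ i ∈ P, v i
  set q := ∑ i ∈ N, v i
  have h := real_inner_mul_inner_self_le (v y) (p - q)
  have hpp : inner ℝ p p ≤ _ := hv.inner_sum_self_le P
  have hqq : inner ℝ q q ≤ _ := hv.inner_sum_self_le N
  have hpq : inner ℝ p q = (#P : ℝ) * #N := by
    rw [sum_inner, ← nsmul_eq_mul]
    exact sum_eq_card_nsmul fun i hi => hv.inner_sum_eq_card (hPN i hi)
  rw [inner_sub_left, inner_sub_right, inner_sub_right, inner_sub_right, hv.inner_sum_eq_card hP,
    hv.inner_sum_eq_zero hN, real_inner_comm p q, hpq, hv.self] at h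
  rw [← hcard] at h hqq
  have h0 : (0 : ℝ) < #P := by exact_mod_cast hne.card_pos
  have h2 : (#P : ℝ) * #P ≤ L * (2 * #P * (L - 1)) := by
    refine le_trans (by linarith) (h.trans (mul_le_mul_of_nonneg_left ?_ hL.le))
    linarith
  nlinarith

/-- If `d + 1` vertices, one of which is not adjacent to the others, have a large common clique in
their neighbourhoods, then `d ≤ (L - 1) ^ 2`. -/
theorem two_mul_card_le (hv : G.IsGramRep L v) {y : V} {Z C : Finset V}
    (hZ : ∀ z ∈ Z, y ≠ z ∧ ¬ G.Adj y z) (hy : ∀ c ∈ C, G.Adj y c)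
    (hZC : ∀ z ∈ Z, ∀ c ∈ C, G.Adj z c) (hcard : (#Z : ℝ) = (L - 1) ^ 2 + 1)
    (hC : C.Nonempty) : 2 * (#C : ℝ) ≤ (L + #Z) ^ 2 * (L - 1) := by
  set s := ∑ i ∈ C, v i
  set z := ∑ i ∈ Z, v i
  have h := real_inner_self_nonneg (x := (#C : ℝ) • (L • v y + z) - (L + #Z) • s)
  have hss : inner ℝ s s ≤ _ := hv.inner_sum_self_le C
  have hzz : inner ℝ z z ≤ _ := hv.inner_sum_self_le Z
  have hzs : inner ℝ z s = (#Z : ℝ) * #C := by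
    rw [sum_inner, ← nsmul_eq_mul]
    exact sum_eq_card_nsmul fun i hi => hv.inner_sum_eq_card (hZC i hi)
  have hys : inner ℝ (v y) s = #C := hv.inner_sum_eq_card hy
  have hyz : inner ℝ (v y) z = 0 := hv.inner_sum_eq_zero hZ
  have hC0 : (0 : ℝ) < #C := by exact_mod_cast card_pos.2 hC
  simp only [inner_sub_left, inner_sub_right, inner_add_left, inner_add_right,
    real_inner_smul_left, real_inner_smul_right, real_inner_comm (v y) s,
    real_inner_comm (v y) z, real_inner_comm z s, hzs, hys, hyz, hv.self] at h
  have h1 := mul_le_mul_of_nonneg_left hss (sq_nonneg (L + #Z))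
  have h2 := mul_le_mul_of_nonneg_left hzz (sq_nonneg (#C : ℝ))
  refine le_of_mul_le_mul_left ?_ hC0
  generalize (#C : ℝ) = c at *
  rw [hcard] at *
  nlinarith

/-- A vertex is in at most `L` almost disjoint families of large cliques. -/
theorem card_family_le (hv : G.IsGramRep L v) {x : V} {F : Finset (Finset V)} {n m : ℕ} (hn : 0 < n)
    (hx : ∀ C ∈ F, ∀ c ∈ C, G.Adj x c) (hc : ∀ C ∈ F, #C = n)
    (hF : ∀ C ∈ F, ∀ D ∈ F, C ≠ D → inner ℝ (∑ i ∈ C, v i) (∑ i ∈ D, v i) ≤ (n : ℝ) * m) :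
    (n : ℝ) * (#F - L) ≤ #F * (L - 1 + #F * m) := by
  classical
  set s : Finset V → E := fun C => ∑ i ∈ C, v i with hs
  have hxs : inner ℝ (v x) (∑ C ∈ F, s C) = #F * (n : ℝ) := by
    rw [inner_sum, ← nsmul_eq_mul]
    refine sum_eq_card_nsmul fun C hC => ?_
    rw [hv.inner_sum_eq_card (hx C hC), hc C hC]
  have hss : inner ℝ (∑ C ∈ F, s C) (∑ C ∈ F, s C) ≤ #F * (n * (L + n - 1) + #F * (n * m)) := by
    rw [sum_inner, ← nsmul_eq_mul]
    refine sum_le_card_nsmul _ _ _ fun C hC => ?_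
    rw [inner_sum, ← add_sum_erase _ _ hC]
    refine add_le_add ?_ ?_
    · simpa only [hc C hC] using hv.inner_sum_self_le C
    · refine (sum_le_card_nsmul (F.erase C) _ ((n : ℝ) * m) fun D hD =>
        hF C hC D (mem_of_mem_erase hD) (ne_of_mem_erase hD).symm).trans ?_
      rw [nsmul_eq_mul]
      gcongr
      exact erase_subset _ _
  have h := real_inner_self_nonneg (x := (n : ℝ) • v x - ∑ C ∈ F, s C)
  simp only [inner_sub_left (𝕜 := ℝ), inner_sub_right, real_inner_smul_left, real_inner_smul_right,
    real_inner_comm (v x) (∑ C ∈ F, s C), hxs, hv.self] at h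
  have hn' : (0 : ℝ) < n := by exact_mod_cast hn
  refine le_of_mul_le_mul_left ?_ hn'
  nlinarith

theorem card_adj_lt_or_card_not_adj_lt [DecidableRel G.Adj] (hv : G.IsGramRep L v) (hL : 0 < L)
    {C : Finset V} (hC : G.IsClique C) {m : ℕ} (hm : 2 * L * (L - 1) < m) (hm2 : 2 ≤ m) (y : V) :
    #{c ∈ C | G.Adj y c} < m ∨ #{c ∈ C | ¬ G.Adj y c} < m := by
  classical
  by_contra! hcon
  obtain ⟨P, hPs, hP⟩ := exists_subset_card_eq hcon.1
  obtain ⟨N, hNs, hN⟩ := exists_subset_card_eq hcon.2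
  have hP' : ∀ p ∈ P, p ∈ C ∧ G.Adj y p := fun p hp => mem_filter.1 (hPs hp)
  have hN' : ∀ q ∈ N, q ∈ C ∧ ¬ G.Adj y q := fun q hq => mem_filter.1 (hNs hq)
  refine hm.not_ge (hP ▸ hv.card_le_of_adj_of_not_adj hL (y := y) (N := N)
    (fun p hp => (hP' p hp).2) (fun q hq => ⟨?_, (hN' q hq).2⟩) (fun p hp q hq => ?_)
    (hP.trans hN.symm) (card_pos.1 (by omega)))
  · rintro rfl
    obtain ⟨z, hz, hzy⟩ := exists_mem_ne (by omega : 1 < #N) y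
    exact (hN' z hz).2 (hC (hN' y hq).1 (hN' z hz).1 hzy.symm)
  · refine hC (hP' p hp).1 (hN' q hq).1 ?_
    rintro rfl
    exact (hN' p hq).2 (hP' p hp).2

/-- All but a bounded number of neighbours of `x` are adjacent to most vertices of one of at most
`l` cliques. -/
theorem exists_family [Fintype V] [DecidableRel G.Adj] {l : ℕ} (hl : 1 ≤ l) (hv : G.IsGramRep (l : ℝ) v)
    {n m R : ℕ} (hn : (l + 1) * (l + (l + 1) * m) < n) (hm : 2 * l ^ 2 ≤ m) (x : V)
    (hR : ∀ S : Finset V, R ≤ #S →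
      (∃ C ⊆ S, G.IsClique C ∧ #C = n) ∨ ∃ I ⊆ S, G.IsIndepSet I ∧ #I = l ^ 2 + 1) :
    ∃ F : Finset (Finset V), #F ≤ l ∧
      (∀ C ∈ F, (∀ c ∈ C, G.Adj x c) ∧ G.IsClique C ∧ #C = n) ∧
      ∃ S : Finset V, #S < R ∧
        ∀ y, G.Adj x y → (∀ C ∈ F, m ≤ #{c ∈ C | ¬ G.Adj y c}) → y ∈ S := by
  classical
  have hl0 : (0 : ℝ) < l := by exact_mod_cast hl
  have hm2 : 2 ≤ m := by nlinarith
  have hmr : 2 * (l : ℝ) * (l - 1) < m := by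
    have : (2 * l ^ 2 : ℝ) ≤ m := by exact_mod_cast hm
    nlinarith
  have hmn : m < n := by nlinarith
  let good : Finset (Finset V) → Prop := fun F =>
    (∀ C ∈ F, (∀ c ∈ C, G.Adj x c) ∧ G.IsClique C ∧ #C = n) ∧
      ∀ C ∈ F, ∀ D ∈ F, C ≠ D → inner ℝ (∑ i ∈ C, v i) (∑ i ∈ D, v i) ≤ (n : ℝ) * m
  obtain ⟨F, hF, hmax⟩ := exists_max_image (univ.filter good) card
    ⟨∅, by simp [good]⟩
  simp only [mem_filter, mem_univ, true_and] at hF hmax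
  let far : V → Prop := fun y => G.Adj x y ∧ ∀ C ∈ F, m ≤ #{c ∈ C | ¬ G.Adj y c}
  refine ⟨F, ?_, hF.1, univ.filter far, ?_, fun y h1 h2 => by simpa using (⟨h1, h2⟩ : far y)⟩
  · by_contra! hcard
    obtain ⟨F', hF', hc⟩ := exists_subset_card_eq (Nat.succ_le_of_lt hcard)
    have := hv.card_family_le (F := F') (x := x) (n := n) (m := m) (by omega)
      (fun C hC => (hF.1 C (hF' hC)).1) (fun C hC => (hF.1 C (hF' hC)).2.2)
      (fun C hC D hD => hF.2 C (hF' hC) D (hF' hD))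
    rw [hc] at this
    have hn' : ((l : ℝ) + 1) * (l + (l + 1) * m) < n := by exact_mod_cast hn
    push_cast at this
    nlinarith
  · by_contra! hcard
    rcases hR _ hcard with ⟨D, hD, hcl, hDn⟩ | ⟨I, hI, hind, hIc⟩
    · have hD' : ∀ y ∈ D, G.Adj x y ∧ ∀ C ∈ F, m ≤ #{c ∈ C | ¬ G.Adj y c} := fun y hy =>
        (mem_filter.1 (hD hy)).2
      have hDF : D ∉ F := by
        intro hDF
        obtain ⟨y, hy⟩ : D.Nonempty := card_pos.1 (by omega)
        have h1 := (hD' y hy).2 D hDF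
        have h2 : {c ∈ D | ¬ G.Adj y c} ⊆ {y} := by
          intro c hc
          rw [mem_filter] at hc
          by_contra hne
          exact hc.2 (hcl hy hc.1 fun h => hne (by simp [h]))
        have h3 := card_le_card h2
        rw [card_singleton] at h3
        omega
      have hinner : ∀ C ∈ F, inner ℝ (∑ i ∈ D, v i) (∑ i ∈ C, v i) ≤ (n : ℝ) * m := by
        intro C hC
        rw [sum_inner, ← hDn, ← nsmul_eq_mul]
        refine sum_le_card_nsmul _ _ _ fun y hy => ?_
        have h1 := (hD' y hy).2 C hC
        have h2 := (hv.card_adj_lt_or_card_not_adj_lt hl0 (hF.1 C hC).2.1 hmr hm2 y).resolve_right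
          h1.not_gt
        have hyC : y ∉ C := by
          intro hyC
          have h2 : {c ∈ C | ¬ G.Adj y c} ⊆ {y} := by
            intro c hc
            rw [mem_filter] at hc
            by_contra hne
            exact hc.2 ((hF.1 C hC).2.1 hyC hc.1 fun h => hne (by simp [h]))
          have h3 := card_le_card h2
          rw [card_singleton] at h3
          omega
        rw [← sum_filter_add_sum_filter_not C (G.Adj y), inner_add_right,
          hv.inner_sum_eq_card fun z hz => (mem_filter.1 hz).2,
          hv.inner_sum_eq_zero fun z hz => ⟨fun h => hyC (by rw [h]; exact (mem_filter.1 hz).1),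
            (mem_filter.1 hz).2⟩, add_zero]
        exact_mod_cast h2.le
      have hgood : good (insert D F) := by
        refine ⟨fun C hC => ?_, fun C hC C' hC' hne => ?_⟩
        · rcases mem_insert.1 hC with rfl | hC
          · exact ⟨fun c hc => (hD' c hc).1, hcl, hDn⟩
          · exact hF.1 C hC
        · rcases mem_insert.1 hC with rfl | hCF <;> rcases mem_insert.1 hC' with rfl | hCF'
          · exact absurd rfl hne
          · exact hinner _ hCF'
          · exact (real_inner_comm _ _).trans_le (hinner _ hCF)
          · exact hF.2 C hCF C' hCF' hne
      have := hmax _ hgood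
      rw [card_insert_of_notMem hDF] at this
      omega
    · have h := hv.card_indepSet_le hl0 (x := x) (I := I)
        (fun z hz => ((mem_filter.1 (hI hz)).2 : far z).1) hind
      rw [hIc] at h
      push_cast at h
      linarith

/-- Among the vertices adjacent to most of a large clique, non-adjacency is sparse. -/
theorem card_not_adj_le [DecidableRel G.Adj] {l : ℕ} (hl : 1 ≤ l) (hv : G.IsGramRep (l : ℝ) v)
    {m d : ℕ} (hd : d = (l - 1) ^ 2 + 1) {C Q : Finset V}
    (hC : (l + d) ^ 2 * l + (d + 1) * m < #C) (hQ : ∀ y ∈ Q, #{c ∈ C | ¬ G.Adj y c} < m)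
    {y : V} (hy : y ∈ Q) : #{q ∈ Q | ¬ G.Adj y q} ≤ d := by
  classical
  by_contra! hcon
  have hyf : y ∈ ({q ∈ Q | ¬ G.Adj y q} : Finset V) := by simp [hy]
  obtain ⟨Z, hZs, hZ⟩ := exists_subset_card_eq (s := ({q ∈ Q | ¬ G.Adj y q} : Finset V).erase y)
    (n := d) (by rw [card_erase_of_mem hyf]; omega)
  have hZ' : ∀ z ∈ Z, z ≠ y ∧ z ∈ Q ∧ ¬ G.Adj y z := fun z hz => by simpa using hZs hz
  have hyZ : y ∉ Z := fun h => (hZ' y h).1 rfl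
  set C' := {c ∈ C | ∀ w ∈ insert y Z, G.Adj w c} with hC'
  have hcover : C ⊆ C' ∪ (insert y Z).biUnion fun w => {c ∈ C | ¬ G.Adj w c} := by
    intro c hc
    by_cases h : ∀ w ∈ insert y Z, G.Adj w c
    · exact mem_union_left _ (mem_filter.2 ⟨hc, h⟩)
    · push Not at h
      obtain ⟨w, hw, hwc⟩ := h
      exact mem_union_right _ (mem_biUnion.2 ⟨w, hw, mem_filter.2 ⟨hc, hwc⟩⟩)
  have h1 : #((insert y Z).biUnion fun w => {c ∈ C | ¬ G.Adj w c}) ≤ #(insert y Z) * m :=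
    card_biUnion_le_card_mul _ _ _ fun w hw => by
      refine (hQ w ?_).le
      rcases mem_insert.1 hw with rfl | hw
      · exact hy
      · exact (hZ' w hw).2.1
  rw [card_insert_of_notMem hyZ, hZ] at h1
  have h2 := (card_le_card hcover).trans (card_union_le _ _)
  have h3 : (l + d) ^ 2 * l < #C' := by omega
  have hdr : (#Z : ℝ) = ((l : ℝ) - 1) ^ 2 + 1 := by
    rw [hZ, hd]
    push_cast [Nat.cast_sub hl]
    ring
  have h4 := hv.two_mul_card_le (y := y) (Z := Z) (C := C')
    (fun z hz => ⟨(hZ' z hz).1.symm, (hZ' z hz).2.2⟩)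
    (fun c hc => (mem_filter.1 hc).2 y (mem_insert_self _ _))
    (fun z hz c hc => (mem_filter.1 hc).2 z (mem_insert_of_mem hz)) hdr
    (card_pos.1 (by omega))
  rw [hZ] at h4
  have h5 : ((l : ℝ) + d) ^ 2 * l < #C' := by exact_mod_cast h3
  nlinarith [sq_nonneg ((l : ℝ) + d)]

end IsGramRep

/-- A vertex of degree `k` lies in a clique of order about `k / (l * ((l - 1) ^ 2 + 1))`. -/
theorem exists_clique_of_isGramRep {l : ℕ} (hl : 1 ≤ l) : ∃ R : ℕ, ∀ (V : Type) (E : Type)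
    [NormedAddCommGroup E] [InnerProductSpace ℝ E] [Fintype V] [DecidableEq V] (G : SimpleGraph V)
    [DecidableRel G.Adj] (v : V → E), G.IsGramRep (l : ℝ) v → ∀ x : V,
    ∃ C : Finset V, x ∈ C ∧ G.IsClique C ∧ G.degree x ≤ R + l * (((l - 1) ^ 2 + 1) * #C) := by
  obtain ⟨d, hd⟩ : ∃ d, d = (l - 1) ^ 2 + 1 := ⟨_, rfl⟩
  obtain ⟨m, hm⟩ : ∃ m, m = 2 * l ^ 2 := ⟨_, rfl⟩
  obtain ⟨n, hn⟩ : ∃ n, n = (l + 1) * (l + (l + 1) * m) + ((l + d) ^ 2 * l + (d + 1) * m) + 1 :=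
    ⟨_, rfl⟩
  obtain ⟨R, hR⟩ := exists_clique_or_indep n (l ^ 2 + 1)
  refine ⟨R, fun V E _ _ _ _ G _ v hv x => ?_⟩
  obtain ⟨F, hFl, hF, S, hSR, hS⟩ := hv.exists_family hl (n := n) (m := m) (R := R) (by omega) hm.ge x
    (hR G)
  rw [← hd]
  set Q : Finset V → Finset V := fun C => {y | G.Adj x y ∧ #{c ∈ C | ¬ G.Adj y c} < m} with hQ
  have hclique : ∀ C ∈ F, ∃ K : Finset V, x ∈ K ∧ G.IsClique K ∧ #(Q C) ≤ d * #K := by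
    intro C hC
    obtain ⟨K, hKQ, hK, hcard⟩ := G.exists_clique_of_card_not_adj_le (Q C) d fun y hy =>
      hv.card_not_adj_le hl hd (m := m) (C := C) (by rw [(hF C hC).2.2]; omega)
        (fun z hz => (mem_filter.1 hz).2.2) hy
    refine ⟨insert x K, mem_insert_self _ _, ?_, hcard.trans ?_⟩
    · rw [coe_insert]
      exact hK.insert fun y hy _ => (mem_filter.1 (hKQ hy)).2.1
    · exact Nat.mul_le_mul_left _ (card_le_card (subset_insert _ _))
  by_contra! hcon
  have hcover : G.neighborFinset x ⊆ S ∪ F.biUnion Q := by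
    intro y hy
    rw [mem_neighborFinset] at hy
    by_cases h : ∀ C ∈ F, m ≤ #{c ∈ C | ¬ G.Adj y c}
    · exact mem_union_left _ (hS y hy h)
    · push Not at h
      obtain ⟨C, hC, hlt⟩ := h
      exact mem_union_right _ (mem_biUnion.2 ⟨C, hC, by simpa [hQ] using ⟨hy, hlt⟩⟩)
  have h1 := (card_le_card hcover).trans (card_union_le _ _)
  rw [card_neighborFinset_eq_degree] at h1
  have h2 : ∀ C ∈ F, l * #(Q C) ≤ G.degree x - R := by
    intro C hC
    obtain ⟨K, hxK, hK, hcard⟩ := hclique C hC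
    have := hcon K hxK hK
    have := Nat.mul_le_mul_left l hcard
    omega
  have h3 : l * #(F.biUnion Q) ≤ l * (G.degree x - R) := by
    calc l * #(F.biUnion Q) ≤ l * ∑ C ∈ F, #(Q C) := Nat.mul_le_mul_left _ card_biUnion_le
      _ = ∑ C ∈ F, l * #(Q C) := mul_sum _ _ _
      _ ≤ #F * (G.degree x - R) := sum_le_card_nsmul _ _ _ h2
      _ ≤ l * (G.degree x - R) := Nat.mul_le_mul_right _ hFl
  have h4 := Nat.le_of_mul_le_mul_left h3 hl
  have h5 := hcon {x} (mem_singleton_self x) (by simp)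
  omega

end SimpleGraph

/-- for large valency, every vertex of a connected `k`-regular graph with smallest
eigenvalue at least `-λ` lies in a clique of order at least `(k − ε(λ)) / (λ((λ−1)²+1))`. -/
theorem stmt_4 (lam : ℕ) (hlam : 1 ≤ lam) :
    ∃ (κ : ℕ) (ε : ℝ), 0 < κ ∧ 0 < ε ∧
      ∀ (V : Type) [Fintype V] [DecidableEq V] (G : SimpleGraph V) [DecidableRel G.Adj]
        (k : ℕ), G.Connected → G.IsRegularOfDegree k →
        (∀ μ : ℝ, G.adjEigenvalue μ → -(lam : ℝ) ≤ μ) → κ ≤ k →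
        ∀ x : V, ∃ C : Finset V, x ∈ C ∧ G.IsClique (C : Set V) ∧
          ((k : ℝ) - ε) / ((lam : ℝ) * (((lam : ℝ) - 1) ^ 2 + 1)) ≤ (C.card : ℝ) := by
  classical
  obtain ⟨R, hR⟩ := SimpleGraph.exists_clique_of_isGramRep hlam
  refine ⟨1, R + 1, one_pos, by positivity, fun V _ _ G _ k _ hreg hG _ x => ?_⟩
  obtain ⟨v, hv⟩ := G.exists_isGramRep (lam : ℝ) fun μ w hw h => hG μ ⟨w, hw, by
    rw [← h]
    congr 1
    ext i j
    simp [SimpleGraph.adjMatrix_apply]⟩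
  obtain ⟨C, hxC, hC, hcard⟩ := hR V _ G v hv x
  refine ⟨C, hxC, hC, ?_⟩
  rw [hreg.degree_eq x] at hcard
  have hlam' : (0 : ℝ) < lam := by exact_mod_cast hlam
  rw [div_le_iff₀ (by positivity)]
  have h : (k : ℝ) ≤ R + lam * ((((lam : ℝ) - 1) ^ 2 + 1) * C.card) := by
    have h' : (k : ℝ) ≤ (R + lam * (((lam - 1) ^ 2 + 1) * C.card) : ℕ) := by exact_mod_cast hcard
    simpa [Nat.cast_sub hlam] using h'
  linarith
end

section
/- Let t ≥ 1 be an integer and let P be a t-plex (in some finite simple graph G) with vertex set V(P). Then there exists a partition V(P) = V₁ ∪ V₂ ∪ … ∪ V_t such that for each i the set Vᵢ is a clique of G, and ||Vᵢ| − |Vⱼ|| ≤ 1 for all 1 ≤ i, j ≤ t. -/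
namespace HajnalSzemeredi

open Finset Relation

section Digraph

variable {ι : Type*} [DecidableEq ι]

/-- The relation `r` with both ends restricted to `D`. -/
def Restr (r : ι → ι → Prop) (D : Finset ι) (a b : ι) : Prop :=
  a ∈ D ∧ b ∈ D ∧ r a b

/-- A vertex `a` that reaches `v ≠ a` has an out-neighbour that reaches `v` without meeting `a`. -/
lemma exists_step_avoiding {r : ι → ι → Prop} {D : Finset ι} {a v : ι} (hav : a ≠ v)
    (h : ReflTransGen (Restr r D) a v) :
    ∃ b ∈ D.erase a, r a b ∧ ReflTransGen (Restr r (D.erase a)) b v := by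
  have stuck : ¬ ReflTransGen (Restr r (D.erase a)) a v := by
    intro h
    rcases h.cases_head with h | ⟨b, hb, -⟩
    · exact hav h
    · exact notMem_erase a D hb.1
  have key : ∀ z, ReflTransGen (Restr r D) z v →
      ReflTransGen (Restr r (D.erase a)) z v ∨
        ∃ b ∈ D.erase a, r a b ∧ ReflTransGen (Restr r (D.erase a)) b v := by
    intro z hz
    induction hz using ReflTransGen.head_induction_on with
    | refl => exact Or.inl .refl
    | @head x y hxy _ ih =>
      rcases ih with ih | ih
      · have hya : y ≠ a := by
          rintro rfl
          exact stuck ih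
        by_cases hxa : x = a
        · subst hxa
          exact Or.inr ⟨y, mem_erase.2 ⟨hya, hxy.2.1⟩, hxy.2.2, ih⟩
        · exact Or.inl (.head ⟨mem_erase.2 ⟨hxa, hxy.1⟩, mem_erase.2 ⟨hya, hxy.2.1⟩, hxy.2.2⟩ ih)
      · exact Or.inr ih
  exact (key a h).resolve_left stuck

/-- Of two distinct vertices reaching `v`, one reaches `v` avoiding the other. -/
lemma reach_avoiding_or {r : ι → ι → Prop} {S : Finset ι} {u w v : ι} (huw : u ≠ w)
    (hu : ReflTransGen (Restr r S) u v) :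
    ReflTransGen (Restr r (S.erase w)) u v ∨ ReflTransGen (Restr r (S.erase u)) w v := by
  by_contra! hcon
  obtain ⟨h1, h2⟩ := hcon
  have key : ∀ x, ReflTransGen (Restr r S) x v →
      ReflTransGen (Restr r (S.erase w)) x v ∧ ReflTransGen (Restr r (S.erase u)) x v := by
    intro x hx
    induction hx using ReflTransGen.head_induction_on with
    | refl => exact ⟨.refl, .refl⟩
    | @head x y hxy _ ih =>
      obtain ⟨ihw, ihu⟩ := ih
      have hyu : y ≠ u := by rintro rfl; exact h1 ihw
      have hyw : y ≠ w := by rintro rfl; exact h2 ihu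
      have hxu : x ≠ u := by
        rintro rfl
        exact h1 (.head ⟨mem_erase.2 ⟨huw, hxy.1⟩, mem_erase.2 ⟨hyw, hxy.2.1⟩, hxy.2.2⟩ ihw)
      have hxw : x ≠ w := by
        rintro rfl
        exact h2 (.head ⟨mem_erase.2 ⟨huw.symm, hxy.1⟩, mem_erase.2 ⟨hyu, hxy.2.1⟩, hxy.2.2⟩ ihu)
      exact ⟨.head ⟨mem_erase.2 ⟨hxw, hxy.1⟩, mem_erase.2 ⟨hyw, hxy.2.1⟩, hxy.2.2⟩ ihw,
        .head ⟨mem_erase.2 ⟨hxu, hxy.1⟩, mem_erase.2 ⟨hyu, hxy.2.1⟩, hxy.2.2⟩ ihu⟩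
  exact h1 (key u hu).1

/-- In a digraph on `S` in which every vertex reaches `v`, there are a vertex `u` and a nonempty
set `T` of vertices, none of which is needed by the others to reach `v`, with no arc from `T` to
a vertex outside `T` other than `u`. -/
lemma exists_terminal_set {r : ι → ι → Prop} {S : Finset ι} {v : ι} (hv : v ∈ S)
    (hS : ∀ a ∈ S, ReflTransGen (Restr r S) a v) (hne : ∃ a ∈ S, a ≠ v) :
    ∃ u ∈ S, ∃ T ⊆ S, u ∉ T ∧ v ∉ T ∧ T.Nonempty ∧
      (∀ w ∈ T, ∀ x ∈ S, x ≠ w → ReflTransGen (Restr r (S.erase w)) x v) ∧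
      (∀ w ∈ T, ∀ x ∈ S, x ≠ u → x ∉ T → ¬ r w x) := by
  classical
  let T : ι → Finset ι := fun u =>
    S.filter fun x => x ≠ u ∧ ¬ ReflTransGen (Restr r (S.erase u)) x v
  have hT : ∀ u x, x ∈ T u ↔ x ∈ S ∧ x ≠ u ∧ ¬ ReflTransGen (Restr r (S.erase u)) x v := by
    intro u x
    simp [T]
  have hTv : (T v).Nonempty := by
    obtain ⟨a, ha, hav⟩ := hne
    refine ⟨a, (hT _ _).2 ⟨ha, hav, fun h => ?_⟩⟩
    rcases h.cases_tail with h | ⟨b, -, hb⟩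
    · exact hav h.symm
    · exact notMem_erase v S hb.2.1
  obtain ⟨u, hu, hmin⟩ := exists_min_image (S.filter fun u => (T u).Nonempty) (fun u => #(T u))
    ⟨v, mem_filter.2 ⟨hv, hTv⟩⟩
  rw [mem_filter] at hu
  refine ⟨u, hu.1, T u, filter_subset _ _, fun h => ((hT _ _).1 h).2.1 rfl,
    fun h => ((hT _ _).1 h).2.2 .refl, hu.2, ?_, ?_⟩
  · intro w hw x hx hxw
    by_contra hcon
    obtain ⟨hwS, hwu, hwr⟩ := (hT _ _).1 hw
    have hsub : T w ⊂ T u := by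
      refine (ssubset_iff_of_subset ?_).2 ⟨w, hw, fun h => ((hT _ _).1 h).2.1 rfl⟩
      intro x hx
      obtain ⟨hxS, hxw, hxr⟩ := (hT _ _).1 hx
      refine (hT _ _).2 ⟨hxS, ?_, fun h => hxr ?_⟩
      · rintro rfl
        exact (reach_avoiding_or hxw (hS x hxS)).elim hxr hwr
      · clear hxr hxw hx hcon hxS
        induction h using ReflTransGen.head_induction_on with
        | refl => exact .refl
        | @head x y hxy hy ih =>
          have hyw : y ≠ w := by rintro rfl; exact hwr hy
          have hxw : x ≠ w := by rintro rfl; exact hwr (.head hxy hy)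
          exact .head ⟨mem_erase.2 ⟨hxw, mem_of_mem_erase hxy.1⟩,
            mem_erase.2 ⟨hyw, mem_of_mem_erase hxy.2.1⟩, hxy.2.2⟩ ih
    exact (card_lt_card hsub).not_ge
      (hmin w (mem_filter.2 ⟨hwS, x, (hT _ _).2 ⟨hx, hxw, hcon⟩⟩))
  · intro w hw x hx hxu hxT hwx
    obtain ⟨hwS, hwu, hwr⟩ := (hT _ _).1 hw
    have hxr : ReflTransGen (Restr r (S.erase u)) x v := by
      by_contra h
      exact hxT ((hT _ _).2 ⟨hx, hxu, h⟩)
    exact hwr (.head ⟨mem_erase.2 ⟨hwu, hwS⟩, mem_erase.2 ⟨hxu, hx⟩, hwx⟩ hxr)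

end Digraph

section Colouring

variable {V ι : Type*}

open scoped Classical in
/-- The part of the colour class `j` of `c` that lies in `P`. -/
noncomputable def colourClass (P : Finset V) (c : V → ι) (j : ι) : Finset V :=
  P.filter fun x => c x = j

open scoped Classical in
/-- The neighbours of `x` in `S`. -/
noncomputable def nbrs (G : SimpleGraph V) (x : V) (S : Finset V) : Finset V :=
  S.filter fun y => G.Adj x y

/-- `c` is a proper colouring of the subgraph induced by `P`. -/
def ProperOn (G : SimpleGraph V) (P : Finset V) (c : V → ι) : Prop :=
  ∀ x ∈ P, ∀ y ∈ P, G.Adj x y → c x ≠ c y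

/-- Some vertex of colour `a` may be recoloured with `b`. -/
def Movable (G : SimpleGraph V) (P : Finset V) (c : V → ι) (a b : ι) : Prop :=
  ∃ x ∈ P, c x = a ∧ ∀ y ∈ P, c y = b → ¬ G.Adj x y

@[simp] lemma mem_colourClass {P : Finset V} {c : V → ι} {j : ι} {x : V} :
    x ∈ colourClass P c j ↔ x ∈ P ∧ c x = j := by
  simp [colourClass]

@[simp] lemma mem_nbrs {G : SimpleGraph V} {x y : V} {S : Finset V} :
    y ∈ nbrs G x S ↔ y ∈ S ∧ G.Adj x y := by
  simp [nbrs]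

lemma nbrs_mono {G : SimpleGraph V} {x : V} {S S' : Finset V} (h : S ⊆ S') :
    nbrs G x S ⊆ nbrs G x S' := by
  intro y
  simp only [mem_nbrs]
  exact fun hy => ⟨h hy.1, hy.2⟩

/-- Reachability only depends on the colour classes in the set of permitted colours. -/
lemma reach_congr {G : SimpleGraph V} {P : Finset V} {c c' : V → ι} {D : Finset ι} {a v : ι}
    (hc : ∀ x ∈ P, ∀ j ∈ D, c x = j ↔ c' x = j)
    (h : ReflTransGen (Restr (Movable G P c) D) a v) :
    ReflTransGen (Restr (Movable G P c') D) a v := by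
  refine ReflTransGen.mono ?_ _ _ h
  rintro i j ⟨hi, hj, x, hx, hxi, hxj⟩
  exact ⟨hi, hj, x, hx, (hc x hx i hi).1 hxi, fun y hy hyj => hxj y hy ((hc y hy j hj).2 hyj)⟩

lemma reach_mono {r : ι → ι → Prop} {D D' : Finset ι} {a v : ι} (hD : D ⊆ D')
    (h : ReflTransGen (Restr r D) a v) : ReflTransGen (Restr r D') a v :=
  ReflTransGen.mono (fun _ _ hij => ⟨hD hij.1, hD hij.2.1, hij.2.2⟩) _ _ h

open scoped Classical in
lemma card_colourClass_insert {S : Finset V} {c : V → ι} {z : V} (hz : z ∉ S) (k j : ι) :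
    #(colourClass (insert z S) (Function.update c z k) j) =
      #(colourClass S c j) + (if j = k then 1 else 0) := by
  have h : ∀ x ∈ S, Function.update c z k x = c x := fun x hx => by
    rw [Function.update_of_ne]
    rintro rfl
    exact hz hx
  split_ifs with hjk
  · rw [← card_insert_of_notMem (a := z) (by simp [hz])]
    congr 1
    ext x
    by_cases hx : x = z
    · simp [hx, hjk]
    · simp [hx]
  · congr 1
    ext x
    by_cases hx : x = z
    · simp [hx, hz, Ne.symm hjk]
    · simp [hx]

open scoped Classical in
lemma card_colourClass_erase {P : Finset V} (c : V → ι) {z : V} (hz : z ∈ P) (j : ι) :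
    #(colourClass (P.erase z) c j) + (if j = c z then 1 else 0) = #(colourClass P c j) := by
  have h := card_colourClass_insert (c := c) (notMem_erase z P) (c z) j
  rw [insert_erase hz, Function.update_eq_self] at h
  exact h.symm

open scoped Classical in
lemma card_colourClass_update {P : Finset V} {c : V → ι} {z : V} (hz : z ∈ P) (k j : ι) :
    #(colourClass P (Function.update c z k) j) + (if j = c z then 1 else 0) =
      #(colourClass P c j) + (if j = k then 1 else 0) := by
  have h1 := card_colourClass_erase c hz j
  have h2 := card_colourClass_insert (c := c) (notMem_erase z P) k j
  rw [insert_erase hz] at h2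
  omega

open scoped Classical in
lemma ProperOn.insert_update {G : SimpleGraph V} {S : Finset V} {c : V → ι} {z : V} {k : ι}
    (hc : ProperOn G (S.erase z) c) (hk : ∀ y ∈ S, c y = k → y ≠ z → ¬ G.Adj z y) :
    ProperOn G (insert z S) (Function.update c z k) := by
  intro x hx y hy hxy
  by_cases hxz : x = z
  · subst hxz
    have hyx : y ≠ x := hxy.ne'
    rw [Function.update_self, Function.update_of_ne hyx]
    exact fun h => hk y (mem_of_mem_insert_of_ne hy hyx) h.symm hyx hxy
  · have hxS := mem_of_mem_insert_of_ne hx hxz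
    by_cases hyz : y = z
    · subst hyz
      rw [Function.update_self, Function.update_of_ne hxz]
      exact fun h => hk x hxS h hxz hxy.symm
    · rw [Function.update_of_ne hxz, Function.update_of_ne hyz]
      exact hc x (mem_erase.2 ⟨hxz, hxS⟩) y
        (mem_erase.2 ⟨hyz, mem_of_mem_insert_of_ne hy hyz⟩) hxy

lemma ProperOn.mono {G : SimpleGraph V} {S S' : Finset V} {c : V → ι} (hc : ProperOn G S' c)
    (h : S ⊆ S') : ProperOn G S c :=
  fun x hx y hy => hc x (h hx) y (h hy)

open scoped Classical in
/-- If `z` can be recoloured with a colour `a` that reaches `v` within `D`, recolouring `z` and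
one vertex of each class along a path from `a` to `v` makes the class of `z` smaller and
the class of `v` larger, and keeps the size of all other classes. -/
lemma exists_shift {G : SimpleGraph V} {P : Finset V} (D : Finset ι) {v : ι} :
    ∀ {c : V → ι} {z : V} {a : ι}, ProperOn G P c → z ∈ P → c z ∉ D → a ∈ D →
      (∀ y ∈ P, c y = a → ¬ G.Adj z y) → ReflTransGen (Restr (Movable G P c) D) a v →
      ∃ c' : V → ι, ProperOn G P c' ∧ c' z ∈ D ∧ (∀ x, c x ∈ D → c' x ∈ D) ∧
        (∀ x, x ≠ z → c x ∉ D → c' x = c x) ∧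
        ∀ j, #(colourClass P c' j) + (if j = c z then 1 else 0) =
          #(colourClass P c j) + (if j = v then 1 else 0) := by
  induction D using Finset.strongInduction with
  | H D ih =>
  intro c z a hc hz hzD ha hza hreach
  set c₁ := Function.update c z a with hc₁
  have hz₁ : c₁ z = a := by simp [hc₁]
  have hne₁ : ∀ x, x ≠ z → c₁ x = c x := fun x hx => by simp [hc₁, hx]
  have hp₁ : ProperOn G P c₁ := by
    have h := (hc.mono (erase_subset z P)).insert_update fun y hy hya _ => hza y hy hya
    rwa [insert_eq_of_mem hz] at h
  by_cases hav : a = v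
  · subst hav
    refine ⟨c₁, hp₁, hz₁ ▸ ha, ?_, fun x hx _ => hne₁ x hx, card_colourClass_update hz a⟩
    intro x hx
    by_cases hxz : x = z
    · rw [hxz, hz₁]; exact ha
    · rwa [hne₁ x hxz]
  obtain ⟨b, hb, ⟨x, hx, hxa, hxb⟩, hbv⟩ := exists_step_avoiding hav hreach
  have hbne : b ≠ a := ne_of_mem_erase hb
  have hbD : b ∈ D := mem_of_mem_erase hb
  have hxz : x ≠ z := by rintro rfl; exact hzD (hxa ▸ ha)
  have hcongr : ∀ y ∈ P, ∀ j ∈ D.erase a, c y = j ↔ c₁ y = j := by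
    intro y _ j hj
    by_cases hyz : y = z
    · rw [hyz, hz₁]
      exact ⟨fun h => absurd (h ▸ mem_of_mem_erase hj) hzD,
        fun h => absurd h.symm (ne_of_mem_erase hj)⟩
    · rw [hne₁ y hyz]
  have hx₁ : c₁ x = a := by rw [hne₁ x hxz, hxa]
  obtain ⟨c', hp', hx', hin', hout', hcard'⟩ := ih (D.erase a) (erase_ssubset ha) hp₁ hx
    (by rw [hx₁]; exact notMem_erase a D) hb
    (fun y hy hyb => hxb y hy ((hcongr y hy b hb).2 hyb)) (reach_congr hcongr hbv)
  have hfix : ∀ y, y ≠ x → c₁ y = a → c' y = a := by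
    intro y hyx hy
    rw [hout' y hyx (by rw [hy]; exact notMem_erase a D), hy]
  refine ⟨c', hp', ?_, ?_, ?_, ?_⟩
  · rw [hfix z hxz.symm hz₁]; exact ha
  · intro y hy
    by_cases hyx : y = x
    · subst hyx; exact mem_of_mem_erase hx'
    · have hyz : y ≠ z := by rintro rfl; exact hzD hy
      by_cases hya : c y = a
      · rw [hfix y hyx (by rw [hne₁ y hyz, hya])]; exact ha
      · exact mem_of_mem_erase (hin' y (by rw [hne₁ y hyz]; exact mem_erase.2 ⟨hya, hy⟩))
  · intro y hyz hy
    have hyx : y ≠ x := by rintro rfl; exact hy (hxa ▸ ha)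
    rw [hout' y hyx (by rw [hne₁ y hyz]; exact fun h => hy (mem_of_mem_erase h)), hne₁ y hyz]
  · intro j
    have h1 := card_colourClass_update hz a (c := c) j
    have h2 := hcard' j
    rw [hx₁] at h2
    rw [← hc₁] at h1
    omega


/-- The vertices of `P` whose colour lies in `T`. -/
noncomputable def part (P : Finset V) (c : V → ι) (T : Finset ι) : Finset V := by
  classical exact P.filter fun x => c x ∈ T

@[simp] lemma mem_part {P : Finset V} {c : V → ι} {T : Finset ι} {x : V} :
    x ∈ part P c T ↔ x ∈ P ∧ c x ∈ T := by
  simp [part]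

lemma card_part (P : Finset V) (c : V → ι) (T : Finset ι) :
    #(part P c T) = ∑ j ∈ T, #(colourClass P c j) := by
  classical
  rw [card_eq_sum_card_fiberwise (f := c) (t := T) (fun x hx => (mem_part.1 hx).2)]
  refine sum_congr rfl fun j hj => congrArg card ?_
  ext x
  simp only [mem_filter, mem_part, mem_colourClass]
  grind

open scoped Classical in
lemma card_filter_part (P : Finset V) (c : V → ι) (T : Finset ι) (p : V → Prop) :
    #((part P c T).filter p) = ∑ j ∈ T, #((colourClass P c j).filter p) := by
  rw [card_eq_sum_card_fiberwise (f := c) (t := T)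
    (fun x hx => (mem_part.1 (mem_filter.1 hx).1).2)]
  refine sum_congr rfl fun j hj => congrArg card ?_
  ext x
  simp only [mem_filter, mem_part, mem_colourClass]
  grind

lemma card_nbrs_part (G : SimpleGraph V) (x : V) (P : Finset V) (c : V → ι) (T : Finset ι) :
    #(nbrs G x (part P c T)) = ∑ j ∈ T, #(nbrs G x (colourClass P c j)) := by
  classical
  exact card_filter_part P c T _

lemma sum_card_nbrs_comm (G : SimpleGraph V) (A B : Finset V) :
    ∑ y ∈ B, #(nbrs G y A) = ∑ x ∈ A, #(nbrs G x B) := by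
  classical
  have h := sum_card_bipartiteAbove_eq_sum_card_bipartiteBelow (s := B) (t := A) G.Adj
  simp only [bipartiteAbove, bipartiteBelow, G.adj_comm _] at h
  convert h using 3 <;> simp [nbrs]

open scoped Classical in
/-- Gluing colourings of disjoint vertex sets that use disjoint sets of colours. -/
lemma ProperOn.glue {G : SimpleGraph V} {P P₁ P₂ : Finset V} {c₁ c₂ : V → ι} {S : Finset ι}
    (hP : ∀ x, x ∈ P ↔ x ∈ P₁ ∨ x ∈ P₂) (hdisj : ∀ x ∈ P₁, x ∉ P₂)
    (h₁ : ProperOn G P₁ c₁) (h₂ : ProperOn G P₂ c₂)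
    (hc₁ : ∀ x ∈ P₁, c₁ x ∈ S) (hc₂ : ∀ x ∈ P₂, c₂ x ∉ S) :
    ∃ c : V → ι, ProperOn G P c ∧ (∀ x ∈ P₁, c x = c₁ x) ∧ (∀ x ∈ P₂, c x = c₂ x) ∧
      (∀ j ∈ S, colourClass P c j = colourClass P₁ c₁ j) ∧
      (∀ j ∉ S, colourClass P c j = colourClass P₂ c₂ j) := by
  obtain ⟨c, hc⟩ : ∃ c : V → ι, c = fun x => if x ∈ P₂ then c₂ x else c₁ x := ⟨_, rfl⟩
  have e₁ : ∀ x ∈ P₁, c x = c₁ x := fun x hx => by simp [hc, hdisj x hx]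
  have e₂ : ∀ x ∈ P₂, c x = c₂ x := fun x hx => by simp [hc, hx]
  refine ⟨c, ?_, e₁, e₂, ?_, ?_⟩
  · intro x hx y hy hxy h
    rcases (hP x).1 hx with hx | hx <;> rcases (hP y).1 hy with hy | hy
    · exact h₁ x hx y hy hxy (by rw [← e₁ x hx, ← e₁ y hy, h])
    · exact hc₂ y hy (by rw [← e₂ y hy, ← h, e₁ x hx]; exact hc₁ x hx)
    · exact hc₂ x hx (by rw [← e₂ x hx, h, e₁ y hy]; exact hc₁ y hy)
    · exact h₂ x hx y hy hxy (by rw [← e₂ x hx, ← e₂ y hy, h])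
  · intro j hj
    ext x
    simp only [mem_colourClass, hP]
    constructor
    · rintro ⟨hx | hx, h⟩
      · exact ⟨hx, by rw [← e₁ x hx, h]⟩
      · exact absurd hj (by rw [← h, e₂ x hx]; exact hc₂ x hx)
    · rintro ⟨hx, h⟩
      exact ⟨Or.inl hx, by rw [e₁ x hx, h]⟩
  · intro j hj
    ext x
    simp only [mem_colourClass, hP]
    constructor
    · rintro ⟨hx | hx, h⟩
      · exact absurd (hc₁ x hx) (by rw [← e₁ x hx, h]; exact hj)
      · exact ⟨hx, by rw [← e₂ x hx, h]⟩
    · rintro ⟨hx, h⟩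
      exact ⟨Or.inr hx, by rw [e₂ x hx, h]⟩

end Colouring

section Counting

variable {V : Type*}

open scoped Classical in
/-- If every vertex of `B` has a neighbour in `W`, and the vertices of `W` that are the only
neighbour in `W` of some vertex of `B` have few neighbours in `B`, then some vertex of `W` has
many neighbours in `B`. -/
lemma lt_of_solo_degree {G : SimpleGraph V} {W B : Finset V} {s q t : ℕ} (hW : #W = s)
    (hB : #B = s * q + 1) (hBW : ∀ y ∈ B, 1 ≤ #(nbrs G y W))
    (hWB : ∀ z ∈ W, #(nbrs G z B) ≤ q + t)
    (hsolo : ∀ z ∈ W, ∀ y ∈ B, G.Adj z y → (∀ x ∈ W, G.Adj y x → x = z) → #(nbrs G z B) ≤ q) :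
    q < t := by
  by_contra! htq
  let σ : V → V → Prop := fun y z => G.Adj z y ∧ ∀ x ∈ W, G.Adj y x → x = z
  have h1 : ∑ y ∈ B, 2 ≤ ∑ y ∈ B, (#(nbrs G y W) + #(W.filter (σ y))) := by
    refine sum_le_sum fun y hy => ?_
    have h := hBW y hy
    by_cases h2 : #(nbrs G y W) = 1
    · obtain ⟨z, hz⟩ := card_eq_one.1 h2
      have hzW : z ∈ nbrs G y W := by simp [hz]
      have : 0 < #(W.filter (σ y)) := by
        refine card_pos.2 ⟨z, mem_filter.2 ⟨(mem_nbrs.1 hzW).1, (mem_nbrs.1 hzW).2.symm, ?_⟩⟩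
        intro x hx hyx
        have : x ∈ nbrs G y W := mem_nbrs.2 ⟨hx, hyx⟩
        simpa [hz] using this
      omega
    · omega
  have h2 : ∑ y ∈ B, (#(nbrs G y W) + #(W.filter (σ y))) =
      ∑ z ∈ W, (#(nbrs G z B) + #(B.filter fun y => σ y z)) := by
    rw [sum_add_distrib, sum_add_distrib, sum_card_nbrs_comm]
    congr 1
    exact sum_card_bipartiteAbove_eq_sum_card_bipartiteBelow σ
  have h3 : ∑ z ∈ W, (#(nbrs G z B) + #(B.filter fun y => σ y z)) ≤ ∑ z ∈ W, 2 * q := by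
    refine sum_le_sum fun z hz => ?_
    have hle : #(B.filter fun y => σ y z) ≤ #(nbrs G z B) :=
      card_le_card fun y hy => mem_nbrs.2 ⟨(mem_filter.1 hy).1, (mem_filter.1 hy).2.1⟩
    rcases (B.filter fun y => σ y z).eq_empty_or_nonempty with he | ⟨y, hy⟩
    · have := hWB z hz
      rw [he, card_empty]
      omega
    · obtain ⟨hyB, hzy, huniq⟩ := mem_filter.1 hy
      have := hsolo z hz y hyB hzy huniq
      omega
  rw [h2] at h1
  have h4 := h1.trans h3
  simp only [sum_const, smul_eq_mul, hW, hB] at h4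
  nlinarith

open scoped Classical in
/-- The discharging step: each `z ∈ A` distributes weight `q` evenly over its `σ`-partners. -/
lemma false_of_solo_cliques {A B : Finset V} {s q t : ℕ} {σ : V → V → Prop} {d : V → ℕ}
    (ht : q < t) (hA : #A = s * t) (hB : #B = s * q + 1) (hd : ∀ y ∈ B, d y + 1 ≤ q)
    (hmany : ∀ y ∈ B, d y + t + 1 ≤ q + #(A.filter fun z => σ z y))
    (hclique : ∀ z ∈ A, ∀ y ∈ B, σ z y → #(B.filter (σ z)) ≤ d y + 1) : False := by
  let μ : V → ℚ := fun z => q / #(B.filter (σ z))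
  have h1 : ∑ z ∈ A, ∑ y ∈ B.filter (σ z), μ z ≤ ∑ z ∈ A, (q : ℚ) := by
    refine sum_le_sum fun z _ => ?_
    rw [sum_const, nsmul_eq_mul]
    rcases eq_or_ne (#(B.filter (σ z)) : ℚ) 0 with h | h
    · simp [μ, h]
    · exact (mul_div_cancel₀ _ h).le
  have h2 : ∑ z ∈ A, ∑ y ∈ B.filter (σ z), μ z =
      ∑ y ∈ B, ∑ z ∈ A.filter (fun z => σ z y), μ z := by
    simp only [sum_filter]
    exact sum_comm
  have h3 : ∑ y ∈ B, (t : ℚ) ≤ ∑ y ∈ B, ∑ z ∈ A.filter (fun z => σ z y), μ z := by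
    refine sum_le_sum fun y hy => ?_
    have hlow : ∀ z ∈ A.filter (fun z => σ z y), (q : ℚ) / (d y + 1) ≤ μ z := by
      intro z hz
      obtain ⟨hzA, hzy⟩ := mem_filter.1 hz
      have hpos : 0 < #(B.filter (σ z)) := card_pos.2 ⟨y, mem_filter.2 ⟨hy, hzy⟩⟩
      have hle := hclique z hzA y hy hzy
      refine div_le_div_of_nonneg_left (by positivity) (by exact_mod_cast hpos) ?_
      exact_mod_cast hle
    refine le_trans ?_ (card_nsmul_le_sum _ _ _ hlow)
    rw [nsmul_eq_mul, ← mul_div_assoc, le_div_iff₀ (by positivity)]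
    have e1 : (d y : ℚ) + 1 ≤ q := by exact_mod_cast hd y hy
    have e2 : (d y : ℚ) + t + 1 ≤ q + #(A.filter fun z => σ z y) := by exact_mod_cast hmany y hy
    have e3 : (q : ℚ) < t := by exact_mod_cast ht
    have e4 : (0 : ℚ) ≤ q := by positivity
    nlinarith [mul_nonneg (sub_nonneg.2 e3.le) (sub_nonneg.2 e1)]
  rw [h2] at h1
  have h4 := h3.trans h1
  simp only [sum_const, nsmul_eq_mul, hA, hB] at h4
  have h5 : (s * q + 1) * t ≤ s * t * q := by exact_mod_cast h4
  nlinarith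

end Counting
section Main

variable {V ι : Type*}

/-- `P` has a proper colouring with the colours in `C` whose classes all have size `s`. -/
def Equitable (G : SimpleGraph V) (P : Finset V) (C : Finset ι) (s : ℕ) : Prop :=
  ∃ c : V → ι, (∀ x ∈ P, c x ∈ C) ∧ ProperOn G P c ∧ ∀ j ∈ C, #(colourClass P c j) = s

open scoped Classical in
/-- A proper colouring with all classes of size `s`, except for the class of `v`, which has one
element less, and the class of `w`, which has one more. -/
structure NearlyEquitable (G : SimpleGraph V) (P : Finset V) (C : Finset ι) (s : ℕ) (c : V → ι)
    (v w : ι) : Prop where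
  mapsTo : ∀ x ∈ P, c x ∈ C
  proper : ProperOn G P c
  small_mem : v ∈ C
  large_mem : w ∈ C
  small_ne_large : v ≠ w
  card_class : ∀ j ∈ C, #(colourClass P c j) + (if j = v then 1 else 0) =
    s + (if j = w then 1 else 0)

/-- The colours from which `v` is reachable. -/
noncomputable def accessible (G : SimpleGraph V) (P : Finset V) (C : Finset ι) (c : V → ι)
    (v : ι) : Finset ι := by
  classical exact C.filter fun a => ReflTransGen (Restr (Movable G P c) C) a v

@[simp] lemma mem_accessible {G : SimpleGraph V} {P : Finset V} {C : Finset ι} {c : V → ι}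
    {v a : ι} : a ∈ accessible G P C c v ↔
      a ∈ C ∧ ReflTransGen (Restr (Movable G P c) C) a v := by
  simp [accessible]

lemma mem_accessible_of_movable {G : SimpleGraph V} {P : Finset V} {C : Finset ι} {c : V → ι}
    {v a b : ι} (ha : a ∈ C) (hb : b ∈ accessible G P C c v) (hab : Movable G P c a b) :
    a ∈ accessible G P C c v := by
  rw [mem_accessible] at hb ⊢
  exact ⟨ha, .head ⟨ha, hb.1, hab⟩ hb.2⟩

lemma reach_of_mem_accessible {G : SimpleGraph V} {P : Finset V} {C : Finset ι} {c : V → ι}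
    {v a : ι} (ha : a ∈ accessible G P C c v) :
    ReflTransGen (Restr (Movable G P c) (accessible G P C c v)) a v := by
  obtain ⟨haC, h⟩ := mem_accessible.1 ha
  clear ha haC
  induction h using ReflTransGen.head_induction_on with
  | refl => exact .refl
  | @head x y hxy hy ih =>
    exact .head ⟨mem_accessible.2 ⟨hxy.1, .head hxy hy⟩, mem_accessible.2 ⟨hxy.2.1, hy⟩, hxy.2.2⟩ ih

/-- `y` is adjacent to `z` and to no other vertex of the colour class of `z`. -/
def IsSolo (G : SimpleGraph V) (P : Finset V) (c : V → ι) (z y : V) : Prop :=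
  G.Adj z y ∧ ∀ x ∈ P, c x = c z → G.Adj y x → x = z

namespace NearlyEquitable

variable {G : SimpleGraph V} {P : Finset V} {C : Finset ι} {s : ℕ} {c : V → ι} {v w : ι}

lemma small_mem_accessible (h : NearlyEquitable G P C s c v w) : v ∈ accessible G P C c v :=
  mem_accessible.2 ⟨h.small_mem, .refl⟩

lemma one_le_card_nbrs {y : V} {a : ι} (hyP : y ∈ P) (hyC : c y ∈ C)
    (hy : c y ∉ accessible G P C c v) (ha : a ∈ accessible G P C c v) :
    1 ≤ #(nbrs G y (colourClass P c a)) := by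
  rw [Nat.one_le_iff_ne_zero, ← Nat.pos_iff_ne_zero, card_pos]
  by_contra hcon
  refine hy (mem_accessible_of_movable hyC ha ⟨y, hyP, rfl, fun x hx hxa hadj => hcon ⟨x, ?_⟩⟩)
  exact mem_nbrs.2 ⟨mem_colourClass.2 ⟨hx, hxa⟩, hadj⟩

/-- If the large class is accessible then shifting along a path yields an equitable colouring. -/
lemma equitable_of_large_mem (h : NearlyEquitable G P C s c v w)
    (hw : w ∈ accessible G P C c v) : Equitable G P C s := by
  classical
  obtain ⟨a, ha, ⟨z, hz, hzw, hza⟩, hav⟩ :=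
    exists_step_avoiding h.small_ne_large.symm (mem_accessible.1 hw).2
  obtain ⟨c', hp, hzD, hin, hout, hcard⟩ := exists_shift (C.erase w) h.proper hz
    (by rw [hzw]; exact notMem_erase w C) ha hza hav
  refine ⟨c', fun x hx => ?_, hp, fun j hj => ?_⟩
  · by_cases hxz : x = z
    · rw [hxz]; exact mem_of_mem_erase hzD
    · by_cases hxw : c x = w
      · rw [hout x hxz (by rw [hxw]; exact notMem_erase w C)]; exact h.mapsTo x hx
      · exact mem_of_mem_erase (hin x (mem_erase.2 ⟨hxw, h.mapsTo x hx⟩))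
  · have h1 := hcard j
    have h2 := h.card_class j hj
    rw [hzw] at h1
    omega

open scoped Classical in
lemma card_part_inaccessible (h : NearlyEquitable G P C s c v w)
    (hw : w ∉ accessible G P C c v) :
    #(part P c (C \ accessible G P C c v)) = s * #(C \ accessible G P C c v) + 1 := by
  have h1 : ∀ j ∈ C \ accessible G P C c v,
      #(colourClass P c j) = s + (if j = w then 1 else 0) := by
    intro j hj
    obtain ⟨hjC, hj⟩ := mem_sdiff.1 hj
    have h2 := h.card_class j hjC
    rwa [if_neg (fun hjv : j = v => hj (hjv ▸ h.small_mem_accessible)), add_zero] at h2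
  rw [card_part, sum_congr rfl h1, sum_add_distrib, sum_ite_eq',
    if_pos (mem_sdiff.2 ⟨h.large_mem, hw⟩), sum_const, smul_eq_mul, mul_comm]

open scoped Classical in
lemma degree_split (h : NearlyEquitable G P C s c v w) {S : Finset ι} (hS : S ⊆ C) (x : V) :
    #(nbrs G x (part P c (C \ S))) + ∑ j ∈ S, #(nbrs G x (colourClass P c j)) =
      #(nbrs G x P) := by
  have hP : P = part P c C := by
    ext x
    simpa using h.mapsTo x
  conv_rhs => rw [hP]
  rw [card_nbrs_part, card_nbrs_part, sum_sdiff hS]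

open scoped Classical in
/-- Colourings of the two sides can be completed to an equitable colouring when a solo vertex can
be moved within the accessible part. -/
lemma equitable_of_movable_solo (h : NearlyEquitable G P C s c v w)
    (hw : w ∉ accessible G P C c v)
    (hB : ∀ y ∈ part P c (C \ accessible G P C c v),
      Equitable G ((part P c (C \ accessible G P C c v)).erase y) (C \ accessible G P C c v) s)
    {z y : V} {a : ι} (hz : z ∈ P) (hzS : c z ∈ accessible G P C c v)
    (hy : y ∈ part P c (C \ accessible G P C c v)) (hzy : IsSolo G P c z y)
    (ha : a ∈ accessible G P C c v) (haz : a ≠ c z)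
    (hza : ∀ x ∈ P, c x = a → ¬ G.Adj z x)
    (hreach : ReflTransGen (Restr (Movable G P c) ((accessible G P C c v).erase (c z))) a v) :
    Equitable G P C s := by
  set S := accessible G P C c v with hS
  obtain ⟨g, hgC, hgp, hgs⟩ := hB y hy
  obtain ⟨c', hp', hz', hin', hout', hcard'⟩ := exists_shift (S.erase (c z)) h.proper hz
    (notMem_erase _ _) (mem_erase.2 ⟨haz, ha⟩) hza hreach
  obtain ⟨hyP, hyC⟩ := mem_part.1 hy
  obtain ⟨hyC, hyS⟩ := mem_sdiff.1 hyC
  have hSC : S ⊆ C := fun j hj => (mem_accessible.1 hj).1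
  have hin : ∀ x, c x ∈ S → c' x ∈ S := by
    intro x hx
    by_cases hxz : x = z
    · rw [hxz]; exact mem_of_mem_erase hz'
    · by_cases hxc : c x = c z
      · rw [hout' x hxz (by rw [hxc]; exact notMem_erase _ _)]; exact hx
      · exact mem_of_mem_erase (hin' x (mem_erase.2 ⟨hxc, hx⟩))
  have hout : ∀ x, c x ∉ S → c' x = c x := by
    intro x hx
    refine hout' x ?_ fun h => hx (mem_of_mem_erase h)
    rintro rfl
    exact hx hzS
  have hyA : y ∉ part P c S := fun h => hyS (mem_part.1 h).2
  have hcz : ∀ x ∈ part P c S, c' x = c z → c x = c z ∧ x ≠ z := by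
    intro x hx hxc
    refine ⟨?_, ?_⟩
    · by_contra hne
      have := hin' x (mem_erase.2 ⟨hne, (mem_part.1 hx).2⟩)
      exact (ne_of_mem_erase this) hxc
    · rintro rfl
      exact (ne_of_mem_erase hz') hxc
  have hp₁ : ProperOn G (insert y (part P c S)) (Function.update c' y (c z)) := by
    refine ProperOn.insert_update (hp'.mono fun x hx => ?_) fun x hx hxc _ hadj => ?_
    · exact (mem_part.1 (mem_of_mem_erase hx)).1
    · obtain ⟨h1, h2⟩ := hcz x hx hxc
      exact h2 (hzy.2 x (mem_part.1 hx).1 h1 hadj)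
  obtain ⟨f, hfp, hf₁, hf₂, hfS, hfC⟩ := ProperOn.glue (P := P) (S := S)
    (P₁ := insert y (part P c S)) (P₂ := (part P c (C \ S)).erase y)
    (by
      intro x
      have := h.mapsTo x
      by_cases hxy : x = y
      · simp [hxy, hyP]
      · simp only [mem_insert, mem_part, mem_erase, mem_sdiff]
        tauto)
    (by
      intro x
      simp only [mem_insert, mem_part, mem_erase, mem_sdiff]
      tauto) hp₁ hgp
    (by
      intro x hx
      by_cases hxy : x = y
      · rw [hxy, Function.update_self]; exact hzS
      · rw [Function.update_of_ne hxy]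
        exact hin x (mem_part.1 (mem_of_mem_insert_of_ne hx hxy)).2)
    (fun x hx => (mem_sdiff.1 (hgC x hx)).2)
  refine ⟨f, fun x hx => ?_, hfp, fun j hj => ?_⟩
  · by_contra hxC
    have hxS : f x ∉ S := fun h => hxC (hSC h)
    have hx' : x ∈ colourClass P f (f x) := mem_colourClass.2 ⟨hx, rfl⟩
    rw [hfC _ hxS, mem_colourClass] at hx'
    have := hgC x hx'.1
    rw [hx'.2] at this
    exact hxC (mem_sdiff.1 this).1
  · by_cases hjS : j ∈ S
    · rw [hfS j hjS, card_colourClass_insert hyA]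
      have h1 : colourClass (part P c S) c' j = colourClass P c' j := by
        ext x
        simp only [mem_colourClass, mem_part]
        refine ⟨fun h => ⟨h.1.1, h.2⟩, fun h => ⟨⟨h.1, ?_⟩, h.2⟩⟩
        by_contra hx
        exact hx (by rw [← hout x hx, h.2]; exact hjS)
      have h2 := h.card_class j hj
      rw [if_neg (fun hjw : j = w => hw (hjw ▸ hjS))] at h2
      have h3 := hcard' j
      rw [h1]
      omega
    · rw [hfC j hjS]
      exact hgs j (mem_sdiff.2 ⟨hj, hjS⟩)

open scoped Classical in
/-- If an unmovable solo vertex has two nonadjacent special neighbours, then there is a nearly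
equitable colouring with more accessible classes. -/
lemma exists_more_accessible (h : NearlyEquitable G P C s c v w)
    (hw : w ∉ accessible G P C c v)
    (hB : ∀ y ∈ part P c (C \ accessible G P C c v),
      Equitable G ((part P c (C \ accessible G P C c v)).erase y) (C \ accessible G P C c v) s)
    {z y y' : V} (hz : z ∈ P) (hzS : c z ∈ accessible G P C c v) (hzv : c z ≠ v)
    (hy : y ∈ part P c (C \ accessible G P C c v)) (hzy : IsSolo G P c z y)
    (hy' : y' ∈ part P c (C \ accessible G P C c v)) (hzy' : IsSolo G P c z y')
    (hyy' : y ≠ y') (hadj : ¬ G.Adj y y')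
    (hmov : ∀ a ∈ accessible G P C c v, a ≠ c z → ∃ x ∈ P, c x = a ∧ G.Adj z x)
    (hdeg : #(nbrs G z (part P c (C \ accessible G P C c v))) ≤ #(C \ accessible G P C c v))
    (hterm : ∀ a ∈ accessible G P C c v, a ≠ c z →
      ReflTransGen (Restr (Movable G P c) ((accessible G P C c v).erase (c z))) a v) :
    ∃ f : V → ι, ∃ b, NearlyEquitable G P C s f v b ∧
      accessible G P C c v ⊂ accessible G P C f v := by
  set S := accessible G P C c v with hS
  obtain ⟨g, hgC, hgp, hgs⟩ := hB y hy
  set B := part P c (C \ S) with hBdef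
  have hSC : S ⊆ C := fun j hj => (mem_accessible.1 hj).1
  obtain ⟨hyP, hyC⟩ := mem_part.1 hy
  obtain ⟨hyC, hyS⟩ := mem_sdiff.1 hyC
  obtain ⟨hyP', hyC'⟩ := mem_part.1 hy'
  have hzy_ne : z ≠ y := hzy.1.ne
  have hzB : z ∉ B := fun h => (mem_sdiff.1 (mem_part.1 h).2).2 hzS
  obtain ⟨b, hb, hbz⟩ : ∃ b ∈ C \ S, ∀ x ∈ B.erase y, g x = b → ¬ G.Adj z x := by
    by_contra! hcon
    have h1 : C \ S ⊆ (nbrs G z (B.erase y)).image g := by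
      intro b hb
      obtain ⟨x, hx, hxb, hzx⟩ := hcon b hb
      exact mem_image.2 ⟨x, mem_nbrs.2 ⟨hx, hzx⟩, hxb⟩
    have h2 := (card_le_card h1).trans card_image_le
    have h3 : nbrs G z (B.erase y) ⊂ nbrs G z B := by
      refine (ssubset_iff_of_subset (nbrs_mono (erase_subset _ _))).2 ⟨y, ?_, ?_⟩
      · exact mem_nbrs.2 ⟨hy, hzy.1⟩
      · simp
    have h4 := card_lt_card h3
    omega
  obtain ⟨hbC, hbS⟩ := mem_sdiff.1 hb
  have hzA : z ∈ part P c S := mem_part.2 ⟨hz, hzS⟩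
  have hyA : y ∉ (part P c S).erase z := fun h => hyS (mem_part.1 (mem_of_mem_erase h)).2
  have hp₁ : ProperOn G (insert y ((part P c S).erase z)) (Function.update c y (c z)) := by
    refine ProperOn.insert_update (h.proper.mono fun x hx => ?_) fun x hx hxc _ hadj => ?_
    · exact (mem_part.1 (mem_of_mem_erase (mem_of_mem_erase hx))).1
    · exact (ne_of_mem_erase hx) (hzy.2 x (mem_part.1 (mem_of_mem_erase hx)).1 hxc hadj)
  have hp₂ : ProperOn G (insert z (B.erase y)) (Function.update g z b) :=
    ProperOn.insert_update (hgp.mono (erase_subset _ _)) fun x hx hxb _ => hbz x hx hxb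
  have hg₂ : ∀ x ∈ insert z (B.erase y), Function.update g z b x ∈ C \ S := by
    intro x hx
    by_cases hxz : x = z
    · rw [hxz, Function.update_self]; exact hb
    · rw [Function.update_of_ne hxz]
      exact hgC x (mem_of_mem_insert_of_ne hx hxz)
  obtain ⟨f, hfp, hf₁, hf₂, hfS, hfC⟩ := ProperOn.glue (P := P) (S := S)
    (P₁ := insert y ((part P c S).erase z)) (P₂ := insert z (B.erase y))
    (by
      intro x
      have := h.mapsTo x
      by_cases hxy : x = y
      · simp [hxy, hyP]
      · by_cases hxz : x = z
        · simp [hxz, hz]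
        · simp only [hBdef, mem_insert, mem_part, mem_erase, mem_sdiff]
          tauto)
    (by
      intro x
      by_cases hxy : x = y
      · simp [hxy, hzy_ne.symm]
      · simp only [hBdef, mem_insert, mem_part, mem_erase, mem_sdiff]
        tauto) hp₁ hp₂
    (by
      intro x hx
      by_cases hxy : x = y
      · rw [hxy, Function.update_self]; exact hzS
      · rw [Function.update_of_ne hxy]
        exact (mem_part.1 (mem_of_mem_erase (mem_of_mem_insert_of_ne hx hxy))).2)
    (fun x hx => (mem_sdiff.1 (hg₂ x hx)).2)
  have hfy : f y = c z := by
    rw [hf₁ y (mem_insert_self _ _), Function.update_self]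
  have hfA : ∀ x ∈ P, c x ∈ S → x ≠ z → f x = c x := by
    intro x hx hxS hxz
    rw [hf₁ x (mem_insert_of_mem (mem_erase.2 ⟨hxz, mem_part.2 ⟨hx, hxS⟩⟩)),
      Function.update_of_ne]
    rintro rfl
    exact hyS hxS
  have hfB : ∀ x ∈ B, x ≠ y → f x = g x := by
    intro x hx hxy
    rw [hf₂ x (mem_insert_of_mem (mem_erase.2 ⟨hxy, hx⟩)), Function.update_of_ne]
    rintro rfl
    exact hzB hx
  have hclass : ∀ j ∈ S, ∀ x, x ∈ P ∧ f x = j ↔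
      x = y ∧ j = c z ∨ x ≠ z ∧ x ∈ P ∧ c x = j := by
    intro j hj x
    rw [← mem_colourClass, hfS j hj, mem_colourClass]
    by_cases hxy : x = y
    · subst hxy
      simp only [mem_insert, true_or, Function.update_self, true_and]
      refine ⟨fun h => Or.inl h.symm, ?_⟩
      rintro (h | h)
      · exact h.symm
      · exact absurd (h.2.2 ▸ hj) hyS
    · simp only [mem_insert, hxy, false_or, mem_erase, mem_part, Function.update_of_ne hxy, ne_eq,
        false_and]
      refine ⟨fun h => ⟨h.1.1, h.1.2.1, h.2⟩, fun h => ⟨⟨h.1, h.2.1, ?_⟩, h.2.2⟩⟩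
      rw [h.2.2]; exact hj
  have hcongr : ∀ x ∈ P, ∀ j ∈ S.erase (c z), c x = j ↔ f x = j := by
    intro x hx j hj
    obtain ⟨hjz, hjS⟩ := mem_erase.1 hj
    have h1 := hclass j hjS x
    have h2 : c x = j → x ≠ z := by
      rintro rfl rfl
      exact hjz rfl
    tauto
  have hnear : NearlyEquitable G P C s f v b := by
    refine ⟨fun x hx => ?_, hfp, h.small_mem, hbC, ?_, fun j hj => ?_⟩
    · by_contra hxC
      have hxS : f x ∉ S := fun h => hxC (hSC h)
      have hx' : x ∈ colourClass P f (f x) := mem_colourClass.2 ⟨hx, rfl⟩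
      rw [hfC _ hxS, mem_colourClass] at hx'
      have := hg₂ x hx'.1
      rw [hx'.2] at this
      exact hxC (mem_sdiff.1 this).1
    · rintro rfl
      exact hbS h.small_mem_accessible
    · by_cases hjS : j ∈ S
      · rw [hfS j hjS, card_colourClass_insert hyA, card_colourClass_erase c hzA]
        have h1 : colourClass (part P c S) c j = colourClass P c j := by
          ext x
          simp only [mem_colourClass, mem_part]
          refine ⟨fun h => ⟨h.1.1, h.2⟩, fun h => ⟨⟨h.1, ?_⟩, h.2⟩⟩
          rw [h.2]; exact hjS
        have h2 := h.card_class j hj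
        rw [if_neg (fun hjw : j = w => hw (hjw ▸ hjS))] at h2
        rw [h1, h2, if_neg (fun hjb : j = b => hbS (hjb ▸ hjS))]
      · have hzB' : z ∉ B.erase y := fun h => hzB (mem_of_mem_erase h)
        rw [hfC j hjS, card_colourClass_insert hzB', hgs j (mem_sdiff.2 ⟨hj, hjS⟩),
          if_neg (fun hjv : j = v => hjS (hjv ▸ h.small_mem_accessible)), add_zero]
  have hreach : ∀ a ∈ S, a ≠ c z → a ∈ accessible G P C f v := fun a ha haz =>
    mem_accessible.2 ⟨hSC ha, reach_mono ((erase_subset _ _).trans hSC)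
      (reach_congr hcongr (hterm a ha haz))⟩
  have hzacc : c z ∈ accessible G P C f v := by
    obtain ⟨a, ha, ⟨x, hx, hxz, hxa⟩, -⟩ :=
      exists_step_avoiding hzv (reach_of_mem_accessible hzS)
    obtain ⟨haz, haS⟩ := mem_erase.1 ha
    have hxne : x ≠ z := by
      rintro rfl
      obtain ⟨x', hx', hxa', hadj'⟩ := hmov a haS haz
      exact hxa x' hx' hxa' hadj'
    refine mem_accessible_of_movable (hSC hzS) (hreach a haS haz) ⟨x, hx, ?_, ?_⟩
    · rw [hfA x hx (by rw [hxz]; exact hzS) hxne, hxz]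
    · exact fun x' hx' hxa' => hxa x' hx' ((hcongr x' hx' a ha).2 hxa')
  have hgy' : g y' ∈ C \ S := hgC y' (mem_erase.2 ⟨hyy'.symm, hy'⟩)
  refine ⟨f, b, hnear, (ssubset_iff_of_subset fun a ha => ?_).2
    ⟨g y', ?_, (mem_sdiff.1 hgy').2⟩⟩
  · by_cases haz : a = c z
    · rw [haz]; exact hzacc
    · exact hreach a ha haz
  · refine mem_accessible_of_movable (mem_sdiff.1 hgy').1 hzacc
      ⟨y', hyP', hfB y' hy' hyy'.symm, fun x hx hxz hadj' => ?_⟩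
    rcases (hclass (c z) hzS x).1 ⟨hx, hxz⟩ with h1 | h1
    · rw [h1.1] at hadj'
      exact hadj hadj'.symm
    · exact h1.1 (hzy'.2 x hx h1.2.2 hadj')

open scoped Classical in
lemma degree_lt_inaccessible (h : NearlyEquitable G P C s c v w)
    (hdeg : ∀ x ∈ P, #(nbrs G x P) < #C) {y : V}
    (hy : y ∈ part P c (C \ accessible G P C c v)) :
    #(nbrs G y (part P c (C \ accessible G P C c v))) < #(C \ accessible G P C c v) := by
  obtain ⟨hyP, hyC⟩ := mem_part.1 hy
  obtain ⟨hyC, hyS⟩ := mem_sdiff.1 hyC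
  have hSC : accessible G P C c v ⊆ C := fun j hj => (mem_accessible.1 hj).1
  have h1 := h.degree_split hSC y
  have h2 := hdeg y hyP
  have h3 := card_nsmul_le_sum (accessible G P C c v)
    (fun j => #(nbrs G y (colourClass P c j))) 1 fun j hj => one_le_card_nbrs hyP hyC hyS hj
  have h4 := card_sdiff_add_card_eq_card hSC
  rw [smul_eq_mul, mul_one] at h3
  omega

lemma exists_accessible_ne (h : NearlyEquitable G P C s c v w)
    (hw : w ∉ accessible G P C c v) (hdeg : ∀ x ∈ P, #(nbrs G x P) < #C) :
    ∃ a ∈ accessible G P C c v, a ≠ v := by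
  classical
  by_contra! hcon
  have hS : accessible G P C c v = {v} := by
    ext a
    rw [mem_singleton]
    refine ⟨hcon a, ?_⟩
    rintro rfl
    exact h.small_mem_accessible
  have hB := h.card_part_inaccessible hw
  have hq : #(C \ accessible G P C c v) + 1 = #C := by
    have := card_sdiff_add_card_eq_card (fun j hj => (mem_accessible.1 hj).1 :
      accessible G P C c v ⊆ C)
    rwa [hS, card_singleton, ← hS] at this
  have hv := h.card_class v h.small_mem
  rw [if_pos rfl, if_neg h.small_ne_large] at hv
  have h1 := card_nsmul_le_sum (part P c (C \ accessible G P C c v))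
    (fun y => #(nbrs G y (colourClass P c v))) 1 fun y hy =>
      one_le_card_nbrs (mem_part.1 hy).1 (mem_sdiff.1 (mem_part.1 hy).2).1
        (mem_sdiff.1 (mem_part.1 hy).2).2 h.small_mem_accessible
  have h2 := sum_le_card_nsmul (colourClass P c v)
    (fun x => #(nbrs G x (part P c (C \ accessible G P C c v))))
    (#(C \ accessible G P C c v)) fun x hx => by
      have h3 := hdeg x (mem_colourClass.1 hx).1
      have h4 := card_le_card (nbrs_mono (G := G) (x := x)
        (fun y hy => (mem_part.1 hy).1 : part P c (C \ accessible G P C c v) ⊆ P))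
      omega
  rw [sum_card_nbrs_comm] at h1
  have h3 := h1.trans h2
  simp only [smul_eq_mul, mul_one, hB] at h3
  rw [show s = #(colourClass P c v) + 1 by omega] at h3
  nlinarith

open scoped Classical in
/-- A lower bound for the number of solo neighbours, in the classes of `T`, of an inaccessible
vertex. -/
lemma le_card_solo (h : NearlyEquitable G P C s c v w) (hdeg : ∀ x ∈ P, #(nbrs G x P) < #C)
    {T : Finset ι} (hT : T ⊆ accessible G P C c v) {y : V}
    (hy : y ∈ part P c (C \ accessible G P C c v)) :
    #(nbrs G y (part P c (C \ accessible G P C c v))) + #T + 1 ≤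
      #(C \ accessible G P C c v) + #((part P c T).filter fun z => IsSolo G P c z y) := by
  set S := accessible G P C c v with hS
  obtain ⟨hyP, hyC⟩ := mem_part.1 hy
  obtain ⟨hyC, hyS⟩ := mem_sdiff.1 hyC
  have hSC : S ⊆ C := fun j hj => (mem_accessible.1 hj).1
  have h1 : ∀ j ∈ S, 1 + (if j ∈ T then 1 else 0) ≤ #(nbrs G y (colourClass P c j)) +
      (if j ∈ T then #((colourClass P c j).filter fun z => IsSolo G P c z y) else 0) := by
    intro j hj
    have h2 := one_le_card_nbrs hyP hyC hyS hj
    split_ifs with hjT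
    · by_cases h3 : #(nbrs G y (colourClass P c j)) = 1
      · obtain ⟨z, hz⟩ := card_eq_one.1 h3
        have hzW : z ∈ nbrs G y (colourClass P c j) := by simp [hz]
        obtain ⟨hzj, hyz⟩ := mem_nbrs.1 hzW
        have : 0 < #((colourClass P c j).filter fun z => IsSolo G P c z y) := by
          refine card_pos.2 ⟨z, mem_filter.2 ⟨hzj, hyz.symm, fun x hx hxz hyx => ?_⟩⟩
          have hxW : x ∈ nbrs G y (colourClass P c j) :=
            mem_nbrs.2 ⟨mem_colourClass.2 ⟨hx, hxz.trans (mem_colourClass.1 hzj).2⟩, hyx⟩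
          simpa [hz] using hxW
        omega
      · omega
    · omega
  have h2 := sum_le_sum h1
  rw [sum_add_distrib, sum_add_distrib, sum_ite_mem, sum_ite_mem, inter_eq_right.2 hT,
    ← card_filter_part] at h2
  simp only [sum_const, smul_eq_mul, mul_one] at h2
  have h3 := h.degree_split hSC y
  have h4 := hdeg y hyP
  have h5 := card_sdiff_add_card_eq_card hSC
  omega

open scoped Classical in
/-- If the large class is inaccessible, there is an equitable colouring, or a nearly equitable one
with more accessible classes. -/
lemma equitable_or_exists_more_accessible (h : NearlyEquitable G P C s c v w)
    (hw : w ∉ accessible G P C c v) (hdeg : ∀ x ∈ P, #(nbrs G x P) < #C)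
    (hB : ∀ y ∈ part P c (C \ accessible G P C c v),
      Equitable G ((part P c (C \ accessible G P C c v)).erase y)
        (C \ accessible G P C c v) s) :
    Equitable G P C s ∨ ∃ f : V → ι, ∃ b, NearlyEquitable G P C s f v b ∧
      accessible G P C c v ⊂ accessible G P C f v := by
  by_contra! hcon
  obtain ⟨hne, hmore⟩ := hcon
  obtain ⟨u, hu, T, hTS, huT, hvT, hTne, hterm, hout⟩ := exists_terminal_set
    h.small_mem_accessible (fun a ha => reach_of_mem_accessible ha) (h.exists_accessible_ne hw hdeg)
  have hSC : accessible G P C c v ⊆ C := fun j hj => (mem_accessible.1 hj).1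
  have hSc := card_sdiff_add_card_eq_card hSC
  have hcardB := h.card_part_inaccessible hw
  -- Solo vertices in the classes of `T` cannot be moved.
  have hmov : ∀ z ∈ P, c z ∈ T → ∀ y ∈ part P c (C \ accessible G P C c v), IsSolo G P c z y →
      ∀ a ∈ accessible G P C c v, a ≠ c z → ∃ x ∈ P, c x = a ∧ G.Adj z x := by
    intro z hz hzT y hy hzy a ha haz
    by_contra! hza
    exact hne (h.equitable_of_movable_solo hw hB hz (hTS hzT) hy hzy ha haz hza
      (hterm _ hzT a ha haz))
  have hdegA : ∀ z ∈ P, c z ∈ T → #(nbrs G z (part P c (C \ accessible G P C c v))) ≤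
      #(C \ accessible G P C c v) + #T := by
    intro z hz hzT
    have h1 := h.degree_split hSC z
    have h2 := hdeg z hz
    have h3 : #((accessible G P C c v).erase u \ T) ≤
        ∑ j ∈ accessible G P C c v, #(nbrs G z (colourClass P c j)) := by
      have h4 := card_nsmul_le_sum ((accessible G P C c v).erase u \ T)
        (fun j => #(nbrs G z (colourClass P c j))) 1 fun j hj => by
          obtain ⟨hj, hjT⟩ := mem_sdiff.1 hj
          obtain ⟨hju, hjS⟩ := mem_erase.1 hj
          by_contra hlt
          refine hout _ hzT j hjS hju hjT ⟨z, hz, rfl, fun x hx hxj hzx => hlt ?_⟩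
          exact card_pos.2 ⟨x, mem_nbrs.2 ⟨mem_colourClass.2 ⟨hx, hxj⟩, hzx⟩⟩
      rw [smul_eq_mul, mul_one] at h4
      exact h4.trans (sum_le_sum_of_subset (sdiff_subset.trans (erase_subset _ _)))
    have h4 := card_sdiff_add_card_eq_card
      (fun j hj => mem_erase.2 ⟨fun hju => huT (hju ▸ hj), hTS hj⟩ :
        T ⊆ (accessible G P C c v).erase u)
    have h5 := card_erase_add_one hu
    omega
  have hdegSolo : ∀ z ∈ P, c z ∈ T → ∀ y ∈ part P c (C \ accessible G P C c v),
      IsSolo G P c z y → #(nbrs G z (part P c (C \ accessible G P C c v))) ≤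
        #(C \ accessible G P C c v) := by
    intro z hz hzT y hy hzy
    have h1 := h.degree_split hSC z
    have h2 := hdeg z hz
    have h3 : #((accessible G P C c v).erase (c z)) ≤
        ∑ j ∈ accessible G P C c v, #(nbrs G z (colourClass P c j)) := by
      have h4 := card_nsmul_le_sum ((accessible G P C c v).erase (c z))
        (fun j => #(nbrs G z (colourClass P c j))) 1 fun j hj => by
          obtain ⟨hjz, hjS⟩ := mem_erase.1 hj
          obtain ⟨x, hx, hxj, hzx⟩ := hmov z hz hzT y hy hzy j hjS hjz
          exact card_pos.2 ⟨x, mem_nbrs.2 ⟨mem_colourClass.2 ⟨hx, hxj⟩, hzx⟩⟩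
      rw [smul_eq_mul, mul_one] at h4
      exact h4.trans (sum_le_sum_of_subset (erase_subset _ _))
    have h5 := card_erase_add_one (hTS hzT)
    omega
  have hcardT : ∀ j ∈ T, #(colourClass P c j) = s := by
    intro j hj
    have h1 := h.card_class j (hSC (hTS hj))
    rwa [if_neg (fun hjv : j = v => hvT (hjv ▸ hj)),
      if_neg (fun hjw : j = w => hw (hjw ▸ hTS hj))] at h1
  have hqt : #(C \ accessible G P C c v) < #T := by
    obtain ⟨j, hj⟩ := hTne
    refine lt_of_solo_degree (G := G) (hcardT j hj) hcardB (fun y hy => ?_) (fun z hz => ?_)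
      fun z hz y hy hzy huniq => ?_
    · exact one_le_card_nbrs (mem_part.1 hy).1 (mem_sdiff.1 (mem_part.1 hy).2).1
        (mem_sdiff.1 (mem_part.1 hy).2).2 (hTS hj)
    · obtain ⟨hzP, hzj⟩ := mem_colourClass.1 hz
      exact hdegA z hzP (hzj ▸ hj)
    · obtain ⟨hzP, hzj⟩ := mem_colourClass.1 hz
      exact hdegSolo z hzP (hzj ▸ hj) y hy ⟨hzy, fun x hx hxz hyx =>
        huniq x (mem_colourClass.2 ⟨hx, hxz.trans hzj⟩) hyx⟩
  refine false_of_solo_cliques (A := part P c T) (s := s) (σ := IsSolo G P c)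
    (d := fun y => #(nbrs G y (part P c (C \ accessible G P C c v)))) hqt ?_ hcardB
    (fun y hy => h.degree_lt_inaccessible hdeg hy) (fun y hy => h.le_card_solo hdeg hTS hy) ?_
  · rw [card_part, sum_congr rfl hcardT, sum_const, smul_eq_mul, mul_comm]
  · intro z hzA y hy hzy
    obtain ⟨hz, hzT⟩ := mem_part.1 hzA
    rw [← card_insert_of_notMem (a := y) (s := nbrs G y _) (by simp)]
    refine card_le_card fun y' hy' => ?_
    obtain ⟨hy', hzy'⟩ := mem_filter.1 hy'
    by_contra hmem
    rw [mem_insert, mem_nbrs, not_or, not_and] at hmem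
    obtain ⟨f, b, hf, hlt⟩ := h.exists_more_accessible hw hB hz (hTS hzT)
      (fun hzv => hvT (hzv ▸ hzT)) hy hzy hy' hzy' (Ne.symm hmem.1) (hmem.2 hy')
      (hmov z hz hzT y hy hzy) (hdegSolo z hz hzT y hy hzy) (hterm _ hzT)
    exact hmore f b hf hlt

open scoped Classical in
/-- Nearly equitable colourings can be made equitable, provided that smaller vertex sets have
equitable colourings. -/
lemma equitable {v w : ι} {c : V → ι} (h : NearlyEquitable G P C s c v w)
    (hdeg : ∀ x ∈ P, #(nbrs G x P) < #C)
    (hind : ∀ (P' : Finset V) (C' : Finset ι), P' ⊆ P →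
      (∃ x ∈ P, ∃ y ∈ P', x ∉ P' ∧ G.Adj x y) → #P' = s * #C' →
      (∀ x ∈ P', #(nbrs G x P') < #C') → Equitable G P' C' s) : Equitable G P C s := by
  induction hn : #(C \ accessible G P C c v) using Nat.strong_induction_on generalizing c w with
  | _ n ih =>
  by_cases hw : w ∈ accessible G P C c v
  · exact h.equitable_of_large_mem hw
  have hSC : ∀ f : V → ι, accessible G P C f v ⊆ C := fun f j hj => (mem_accessible.1 hj).1
  have hcardB := h.card_part_inaccessible hw
  have hspos : 0 < s := by
    have hv := h.card_class v h.small_mem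
    rw [if_pos rfl, if_neg h.small_ne_large] at hv
    omega
  have hqpos : 0 < #(C \ accessible G P C c v) :=
    card_pos.2 ⟨w, mem_sdiff.2 ⟨h.large_mem, hw⟩⟩
  have hB : ∀ y ∈ part P c (C \ accessible G P C c v),
      Equitable G ((part P c (C \ accessible G P C c v)).erase y)
        (C \ accessible G P C c v) s := by
    intro y hy
    have hsub : (part P c (C \ accessible G P C c v)).erase y ⊆ P :=
      fun x hx => (mem_part.1 (mem_of_mem_erase hx)).1
    have hcard : #((part P c (C \ accessible G P C c v)).erase y) =
        s * #(C \ accessible G P C c v) := by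
      rw [card_erase_of_mem hy, hcardB, Nat.add_sub_cancel]
    refine hind _ _ hsub ?_ hcard fun x hx => ?_
    · obtain ⟨y', hy'⟩ : ((part P c (C \ accessible G P C c v)).erase y).Nonempty := by
        rw [← card_pos, hcard]
        positivity
      obtain ⟨hyP', hyC'⟩ := mem_part.1 (mem_of_mem_erase hy')
      obtain ⟨hyC', hyS'⟩ := mem_sdiff.1 hyC'
      obtain ⟨x, hx⟩ := card_pos.1 (one_le_card_nbrs hyP' hyC' hyS' h.small_mem_accessible)
      obtain ⟨hx, hyx⟩ := mem_nbrs.1 hx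
      obtain ⟨hxP, hxv⟩ := mem_colourClass.1 hx
      refine ⟨x, hxP, y', hy', fun hxB => ?_, hyx.symm⟩
      refine (mem_sdiff.1 (mem_part.1 (mem_of_mem_erase hxB)).2).2 ?_
      rw [hxv]
      exact h.small_mem_accessible
    · exact (card_le_card (nbrs_mono (erase_subset _ _))).trans_lt
        (h.degree_lt_inaccessible hdeg (mem_of_mem_erase hx))
  rcases h.equitable_or_exists_more_accessible hw hdeg hB with hE | ⟨f, b, hf, hlt⟩
  · exact hE
  · refine ih _ ?_ hf rfl
    rw [← hn]
    have h1 := card_sdiff_add_card_eq_card (hSC c)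
    have h2 := card_sdiff_add_card_eq_card (hSC f)
    have h3 := card_lt_card hlt
    omega

end NearlyEquitable

/-- A set of `s * #C` vertices can be split into classes of size `s` indexed by `C`. -/
lemma exists_colourClass_card_eq [Nonempty ι] (P : Finset V) (C : Finset ι) (s : ℕ)
    (hP : #P = s * #C) :
    ∃ c : V → ι, (∀ x ∈ P, c x ∈ C) ∧ ∀ j ∈ C, #(colourClass P c j) = s := by
  classical
  induction C using Finset.induction_on generalizing P with
  | empty =>
    rw [card_empty, mul_zero, card_eq_zero] at hP
    subst hP
    exact ⟨fun _ => Classical.arbitrary ι, by simp, by simp⟩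
  | insert a C ha ih =>
    rw [card_insert_of_notMem ha, mul_add, mul_one] at hP
    obtain ⟨Q, hQ, hQs⟩ := exists_subset_card_eq (show s ≤ #P by omega)
    obtain ⟨c, hc, hcs⟩ := ih (P \ Q) (by rw [card_sdiff_of_subset hQ]; omega)
    refine ⟨fun x => if x ∈ Q then a else c x, fun x hx => ?_, fun j hj => ?_⟩
    · by_cases hxQ : x ∈ Q
      · simp [hxQ]
      · simpa [hxQ] using Or.inr (hc x (mem_sdiff.2 ⟨hx, hxQ⟩))
    · by_cases hja : j = a
      · subst hja
        rw [← hQs]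
        congr 1
        ext x
        by_cases hxQ : x ∈ Q
        · simp [hxQ, hQ hxQ]
        · simp only [mem_colourClass, hxQ, if_false, iff_false, not_and]
          rintro hx rfl
          exact ha (hc x (mem_sdiff.2 ⟨hx, hxQ⟩))
      · rw [← hcs j (mem_of_mem_insert_of_ne hj hja)]
        congr 1
        ext x
        by_cases hxQ : x ∈ Q
        · simp [hxQ, Ne.symm hja]
        · simp [hxQ]

open scoped Classical in
/-- The **Hajnal–Szemerédi theorem** for vertex sets whose size is a multiple of the number of
colours; `Q` contains all non-isolated vertices. -/
theorem exists_equitable_of_support [Nonempty ι] (Q : Finset V) :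
    ∀ {G : SimpleGraph V} {P : Finset V} {C : Finset ι} {s : ℕ},
      (∀ x ∈ P, ∀ y ∈ P, G.Adj x y → x ∈ Q) → #P = s * #C →
      (∀ x ∈ P, #(nbrs G x P) < #C) → Equitable G P C s := by
  induction Q using Finset.strongInduction with
  | H Q ih =>
  intro G P C s hQ hcard hdeg
  by_cases hedge : ∃ u ∈ P, ∃ y ∈ P, G.Adj u y
  swap
  · obtain ⟨c, hc, hcs⟩ := exists_colourClass_card_eq P C s hcard
    exact ⟨c, hc, fun x hx y hy hxy => absurd ⟨x, hx, y, hy, hxy⟩ hedge, hcs⟩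
  obtain ⟨u, hu, y₀, hy₀, huy₀⟩ := hedge
  let G' : SimpleGraph V :=
    { Adj := fun x y => G.Adj x y ∧ x ≠ u ∧ y ≠ u
      symm := ⟨fun _ _ h => ⟨h.1.symm, h.2.2, h.2.1⟩⟩
      loopless := ⟨fun _ h => h.1.ne rfl⟩ }
  obtain ⟨c, hc, hp, hcs⟩ := ih (Q.erase u) (erase_ssubset (hQ u hu y₀ hy₀ huy₀)) (G := G') (P := P)
    (C := C) (s := s) (fun x hx y hy h => mem_erase.2 ⟨h.2.1, hQ x hx y hy h.1⟩) hcard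
    (fun x hx => (card_le_card fun y hy =>
      mem_nbrs.2 ⟨((mem_nbrs (G := G')).1 hy).1, ((mem_nbrs (G := G')).1 hy).2.1⟩).trans_lt
      (hdeg x hx))
  have hp' : ProperOn G (P.erase u) c := fun x hx y hy hxy =>
    hp x (mem_of_mem_erase hx) y (mem_of_mem_erase hy)
      ⟨hxy, ne_of_mem_erase hx, ne_of_mem_erase hy⟩
  obtain ⟨a, ha, hua⟩ : ∃ a ∈ C, ∀ x ∈ P, c x = a → ¬ G.Adj u x := by
    by_contra! hcon
    have h1 : C ⊆ (nbrs G u P).image c := by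
      intro b hb
      obtain ⟨x, hx, hxb, hux⟩ := hcon b hb
      exact mem_image.2 ⟨x, mem_nbrs.2 ⟨hx, hux⟩, hxb⟩
    exact (((card_le_card h1).trans card_image_le).trans_lt (hdeg u hu)).false
  have hp₁ : ProperOn G P (Function.update c u a) := by
    have h := hp'.insert_update fun x hx hxa _ => hua x hx hxa
    rwa [insert_eq_of_mem hu] at h
  by_cases hau : a = c u
  · rw [hau, Function.update_eq_self] at hp₁
    exact ⟨c, hc, hp₁, hcs⟩
  have hnear : NearlyEquitable G P C s (Function.update c u a) (c u) a := by
    refine ⟨fun x hx => ?_, hp₁, hc u hu, ha, Ne.symm hau, fun j hj => ?_⟩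
    · by_cases hxu : x = u
      · rw [hxu, Function.update_self]; exact ha
      · rw [Function.update_of_ne hxu]; exact hc x hx
    · rw [card_colourClass_update hu, hcs j hj]
  refine hnear.equitable hdeg fun P' C' hP' hex hcard' hdeg' => ?_
  obtain ⟨x, hx, y, hy, hxP', hxy⟩ := hex
  refine ih (Q.filter (· ∈ P')) ?_ (fun x hx y hy hxy => mem_filter.2
    ⟨hQ x (hP' hx) y (hP' hy) hxy, hx⟩) hcard' hdeg'
  exact filter_ssubset.2 ⟨x, hQ x hx y (hP' hy) hxy, hxP'⟩

/-- The **Hajnal–Szemerédi theorem** for vertex sets whose size is a multiple of the number of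
colours. -/
theorem exists_equitable [Nonempty ι] {G : SimpleGraph V} {P : Finset V} {C : Finset ι} {s : ℕ}
    (hcard : #P = s * #C) (hdeg : ∀ x ∈ P, #(nbrs G x P) < #C) : Equitable G P C s :=
  exists_equitable_of_support P (fun _ hx _ _ _ => hx) hcard hdeg

/-- The **Hajnal–Szemerédi theorem**: if all degrees in `G[P]` are less than `t`, then `P` has a
proper colouring with `t` colours whose class sizes differ by at most one. -/
theorem exists_proper_card_le_succ {G : SimpleGraph V} {P : Finset V} {t : ℕ} (ht : 1 ≤ t)
    (hdeg : ∀ x ∈ P, #(nbrs G x P) < t) :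
    ∃ c : V → Fin t, ProperOn G P c ∧
      ∀ i j, #(colourClass P c i) ≤ #(colourClass P c j) + 1 := by
  classical
  have : Nonempty (Fin t) := ⟨⟨0, ht⟩⟩
  have hdiv := Nat.div_add_mod #P t
  have hmod := Nat.mod_lt #P ht
  obtain ⟨p, hp, hpt⟩ : ∃ p, #P + p = (#P / t + 1) * t ∧ p ≤ t :=
    ⟨t - #P % t, by rw [add_mul, one_mul, mul_comm]; omega, Nat.sub_le _ _⟩
  obtain ⟨c, -, hc, hcs⟩ := exists_equitable (G := G ⊕g (⊤ : SimpleGraph (Fin p)))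
    (P := P.disjSum univ) (C := (univ : Finset (Fin t))) (s := #P / t + 1)
    (by rw [card_disjSum, card_fin, card_fin, hp]) (by
      rw [card_fin]
      rintro (x | i) hx
      · refine lt_of_le_of_lt ?_ (hdeg x (by simpa using hx))
        rw [← card_map (Function.Embedding.inl : V ↪ V ⊕ Fin p)]
        refine card_le_card ?_
        rintro (y | j) hy
        · simpa using hy
        · simp at hy
      · have h1 : nbrs (G ⊕g (⊤ : SimpleGraph (Fin p))) (Sum.inr i) (P.disjSum univ) ⊆
            (univ.erase i).map Function.Embedding.inr := by
          rintro (y | j) hy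
          · simp at hy
          · simpa [eq_comm] using hy
        have h2 := card_le_card h1
        have h3 := card_erase_add_one (mem_univ i)
        rw [card_fin] at h3
        rw [card_map] at h2
        omega)
  refine ⟨fun x => c (Sum.inl x), fun x hx y hy hxy => hc _ (inl_mem_disjSum.2 hx) _
    (inl_mem_disjSum.2 hy) (by simpa using hxy), ?_⟩
  have hsplit : ∀ i, colourClass (P.disjSum univ) c i =
      (colourClass P (fun x => c (Sum.inl x)) i).disjSum
        (colourClass univ (fun k => c (Sum.inr k)) i) := by
    intro i
    ext (x | k) <;> simp
  have hone : ∀ i, #(colourClass univ (fun k => c (Sum.inr k)) i) ≤ 1 := by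
    intro i
    refine card_le_one.2 fun k hk l hl => ?_
    by_contra hkl
    exact hc (Sum.inr k) (by simp) (Sum.inr l) (by simp) (by simpa using hkl)
      ((mem_colourClass.1 hk).2.trans (mem_colourClass.1 hl).2.symm)
  intro i j
  have hi := hcs i (mem_univ i)
  have hj := hcs j (mem_univ j)
  rw [hsplit, card_disjSum] at hi hj
  have := hone i
  have := hone j
  omega

end Main

end HajnalSzemeredi

/-- the vertex set of a `t`-plex can be partitioned into `t` cliques whose sizes
pairwise differ by at most one (Hajnal–Szemerédi applied to the complement). -/
theorem stmt_5 {V : Type*} [Fintype V] [DecidableEq V] (G : SimpleGraph V) [DecidableRel G.Adj]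
    (t : ℕ) (ht : 1 ≤ t) (P : Finset V) (hP : G.IsPlex t P) :
    ∃ Vs : Fin t → Finset V,
      (∀ i j, i ≠ j → Disjoint (Vs i) (Vs j)) ∧
      Finset.univ.biUnion Vs = P ∧
      (∀ i, G.IsClique (Vs i : Set V)) ∧
      (∀ i j, (Vs i).card ≤ (Vs j).card + 1) := by
  obtain ⟨c, hc, hcard⟩ := HajnalSzemeredi.exists_proper_card_le_succ (G := Gᶜ) (P := P) ht
    fun x hx => by
      refine lt_of_le_of_lt ((Finset.card_le_card fun y hy => ?_).trans (hP x hx))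
        (Nat.sub_lt ht one_pos)
      obtain ⟨hy, hxy⟩ := HajnalSzemeredi.mem_nbrs.1 hy
      rw [SimpleGraph.compl_adj] at hxy
      exact Finset.mem_filter.2 ⟨Finset.mem_erase.2 ⟨hxy.1.symm, hy⟩, hxy.2⟩
  refine ⟨HajnalSzemeredi.colourClass P c, fun i j hij => ?_, ?_, fun i x hx y hy hxy => ?_, hcard⟩
  · refine Finset.disjoint_left.2 fun x hx hx' => hij ?_
    exact (HajnalSzemeredi.mem_colourClass.1 hx).2.symm.trans
      (HajnalSzemeredi.mem_colourClass.1 hx').2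
  · ext x
    simp
  · obtain ⟨hx, hxi⟩ := HajnalSzemeredi.mem_colourClass.1 hx
    obtain ⟨hy, hyi⟩ := HajnalSzemeredi.mem_colourClass.1 hy
    by_contra hadj
    exact hc x hx y hy ((SimpleGraph.compl_adj G x y).2 ⟨hxy, hadj⟩) (hxi.trans hyi.symm)
end
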